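/- Let S : ℝ² → ℝ be real analytic with ∂_x∂_y S not identically zero near the origin. Let c_{p,q} := ∂_x^p ∂_y^q (∂_x∂_y S)(0,0)/(p! q!) be the Taylor coefficients of ∂_x∂_y S at the origin, let 𝒩 ⊆ ℝ² be the convex hull of the union of the quadrants (p,q) + [0,∞)² over all (p,q) ∈ ℕ² with c_{p,q} ≠ 0, and set δ_S := 1 + inf{ t ∈ ℝ : (t,t) ∈ 𝒩 }. Then there exists ε > 0 such that for every smooth a : ℝ² → ℂ supported in {(x,y) : |x| < ε, |y| < ε} there is a constant C such that for every real λ with |λ| ≥ 1 and every f ∈ L²(ℝ): ‖ x ↦ ∫_ℝ e^{iλS(x,y)} f(y) a(x,y) dy ‖_{L²} ≤ C |λ|^{−1/(2δ_S)} ‖f‖_{L²}. -/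

import Mathlib

open MeasureTheory

noncomputable section

/-- Partial derivative in the first variable. -/
def pdx (f : ℝ × ℝ → ℝ) : ℝ × ℝ → ℝ := fun p => deriv (fun t => f (t, p.2)) p.1

/-- Partial derivative in the second variable. -/
def pdy (f : ℝ × ℝ → ℝ) : ℝ × ℝ → ℝ := fun p => deriv (fun t => f (p.1, t)) p.2

/-- Taylor coefficient `c_{p,q} = ∂ₓ^p ∂_y^q P(0,0) / (p! q!)`. -/
def taylorCoef (P : ℝ × ℝ → ℝ) (p q : ℕ) : ℝ :=
  (pdx^[p] (pdy^[q] P)) (0, 0) / ((Nat.factorial p : ℝ) * (Nat.factorial q : ℝ))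

/-- The union of the quadrants `(p,q) + [0,∞)²` over the pairs `(p,q)` with
nonzero Taylor coefficient: the Newton polyhedron of `P` is its convex hull. -/
def newtonQuadrants (P : ℝ × ℝ → ℝ) : Set (ℝ × ℝ) :=
  {z : ℝ × ℝ | ∃ p q : ℕ, taylorCoef P p q ≠ 0 ∧ (p : ℝ) ≤ z.1 ∧ (q : ℝ) ≤ z.2}

/-! ### One dimensional lemmas -/

def Chn (f : ℕ → ℝ → ℝ) : Prop := ∀ k x, HasDerivAt (f k) (f (k+1) x) x

lemma Chn.cont {f : ℕ → ℝ → ℝ} (hf : Chn f) (k : ℕ) : Continuous (f k) :=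
  continuous_iff_continuousAt.2 fun x => (hf k x).continuousAt

lemma Chn.shift {f : ℕ → ℝ → ℝ} (hf : Chn f) (j : ℕ) : Chn (fun k => f (k + j)) := by
  intro k x
  have := hf (k + j) x
  rwa [show k + j + 1 = k + 1 + j by ring] at this

lemma Chn.lin {f g : ℕ → ℝ → ℝ} (hf : Chn f) (hg : Chn g) (c : ℝ) :
    Chn (fun k x => f k x + c * g k x) := by
  intro k x
  exact (hf k x).add ((hg k x).const_mul c)

lemma Chn.mvt {f : ℕ → ℝ → ℝ} (hf : Chn f) (k : ℕ) {x y : ℝ} (h : x ≤ y) :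
    ∃ z ∈ Set.Icc x y, f k y - f k x = f (k+1) z * (y - x) := by
  rcases h.eq_or_lt with h | h
  · subst h; exact ⟨x, by simp, by simp⟩
  · obtain ⟨z, hz, e⟩ := exists_hasDerivAt_eq_slope (f k) (f (k+1)) h (hf.cont k).continuousOn
      (fun z _ => hf k z)
    refine ⟨z, Set.Ioo_subset_Icc_self hz, ?_⟩
    rw [e]; field_simp [sub_ne_zero.2 h.ne']

lemma zeros_fin (n : ℕ) : ∀ f : ℕ → ℝ → ℝ, Chn f → ∀ p q : ℝ,
    (∀ x ∈ Set.Icc p q, f n x ≠ 0) →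
    ∃ Z : Finset ℝ, Z.card ≤ n ∧ ∀ x ∈ Set.Icc p q, f 0 x = 0 → x ∈ Z := by
  induction n with
  | zero => 
    intro f hf p q h
    exact ⟨∅, by simp, fun x hx h0 => absurd h0 (h x hx)⟩
  | succ n ih =>
    intro f hf p q h
    obtain ⟨T, hT, hT2⟩ := ih _ (hf.shift 1) p q h
    have key : ∀ s : Finset ℝ, (s : Set ℝ) ⊆ {x | x ∈ Set.Icc p q ∧ f 0 x = 0} →
        s.card ≤ n + 1 := by
      intro s hs
      refine (Finset.card_le_of_interleaved (t := T) ?_).trans (by omega)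
      intro x hx y hy hxy _
      obtain ⟨z, hz, e⟩ := exists_hasDerivAt_eq_zero (f := f 0) (f' := f 1) hxy
        (hf.cont 0).continuousOn ((hs hx).2.trans (hs hy).2.symm) (fun z _ => hf 0 z)
      exact ⟨z, hT2 z ⟨(hs hx).1.1.trans hz.1.le, hz.2.le.trans (hs hy).1.2⟩ e, hz.1, hz.2⟩
    have hfin : {x | x ∈ Set.Icc p q ∧ f 0 x = 0}.Finite := by
      by_contra hinf
      obtain ⟨t, ht, ht2⟩ := (Set.not_finite.1 hinf : Set.Infinite _).exists_subset_card_eq (n+2)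
      have := key t ht
      omega
    refine ⟨hfin.toFinset, key _ (by simp), fun x hx h0 => by simp [h0, hx.1, hx.2]⟩

/-- constant sign on an interval whose interior has no zero -/
lemma sign_const {g : ℝ → ℝ} (hg : Continuous g) {p q : ℝ} 
    (h : ∀ x ∈ Set.Ioo p q, g x ≠ 0) :
    (∀ x ∈ Set.Icc p q, 0 ≤ g x) ∨ (∀ x ∈ Set.Icc p q, g x ≤ 0) := by
  by_contra hc
  push Not at hc
  obtain ⟨⟨x, hx, hx2⟩, ⟨y, hy, hy2⟩⟩ := hc
  rcases lt_trichotomy x y with hxy | hxy | hxy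
  · obtain ⟨z, hz, e⟩ := intermediate_value_Ioo hxy.le hg.continuousOn ⟨hx2, hy2⟩
    exact h z ⟨hx.1.trans_lt hz.1, hz.2.trans_le hy.2⟩ e
  · subst hxy; linarith
  · obtain ⟨z, hz, e⟩ := intermediate_value_Ioo' hxy.le hg.continuousOn ⟨hx2, hy2⟩
    exact h z ⟨hy.1.trans_lt hz.1, hz.2.trans_le hx.2⟩ e

lemma SL (j : ℕ) : ∃ c > (0:ℝ), ∀ f : ℕ → ℝ → ℝ, Chn f → ∀ p q m : ℝ, p ≤ q → 0 ≤ m →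
    (∀ x ∈ Set.Icc p q, m ≤ |f j x|) → ∃ x ∈ Set.Icc p q, c * m * (q - p)^j ≤ |f 0 x| := by
  induction j with
  | zero => exact ⟨1, one_pos, fun f hf p q m hpq hm h => ⟨p, ⟨le_rfl, hpq⟩, by
      simpa using h p ⟨le_rfl, hpq⟩⟩⟩
  | succ j ih =>
    obtain ⟨c, hc, H⟩ := ih
    refine ⟨c / 4^(j+1), by positivity, ?_⟩
    intro f hf p q m hpq hm h
    set l := q - p with hl
    have hl0 : 0 ≤ l := by simp [hl, hpq]
    have hdich : (∀ x ∈ Set.Icc p (p + l/4), m * l / 4 ≤ |f j x|) ∨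
        (∀ x ∈ Set.Icc (q - l/4) q, m * l / 4 ≤ |f j x|) := by
      by_contra hcon
      push Not at hcon
      obtain ⟨⟨x, hx, hx2⟩, ⟨y, hy, hy2⟩⟩ := hcon
      have hxy : l / 2 ≤ y - x := by
        have := hx.2; have := hy.1; linarith
      obtain ⟨z, hz, e⟩ := hf.mvt j (x := x) (y := y) (by linarith)
      have h1 := h z ⟨hx.1.trans hz.1, hz.2.trans hy.2⟩
      have h2 : |f j y - f j x| = |f (j+1) z| * (y - x) := by
        rw [e, abs_mul, abs_of_nonneg (by linarith : 0 ≤ y - x)]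
      have h3 : m * (l/2) ≤ |f (j+1) z| * (y - x) := by
        gcongr
      have h4 := abs_sub (f j y) (f j x)
      linarith
    have e4 : c / 4^(j+1) * m * l^(j+1) = c * (m * l/4) * (l/4)^j := by
      rw [div_pow]; field_simp; ring
    rw [e4]
    rcases hdich with hd | hd
    · obtain ⟨x, hx, h5⟩ := H f hf p (p+l/4) (m*l/4) (by linarith) (by positivity) hd
      refine ⟨x, ⟨hx.1, hx.2.trans (by linarith)⟩, ?_⟩
      simpa using h5
    · obtain ⟨x, hx, h5⟩ := H f hf (q-l/4) q (m*l/4) (by linarith) (by positivity) hd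
      refine ⟨x, ⟨le_trans (by linarith) hx.1, hx.2⟩, ?_⟩
      simpa using h5

lemma markov (b : ℕ) : ∃ C ≥ (0:ℝ), ∀ f : ℕ → ℝ → ℝ, Chn f → ∀ p q A B : ℝ, p < q → 0 ≤ A → 0 ≤ B →
    (∀ x ∈ Set.Icc p q, |f 0 x| ≤ A) → (∀ x ∈ Set.Icc p q, |f b x| ≤ B) →
    ∀ β ≤ b, ∀ x ∈ Set.Icc p q, |f β x| * (q-p)^β ≤ C * (A + B * (q-p)^b) := by
  induction b with
  | zero =>
    refine ⟨1, zero_le_one, ?_⟩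
    intro f hf p q A B hpq hA hB h0 hb β hβ x hx
    obtain rfl : β = 0 := by omega
    simp; linarith [h0 x hx]
  | succ b ih =>
    obtain ⟨C, hC, H⟩ := ih
    obtain ⟨c, hc, Hc⟩ := SL b
    refine ⟨C * (1 + 1/c) + 1, by positivity, ?_⟩
    intro f hf p q A B hpq hA hB h0 hb β hβ x hx
    have hl : 0 < q - p := sub_pos.2 hpq
    set l := q - p
    rcases Nat.lt_or_ge b β with h | h
    · obtain rfl : β = b + 1 := by omega
      have h1 := hb x hx
      have h2 : |f (b+1) x| * l^(b+1) ≤ B * l^(b+1) := by gcongr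
      have : 0 ≤ C * (1+1/c) * (A + B * l^(b+1)) := by positivity
      linarith
    · obtain ⟨x0, hx0, hmin⟩ := isCompact_Icc.exists_isMinOn (Set.nonempty_Icc.2 hpq.le)
        ((hf.cont b).abs.continuousOn (s := Set.Icc p q))
      obtain ⟨x1, hx1, h1⟩ := Hc f hf p q (|f b x0|) hpq.le (abs_nonneg _) (fun x hx => hmin hx)
      have h2 := h1.trans (h0 x1 hx1)
      have h3 : |f b x0| * l^b ≤ A / c := by
        rw [le_div_iff₀ hc]; linarith
      have h4 : ∀ x ∈ Set.Icc p q, |f b x| ≤ |f b x0| + B * l := by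
        intro x hx
        have : |f b x - f b x0| ≤ B * l := by
          rcases le_total x0 x with h | h
          · obtain ⟨z, hz, e⟩ := hf.mvt b h
            rw [e, abs_mul]
            have := hb z ⟨hx0.1.trans hz.1, hz.2.trans hx.2⟩
            have h6 : |x - x0| ≤ l := by rw [abs_of_nonneg (by linarith)]; linarith [hx.2, hx0.1]
            gcongr
          · obtain ⟨z, hz, e⟩ := hf.mvt b h
            rw [abs_sub_comm, e, abs_mul]
            have := hb z ⟨hx.1.trans hz.1, hz.2.trans hx0.2⟩
            have h6 : |x0 - x| ≤ l := by rw [abs_of_nonneg (by linarith)]; linarith [hx0.2, hx.1]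
            gcongr
        have := abs_sub_abs_le_abs_sub (f b x) (f b x0)
        linarith
      have h5 := H f hf p q A (|f b x0| + B * l) hpq hA (by positivity) h0 h4 β h x hx
      refine h5.trans ?_
      have h6 : A + (|f b x0| + B * l) * l^b ≤ (1 + 1/c) * (A + B * l^(b+1)) := by
        have e1 : (1 + 1/c) * (A + B * l^(b+1)) = A + A / c + B * l^(b+1) + 1/c * (B * l^(b+1)) := by
          ring
        have e2 : 0 ≤ 1/c * (B * l^(b+1)) := by positivity
        have e3 : (|f b x0| + B * l) * l^b = |f b x0| * l^b + B * l^(b+1) := by ring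
        rw [e1, e3]; linarith
      have h7 : 0 ≤ A + B * l^(b+1) := by positivity
      calc C * (A + (|f b x0| + B * l) * l^b) ≤ C * ((1 + 1/c) * (A + B * l^(b+1))) := by gcongr
        _ ≤ _ := by nlinarith

def osc (lam : ℝ) (φ : ℝ → ℝ) (x : ℝ) : ℂ := Complex.exp (Complex.I * lam * φ x)

lemma osc_norm (lam : ℝ) (φ : ℝ → ℝ) (x : ℝ) : ‖osc lam φ x‖ = 1 := by
  unfold osc
  rw [show Complex.I * (lam:ℂ) * (φ x : ℂ) = ((lam * φ x : ℝ) : ℂ) * Complex.I by push_cast; ring]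
  exact Complex.norm_exp_ofReal_mul_I _

lemma osc_deriv {lam : ℝ} {φ : ℕ → ℝ → ℝ} (hφ : Chn φ) (x : ℝ) :
    HasDerivAt (osc lam (φ 0)) (osc lam (φ 0) x * (Complex.I * lam * φ 1 x)) x := by
  have := (((hφ 0 x).ofReal_comp).const_mul (Complex.I * (lam:ℂ))).cexp
  exact this

lemma osc_cont {lam : ℝ} {φ : ℝ → ℝ} (hφ : Continuous φ) : Continuous (osc lam φ) := by
  unfold osc; fun_prop

lemma ibp {lam : ℝ} {φ : ℕ → ℝ → ℝ} (hφ : Chn φ) {w w1 : ℝ → ℂ} {p q : ℝ} (hpq : p ≤ q)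
    (hw : ∀ x ∈ Set.Icc p q, HasDerivAt w (w1 x) x) (hw1 : ContinuousOn w1 (Set.Icc p q))
    (h1 : ∀ x ∈ Set.Icc p q, φ 1 x ≠ 0) :
    Complex.I * lam * ∫ x in p..q, osc lam (φ 0) x * w x =
      w q / φ 1 q * osc lam (φ 0) q - w p / φ 1 p * osc lam (φ 0) p -
      ∫ x in p..q, (w1 x / φ 1 x - w x * φ 2 x / (φ 1 x)^2) * osc lam (φ 0) x := by
  have hu : Set.uIcc p q = Set.Icc p q := Set.uIcc_of_le hpq
  have hne : ∀ x ∈ Set.Icc p q, (φ 1 x : ℂ) ≠ 0 := fun x hx => by exact_mod_cast h1 x hx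
  have hwc : ContinuousOn w (Set.Icc p q) := fun x hx => (hw x hx).continuousAt.continuousWithinAt
  have c1 : Continuous (fun x => (φ 1 x : ℂ)) := Complex.continuous_ofReal.comp (hφ.cont 1)
  have c2 : Continuous (fun x => (φ 2 x : ℂ)) := Complex.continuous_ofReal.comp (hφ.cont 2)
  have key := intervalIntegral.integral_mul_deriv_eq_deriv_mul (a := p) (b := q)
    (u := fun x => w x / φ 1 x) (u' := fun x => w1 x / φ 1 x - w x * φ 2 x / (φ 1 x)^2)
    (v := osc lam (φ 0)) (v' := fun x => osc lam (φ 0) x * (Complex.I * lam * φ 1 x))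
    (by
      rw [hu]; intro x hx
      have := (hw x hx).div ((hφ 1 x).ofReal_comp) (hne x hx)
      refine this.congr_deriv ?_
      have := hne x hx
      norm_num
      field_simp)
    (fun x _ => osc_deriv hφ x)
    (by
      apply ContinuousOn.intervalIntegrable
      rw [hu]
      refine (hw1.div c1.continuousOn hne).sub
        ((hwc.mul c2.continuousOn).div (c1.continuousOn.pow 2) fun x hx => pow_ne_zero 2 (hne x hx)))
    (by
      apply Continuous.intervalIntegrable
      exact (osc_cont (hφ.cont 0)).mul (continuous_const.mul c1))
  rw [← key, ← intervalIntegral.integral_const_mul]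
  apply intervalIntegral.integral_congr
  intro x hx
  rw [hu] at hx
  have := hne x hx
  field_simp

lemma vdc_gen {lam : ℝ} (hl : lam ≠ 0) {φ : ℕ → ℝ → ℝ} (hφ : Chn φ) {w w1 : ℝ → ℂ} {p q : ℝ}
    (hpq : p ≤ q) (hpq1 : q - p ≤ 1) {W m V : ℝ} (hm : 0 < m)
    (hw : ∀ x ∈ Set.Icc p q, HasDerivAt w (w1 x) x) (hw1 : ContinuousOn w1 (Set.Icc p q))
    (hW : ∀ x ∈ Set.Icc p q, ‖w x‖ ≤ W) (hW1 : ∀ x ∈ Set.Icc p q, ‖w1 x‖ ≤ W)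
    (h1 : ∀ x ∈ Set.Icc p q, m ≤ |φ 1 x|)
    (hV : ∫ x in p..q, |φ 2 x| / (φ 1 x)^2 ≤ V) :
    ‖∫ x in p..q, osc lam (φ 0) x * w x‖ ≤ W * (3 / m + V) / |lam| := by
  have hW0 : 0 ≤ W := (norm_nonneg _).trans (hW p ⟨le_rfl, hpq⟩)
  have h1' : ∀ x ∈ Set.Icc p q, φ 1 x ≠ 0 := fun x hx h => by
    have := h1 x hx; rw [h, abs_zero] at this; linarith
  have key := ibp (lam := lam) hφ hpq hw hw1 h1'
  have hlam : 0 < |lam| := abs_pos.2 hl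
  have hq : ∀ x ∈ Set.Icc p q, ‖w x / φ 1 x * osc lam (φ 0) x‖ ≤ W / m := by
    intro x hx
    rw [norm_mul, osc_norm, mul_one, norm_div, Complex.norm_real, Real.norm_eq_abs]
    exact div_le_div₀ hW0 (hW x hx) hm (h1 x hx)
  have hcont : ContinuousOn (fun x => |φ 2 x| / (φ 1 x)^2) (Set.Icc p q) :=
    (hφ.cont 2).abs.continuousOn.div ((hφ.cont 1).pow 2).continuousOn
      (fun x hx => pow_ne_zero 2 (h1' x hx))
  have hint : ‖∫ x in p..q, (w1 x / φ 1 x - w x * φ 2 x / (φ 1 x)^2) * osc lam (φ 0) x‖ ≤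
      W / m + W * V := by
    have hi : IntervalIntegrable (fun x => |φ 2 x| / (φ 1 x)^2) volume p q := by
      apply ContinuousOn.intervalIntegrable; rwa [Set.uIcc_of_le hpq]
    have : ‖∫ x in p..q, (w1 x / φ 1 x - w x * φ 2 x / (φ 1 x)^2) * osc lam (φ 0) x‖ ≤
        ∫ x in p..q, (W / m + W * (|φ 2 x| / (φ 1 x)^2)) := by
      apply intervalIntegral.norm_integral_le_of_norm_le hpq
      · refine Filter.Eventually.of_forall fun x hx => ?_
        have hx := Set.Ioc_subset_Icc_self hx
        rw [norm_mul, osc_norm, mul_one]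
        refine (norm_sub_le _ _).trans (add_le_add ?_ ?_)
        · rw [norm_div, Complex.norm_real, Real.norm_eq_abs]
          exact div_le_div₀ hW0 (hW1 x hx) hm (h1 x hx)
        · rw [norm_div, norm_mul, norm_pow, Complex.norm_real, Complex.norm_real, Real.norm_eq_abs,
            Real.norm_eq_abs, sq_abs, mul_div_assoc]
          gcongr
          exact hW x hx
      · exact (intervalIntegrable_const).add (hi.const_mul W)
    refine this.trans ?_
    rw [intervalIntegral.integral_add intervalIntegrable_const (hi.const_mul W),
      intervalIntegral.integral_const, intervalIntegral.integral_const_mul, smul_eq_mul]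
    have : 0 ≤ W / m := by positivity
    gcongr
    nlinarith
  rw [le_div_iff₀ hlam]
  have e : ‖∫ x in p..q, osc lam (φ 0) x * w x‖ * |lam| =
      ‖Complex.I * lam * ∫ x in p..q, osc lam (φ 0) x * w x‖ := by
    rw [norm_mul, norm_mul, Complex.norm_I, Complex.norm_real, Real.norm_eq_abs]; ring
  rw [e, key]
  have n1 := hq q ⟨hpq, le_rfl⟩
  have n2 := hq p ⟨le_rfl, hpq⟩
  refine (norm_sub_le _ _).trans ?_
  refine (add_le_add (norm_sub_le _ _) hint).trans ?_
  have : W * (3/m+V) = W/m + W/m + (W/m + W*V) := by ring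
  rw [this]; linarith

lemma vdc1 {lam : ℝ} (hl : lam ≠ 0) {φ : ℕ → ℝ → ℝ} (hφ : Chn φ) {w w1 : ℝ → ℂ} {p q : ℝ}
    (hpq : p ≤ q) (hpq1 : q - p ≤ 1) {W m : ℝ} (hm : 0 < m)
    (hw : ∀ x ∈ Set.Icc p q, HasDerivAt w (w1 x) x) (hw1 : ContinuousOn w1 (Set.Icc p q))
    (hW : ∀ x ∈ Set.Icc p q, ‖w x‖ ≤ W) (hW1 : ∀ x ∈ Set.Icc p q, ‖w1 x‖ ≤ W)
    (h1 : ∀ x ∈ Set.Icc p q, m ≤ |φ 1 x|)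
    (h2 : (∀ x ∈ Set.Icc p q, 0 ≤ φ 2 x) ∨ (∀ x ∈ Set.Icc p q, φ 2 x ≤ 0)) :
    ‖∫ x in p..q, osc lam (φ 0) x * w x‖ ≤ W * (5 / m) / |lam| := by
  have h1' : ∀ x ∈ Set.Icc p q, φ 1 x ≠ 0 := fun x hx h => by
    have := h1 x hx; rw [h, abs_zero] at this; linarith
  have hu : Set.uIcc p q = Set.Icc p q := Set.uIcc_of_le hpq
  have hcont : ContinuousOn (fun x => φ 2 x / (φ 1 x)^2) (Set.Icc p q) :=
    (hφ.cont 2).continuousOn.div ((hφ.cont 1).pow 2).continuousOn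
      (fun x hx => pow_ne_zero 2 (h1' x hx))
  have hI : ∫ x in p..q, φ 2 x / (φ 1 x)^2 = (φ 1 p)⁻¹ - (φ 1 q)⁻¹ := by
    have := intervalIntegral.integral_eq_sub_of_hasDerivAt (a := p) (b := q)
      (f := fun x => -(φ 1 x)⁻¹) (f' := fun x => φ 2 x / (φ 1 x)^2) (by
        rw [hu]; intro x hx
        have := ((hφ 1 x).inv (h1' x hx)).neg
        refine this.congr_deriv ?_; norm_num; ring) (by apply ContinuousOn.intervalIntegrable; rwa [hu])
    rw [this]; ring
  have hb : ∀ x ∈ Set.Icc p q, |(φ 1 x)⁻¹| ≤ 1/m := by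
    intro x hx; rw [abs_inv, ← one_div]; exact one_div_le_one_div_of_le hm (h1 x hx)
  have hV : ∫ x in p..q, |φ 2 x| / (φ 1 x)^2 ≤ 2 / m := by
    have b1 := abs_le.1 (hb p ⟨le_rfl, hpq⟩)
    have b2 := abs_le.1 (hb q ⟨hpq, le_rfl⟩)
    have e2 : 2/m = 1/m+1/m := by ring
    rcases h2 with h2 | h2
    · rw [intervalIntegral.integral_congr (g := fun x => φ 2 x / (φ 1 x)^2), hI]
      · linarith
      · intro x hx; rw [hu] at hx; simp only []; rw [abs_of_nonneg (h2 x hx)]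
    · rw [intervalIntegral.integral_congr (g := fun x => -(φ 2 x / (φ 1 x)^2)),
        intervalIntegral.integral_neg, hI]
      · linarith
      · intro x hx; rw [hu] at hx; simp only []; rw [abs_of_nonpos (h2 x hx)]; ring
  have := vdc_gen hl hφ hpq hpq1 hm hw hw1 hW hW1 h1 hV
  refine this.trans (le_of_eq ?_)
  ring

/-! breaks -/
def BR (Z : Finset ℝ) (F : Set ℝ) : Prop :=
  ∀ x x' : ℝ, 0 ≤ x → x ≤ x' → x' ≤ 1 → (∀ z ∈ Z, z ∉ Set.Icc x x') → (x ∈ F ↔ x' ∈ F)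

open Classical in
lemma BR.inter {Z Z' : Finset ℝ} {F F' : Set ℝ} (h : BR Z F) (h' : BR Z' F') :
    BR (Z ∪ Z') (F ∩ F') := by
  intro x x' h0 hx h1 hz
  rw [Set.mem_inter_iff, Set.mem_inter_iff, 
    h x x' h0 hx h1 fun z hzz => hz z (Finset.mem_union_left _ hzz),
    h' x x' h0 hx h1 fun z hzz => hz z (Finset.mem_union_right _ hzz)]

lemma BR.compl {Z : Finset ℝ} {F : Set ℝ} (h : BR Z F) : BR Z Fᶜ := by
  intro x x' h0 hx h1 hz
  rw [Set.mem_compl_iff, Set.mem_compl_iff, h x x' h0 hx h1 hz]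

lemma gap {h : ℝ → ℂ} (M : ℝ) (Z : Finset ℝ) : ∀ p q : ℝ, p ≤ q → IntervalIntegrable h volume p q →
    (∀ p' q', p ≤ p' → p' ≤ q' → q' ≤ q → (∀ z ∈ Z, z ∉ Set.Ioo p' q') →
      ‖∫ x in p'..q', h x‖ ≤ M) → ‖∫ x in p..q, h x‖ ≤ 2^(Z.card) * M := by
  induction Z using Finset.induction_on with
  | empty => intro p q hpq hi H; simpa using H p q le_rfl hpq le_rfl (by simp)
  | insert z Z hz ih =>
    intro p q hpq hi H
    rw [Finset.card_insert_of_notMem hz, pow_succ]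
    have hM : 0 ≤ M := by
      have := H p p le_rfl le_rfl hpq (by simp)
      exact (norm_nonneg _).trans this
    have hsub : ∀ p' q', p ≤ p' → p' ≤ q' → q' ≤ q → IntervalIntegrable h volume p' q' := by
      intro p' q' a b c
      apply hi.mono_set
      rw [Set.uIcc_of_le b, Set.uIcc_of_le (a.trans (b.trans c))]
      exact Set.Icc_subset_Icc a c
    by_cases hzz : z ∈ Set.Ioo p q
    · rw [← intervalIntegral.integral_add_adjacent_intervals
        (hsub p z le_rfl hzz.1.le hzz.2.le) (hsub z q hzz.1.le hzz.2.le le_rfl)]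
      have h1 := ih p z hzz.1.le (hsub p z le_rfl hzz.1.le hzz.2.le) (by
        intro p' q' a b c d
        refine H p' q' a b (c.trans hzz.2.le) ?_
        intro y hy
        rcases Finset.mem_insert.1 hy with rfl | hy
        · intro hh; exact absurd hh.2 (not_lt.2 c)
        · exact d y hy)
      have h2 := ih z q hzz.2.le (hsub z q hzz.1.le hzz.2.le le_rfl) (by
        intro p' q' a b c d
        refine H p' q' (hzz.1.le.trans a) b c ?_
        intro y hy
        rcases Finset.mem_insert.1 hy with rfl | hy
        · intro hh; exact absurd hh.1 (not_lt.2 a)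
        · exact d y hy)
      refine (norm_add_le _ _).trans ?_
      linarith
    · have h1 := ih p q hpq hi (by
        intro p' q' a b c d
        refine H p' q' a b c ?_
        intro y hy
        rcases Finset.mem_insert.1 hy with rfl | hy
        · intro hh; exact hzz ⟨a.trans_lt hh.1, hh.2.trans_le c⟩
        · exact d y hy)
      have : 0 ≤ 2^Z.card * M := by positivity
      linarith

lemma gapF {h : ℝ → ℂ} (hc : ContinuousOn h (Set.Icc 0 1)) {F : Set ℝ} (hF : MeasurableSet F) (Z : Finset ℝ) 
    {Z0 : Finset ℝ} (hZ : BR Z0 F) (hsub : Z0 ⊆ Z) {M : ℝ} (hM : 0 ≤ M)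
    (H : ∀ p q : ℝ, 0 ≤ p → p < q → q ≤ 1 → (∀ z ∈ Z, z ∉ Set.Ioo p q) → Set.Ioo p q ⊆ F →
      ‖∫ x in p..q, h x‖ ≤ M) : ‖∫ x in (0:ℝ)..1, F.indicator h x‖ ≤ 2^(Z.card) * M := by
  have hi : IntervalIntegrable h volume 0 1 := by
    apply ContinuousOn.intervalIntegrable; rwa [Set.uIcc_of_le zero_le_one]
  have hiF : IntervalIntegrable (F.indicator h) volume 0 1 := by
    rw [intervalIntegrable_iff] at hi ⊢
    exact hi.indicator hF
  apply gap M Z 0 1 zero_le_one hiF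
  intro p q hp hpq hq hz
  rcases hpq.eq_or_lt with e | hlt
  · subst e; simpa using hM
  have hdich : Set.Ioo p q ⊆ F ∨ Set.Ioo p q ⊆ Fᶜ := by
    have hh : ∀ x ∈ Set.Ioo p q, ∀ x' ∈ Set.Ioo p q, x ≤ x' → (x ∈ F ↔ x' ∈ F) := by
      intro x hx x' hx' hxx
      refine hZ x x' (hp.trans hx.1.le) hxx (hx'.2.le.trans hq) ?_
      intro z hz0 hz1
      exact hz z (hsub hz0) ⟨hx.1.trans_le hz1.1, hz1.2.trans_lt hx'.2⟩
    by_cases hmid : (p+q)/2 ∈ F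
    · left; intro x hx
      rcases le_total x ((p+q)/2) with h1 | h1
      · exact (hh x hx _ ⟨by linarith, by linarith⟩ h1).2 hmid
      · exact (hh _ ⟨by linarith, by linarith⟩ x hx h1).1 hmid
    · right; intro x hx
      rcases le_total x ((p+q)/2) with h1 | h1
      · exact fun hxx => hmid ((hh x hx _ ⟨by linarith, by linarith⟩ h1).1 hxx)
      · exact fun hxx => hmid ((hh _ ⟨by linarith, by linarith⟩ x hx h1).2 hxx)
  rw [intervalIntegral.integral_of_le hpq, integral_Ioc_eq_integral_Ioo]
  rcases hdich with hd | hd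
  · have := H p q hp hlt hq hz hd
    rw [intervalIntegral.integral_of_le hpq, integral_Ioc_eq_integral_Ioo] at this
    rwa [setIntegral_congr_fun (g := h) measurableSet_Ioo]
    intro x hx; exact Set.indicator_of_mem (hd hx) _
  · rw [setIntegral_congr_fun (g := fun _ => 0) measurableSet_Ioo]
    · simpa using hM
    intro x hx; exact Set.indicator_of_notMem (hd hx) _

lemma icc_of_ioo {g : ℝ → ℝ} (hg : Continuous g) {p q m : ℝ} (hpq : p < q)
    (h : ∀ x ∈ Set.Ioo p q, m ≤ |g x|) : ∀ x ∈ Set.Icc p q, m ≤ |g x| := by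
  intro x hx
  rw [← closure_Ioo hpq.ne] at hx
  exact closure_minimal (t := {x | m ≤ |g x|}) h (isClosed_le continuous_const hg.abs) hx

open Classical in
lemma V2 {a : ℕ} (ha : 1 ≤ a) {lam : ℝ} (hl : lam ≠ 0) {φ : ℕ → ℝ → ℝ} (hφ : Chn φ) {w w1 : ℝ → ℂ}
    {W μ : ℝ} (hμ : 0 < μ)
    (hw : ∀ x ∈ Set.Icc (0:ℝ) 1, HasDerivAt w (w1 x) x) (hw1 : ContinuousOn w1 (Set.Icc 0 1))
    (hW : ∀ x ∈ Set.Icc (0:ℝ) 1, ‖w x‖ ≤ W) (hW1 : ∀ x ∈ Set.Icc (0:ℝ) 1, ‖w1 x‖ ≤ W)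
    (hne : ∀ x ∈ Set.Icc (0:ℝ) 1, φ (a+1) x ≠ 0) {F : Set ℝ} (hF : MeasurableSet F)
    {Z0 : Finset ℝ} (hZ : BR Z0 F) (h1 : ∀ x ∈ F, x ∈ Set.Icc (0:ℝ) 1 → μ ≤ |φ 1 x|) :
    ‖∫ x in (0:ℝ)..1, F.indicator (fun x => osc lam (φ 0) x * w x) x‖ ≤
      2^(Z0.card + a) * (W * (5 / μ) / |lam|) := by
  have hW0 : 0 ≤ W := (norm_nonneg _).trans (hW 0 ⟨le_rfl, zero_le_one⟩)
  obtain ⟨Z2, hc2, hZ2⟩ := zeros_fin (a-1) _ (hφ.shift 2) 0 1 (by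
    rwa [show a - 1 + 2 = a + 1 by omega])
  have hwc : ContinuousOn w (Set.Icc 0 1) := fun x hx => (hw x hx).continuousAt.continuousWithinAt
  have := gapF (h := fun x => osc lam (φ 0) x * w x) ((osc_cont (hφ.cont 0)).continuousOn.mul hwc) hF
    (Z0 ∪ Z2) hZ Finset.subset_union_left (M := W * (5 / μ) / |lam|) (by positivity) (by
      intro p q hp hpq hq hz hFF
      have hs : Set.Icc p q ⊆ Set.Icc 0 1 := Set.Icc_subset_Icc hp hq
      refine vdc1 hl hφ hpq.le (by linarith) hμ (fun x hx => hw x (hs hx)) (hw1.mono hs)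
        (fun x hx => hW x (hs hx)) (fun x hx => hW1 x (hs hx)) ?_ ?_
      · exact icc_of_ioo (hφ.cont 1) hpq fun x hx => h1 x (hFF hx) (hs (Set.Ioo_subset_Icc_self hx))
      · apply sign_const (hφ.cont 2)
        intro x hx h0
        exact hz x (Finset.mem_union_right _ (hZ2 x (hs (Set.Ioo_subset_Icc_self hx)) (by simpa using h0))) hx)
  refine this.trans ?_
  gcongr
  · norm_num
  · exact (Finset.card_union_le _ _).trans (by omega)

open Classical in
lemma V1 (a : ℕ) (ha : 1 ≤ a) : ∃ C ≥ (0:ℝ), ∀ lam : ℝ, lam ≠ 0 → ∀ φ : ℕ → ℝ → ℝ, Chn φ →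
    ∀ w w1 : ℝ → ℂ, ∀ W m T : ℝ, 0 < m → 0 < T → T^(a+1) * (|lam| * m) = 1 → 
    (∀ x ∈ Set.Icc (0:ℝ) 1, HasDerivAt w (w1 x) x) → ContinuousOn w1 (Set.Icc 0 1) →
    (∀ x ∈ Set.Icc (0:ℝ) 1, ‖w x‖ ≤ W) → (∀ x ∈ Set.Icc (0:ℝ) 1, ‖w1 x‖ ≤ W) →
    (∀ x ∈ Set.Icc (0:ℝ) 1, m ≤ |φ (a+1) x|) → ∀ F : Set ℝ, MeasurableSet F → 
    ∀ Z0 : Finset ℝ, BR Z0 F →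
    ‖∫ x in (0:ℝ)..1, F.indicator (fun x => osc lam (φ 0) x * w x) x‖ ≤
      2^(Z0.card) * (C * W * T) := by
  obtain ⟨c, hc, Hc⟩ := SL a
  set c' := min c 1 with hc'
  have hc'0 : 0 < c' := by positivity
  refine ⟨2^(3*a) * (5 + 1/c'), by positivity, ?_⟩
  intro lam hl φ hφ w w1 W m T hm hT hTe hw hw1 hW hW1 hlow F hF Z0 hZ0
  have hW0 : 0 ≤ W := (norm_nonneg _).trans (hW 0 ⟨le_rfl, zero_le_one⟩)
  have hlam : 0 < |lam| := abs_pos.2 hl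
  have hne : ∀ x ∈ Set.Icc (0:ℝ) 1, φ (a+1) x ≠ 0 := fun x hx h => by
    have := hlow x hx; rw [h, abs_zero] at this; linarith
  obtain ⟨Z2, hc2, hZ2⟩ := zeros_fin (a-1) _ (hφ.shift 2) 0 1 (by
    rwa [show a - 1 + 2 = a + 1 by omega])
  have hcst : ∀ ν : ℝ, ∃ Z : Finset ℝ, Z.card ≤ a ∧ ∀ x ∈ Set.Icc (0:ℝ) 1, φ 1 x + ν = 0 → x ∈ Z := by
    intro ν
    have hC : Chn (fun k x => if k = 0 then φ 1 x + ν else φ (k+1) x) := by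
      intro k x
      rcases k with _ | k
      · simpa using (hφ 1 x).add_const ν
      · simpa using hφ (k+2) x
    have := zeros_fin a _ hC 0 1 (by
      intro x hx
      simp only [show a ≠ 0 by omega, if_false]
      exact hne x hx)
    simpa using this
  set ν := m * T^a with hν
  have hν0 : 0 < ν := by positivity
  obtain ⟨Z3, hc3, hZ3⟩ := hcst ν
  obtain ⟨Z4, hc4, hZ4⟩ := hcst (-ν)
  have hwc : ContinuousOn w (Set.Icc 0 1) := fun x hx => (hw x hx).continuousAt.continuousWithinAt
  have := gapF (h := fun x => osc lam (φ 0) x * w x) ((osc_cont (hφ.cont 0)).continuousOn.mul hwc) hF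
    (Z0 ∪ (Z2 ∪ (Z3 ∪ Z4))) hZ0 Finset.subset_union_left (M := (5 + 1/c') * (W * T)) (by positivity) (by
      intro p q hp hpq hq hz hFF
      have hs : Set.Icc p q ⊆ Set.Icc 0 1 := Set.Icc_subset_Icc hp hq
      have hio := Set.Ioo_subset_Icc_self (a := p) (b := q)
      have s2 := sign_const (hφ.cont 2) (p := p) (q := q) (by
        intro x hx h0
        refine hz x ?_ hx
        simp only [Finset.mem_union]
        exact Or.inr (Or.inl (hZ2 x (hs (hio hx)) (by simpa using h0))))
      have s3 := sign_const (g := fun x => φ 1 x + ν) ((hφ.cont 1).add continuous_const) (p := p) (q := q) (by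
        intro x hx h0
        refine hz x ?_ hx
        simp only [Finset.mem_union]
        exact Or.inr (Or.inr (Or.inl (hZ3 x (hs (hio hx)) (by simpa using h0)))))
      have s4 := sign_const (g := fun x => φ 1 x + -ν) ((hφ.cont 1).add continuous_const) (p := p) (q := q) (by
        intro x hx h0
        refine hz x ?_ hx
        simp only [Finset.mem_union]
        exact Or.inr (Or.inr (Or.inr (hZ4 x (hs (hio hx)) (by simpa using h0)))))
      have hbig : (∀ x ∈ Set.Icc p q, ν ≤ |φ 1 x|) →
          ‖∫ x in p..q, osc lam (φ 0) x * w x‖ ≤ (5 + 1/c') * (W * T) := by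
        intro hbig
        refine (vdc1 hl hφ hpq.le (by linarith) hν0 (fun x hx => hw x (hs hx)) (hw1.mono hs)
          (fun x hx => hW x (hs hx)) (fun x hx => hW1 x (hs hx)) hbig s2).trans ?_
        have e : W * (5/ν) / |lam| = 5 * (W * T) := by
          have : 5 / ν / |lam| = 5 * T := by
            rw [div_div, div_eq_iff (by positivity)]
            calc (5:ℝ) = 5 * (T^(a+1) * (|lam| * m)) := by rw [hTe, mul_one]
              _ = _ := by rw [hν]; ring
          rw [mul_div_assoc, this]; ring
        rw [e]
        have : 0 ≤ 1/c' * (W*T) := by positivity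
        linarith
      rcases s3 with s3 | s3
      · rcases s4 with s4 | s4
        · exact hbig fun x hx => by
            have := s4 x hx; have := le_abs_self (φ 1 x); linarith
        · obtain ⟨x, hx, hx2⟩ := Hc _ (hφ.shift 1) p q m hpq.le hm.le (fun x hx => hlow x (hs hx))
          have hab : |φ 1 x| ≤ ν := abs_le.2 ⟨by linarith [s3 x hx], by linarith [s4 x hx]⟩
          have hlen : q - p ≤ T / c' := by
            have h1 : c * (q-p)^a ≤ T^a := by
              have h2 := hx2.trans hab
              rw [hν] at h2
              have h3 : m * (c * (q-p)^a) ≤ m * T^a := by linarith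
              exact le_of_mul_le_mul_left h3 hm
            have h2 : c'^a ≤ c := (pow_le_of_le_one hc'0.le (min_le_right _ _) (by omega)).trans (min_le_left _ _)
            have hqp : 0 ≤ q - p := by linarith
            have h3 : (c' * (q-p))^a ≤ T^a := by
              rw [mul_pow]; refine le_trans ?_ h1; gcongr
            have h4 := le_of_pow_le_pow_left₀ (by omega) hT.le h3
            rw [le_div_iff₀ hc'0]; linarith
          have h5 : ‖∫ x in p..q, osc lam (φ 0) x * w x‖ ≤ W * |q - p| := by
            apply intervalIntegral.norm_integral_le_of_norm_le_const
            intro x hx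
            rw [Set.uIoc_of_le hpq.le] at hx
            rw [norm_mul, osc_norm, one_mul]
            exact hW x (hs (Set.Ioc_subset_Icc_self hx))
          rw [abs_of_nonneg (by linarith)] at h5
          refine h5.trans ?_
          have h6 : W * (q-p) ≤ W * (T/c') := by gcongr
          have h7 : (5+1/c') * (W*T) = W * (T/c') + 5 * (W*T) := by ring
          have : 0 ≤ W * T := by positivity
          linarith
      · exact hbig fun x hx => by
            have := s3 x hx; have := neg_le_abs (φ 1 x); linarith)
  refine this.trans ?_
  have hcard : (Z0 ∪ (Z2 ∪ (Z3 ∪ Z4))).card ≤ Z0.card + 3 * a := by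
    have h1 := Finset.card_union_le Z0 (Z2 ∪ (Z3 ∪ Z4))
    have h2 := Finset.card_union_le Z2 (Z3 ∪ Z4)
    have h3 := Finset.card_union_le Z3 Z4
    omega
  calc (2:ℝ)^(Z0 ∪ (Z2 ∪ (Z3 ∪ Z4))).card * ((5 + 1/c') * (W * T)) 
      ≤ 2^(Z0.card + 3*a) * ((5 + 1/c') * (W * T)) := by gcongr; norm_num
    _ = _ := by rw [pow_add]; ring

/-! ### Kernel calculus -/

structure Ker (K : ℝ → ℝ → ℂ) : Prop where
  meas : Measurable (fun z : ℝ × ℝ => K z.1 z.2)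
  bd : ∃ M R : ℝ, 0 ≤ M ∧ 0 ≤ R ∧ (∀ x y, ‖K x y‖ ≤ M) ∧ (∀ x y, R < |x| ∨ R < |y| → K x y = 0)

def Tp (K : ℝ → ℝ → ℂ) (f : ℝ → ℂ) : ℝ → ℂ := fun x => ∫ y, K x y * f y

def Bd (K : ℝ → ℝ → ℂ) (A : ℝ) : Prop := ∀ f : ℝ → ℂ, MemLp f 2 volume →
  eLpNorm (Tp K f) 2 volume ≤ ENNReal.ofReal A * eLpNorm f 2 volume

lemma eL2_sq (g : ℝ → ℂ) : eLpNorm g 2 volume ^ 2 = ∫⁻ x, ‖g x‖ₑ^2 := by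
  rw [eLpNorm_eq_lintegral_rpow_enorm_toReal (by norm_num) (by norm_num)]
  simp only [ENNReal.toReal_ofNat, one_div]
  rw [← ENNReal.rpow_natCast, ← ENNReal.rpow_mul]
  simp

lemma Bd_of_sq {K : ℝ → ℝ → ℂ} {A : ℝ} (h : ∀ f : ℝ → ℂ, MemLp f 2 volume →
    ∫⁻ x, ‖Tp K f x‖ₑ^2 ≤ ENNReal.ofReal A ^ 2 * ∫⁻ x, ‖f x‖ₑ^2) : Bd K A := by
  intro f hf
  have := h f hf
  rw [← eL2_sq, ← eL2_sq, ← mul_pow] at this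
  exact (ENNReal.pow_le_pow_left_iff (by norm_num)).1 this

lemma Bd.sq {K : ℝ → ℝ → ℂ} {A : ℝ} (h : Bd K A) (f : ℝ → ℂ) (hf : MemLp f 2 volume) :
    ∫⁻ x, ‖Tp K f x‖ₑ^2 ≤ ENNReal.ofReal A ^ 2 * ∫⁻ x, ‖f x‖ₑ^2 := by
  rw [← eL2_sq, ← eL2_sq, ← mul_pow]
  exact pow_le_pow_left' (h f hf) 2

lemma Bd.mono {K : ℝ → ℝ → ℂ} {A B : ℝ} (h : Bd K A) (hAB : A ≤ B) : Bd K B := by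
  intro f hf
  refine (h f hf).trans ?_
  gcongr

lemma Ker.loc {K : ℝ → ℝ → ℂ} (hK : Ker K) {f : ℝ → ℂ} (hf : MemLp f 2 volume) (R : ℝ) :
    IntegrableOn f (Set.Icc (-R) R) volume := by
  have : MemLp f 2 (volume.restrict (Set.Icc (-R) R)) := hf.restrict _
  exact this.integrable (by norm_num)

lemma Ker.int {K : ℝ → ℝ → ℂ} (hK : Ker K) {f : ℝ → ℂ} (hf : MemLp f 2 volume) (x : ℝ) :
    Integrable (fun y => K x y * f y) volume := by
  obtain ⟨M, R, hM, hR, h1, h2⟩ := hK.bd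
  have hg : Integrable (fun y => (M : ℝ) * ‖(Set.Icc (-R) R).indicator f y‖) volume :=
    (((integrable_indicator_iff measurableSet_Icc).2 (hK.loc hf R)).norm).const_mul M
  refine hg.mono' ?_ ?_
  · have : Measurable (fun y => K x y) := hK.meas.comp (measurable_const.prodMk measurable_id)
    exact this.aestronglyMeasurable.mul hf.1
  · refine Filter.Eventually.of_forall fun y => ?_
    by_cases hy : y ∈ Set.Icc (-R) R
    · rw [Set.indicator_of_mem hy, norm_mul]; gcongr; exact h1 x y
    · rw [h2 x y (Or.inr (by rw [Set.mem_Icc, ← abs_le] at hy; push Not at hy; exact hy))]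
      rw [zero_mul, norm_zero]; positivity

lemma Ker.aesm {K : ℝ → ℝ → ℂ} (hK : Ker K) {f : ℝ → ℂ} (hf : MemLp f 2 volume) :
    AEStronglyMeasurable (Tp K f) volume := by
  have : AEStronglyMeasurable (fun z : ℝ × ℝ => K z.1 z.2 * f z.2) (volume.prod volume) :=
    hK.meas.aestronglyMeasurable.mul hf.1.comp_snd
  exact this.integral_prod_right'

lemma Ker.add {K K' : ℝ → ℝ → ℂ} (h : Ker K) (h' : Ker K') : Ker (fun x y => K x y + K' x y) := by
  refine ⟨h.meas.add h'.meas, ?_⟩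
  obtain ⟨M, R, hM, hR, h1, h2⟩ := h.bd
  obtain ⟨M', R', hM', hR', h1', h2'⟩ := h'.bd
  refine ⟨M + M', R + R', by positivity, by positivity, fun x y => (norm_add_le _ _).trans (add_le_add (h1 x y) (h1' x y)), ?_⟩
  intro x y hxy
  rw [h2 x y, h2' x y, add_zero]
  · rcases hxy with h | h
    · left; linarith
    · right; linarith
  · rcases hxy with h | h
    · left; linarith
    · right; linarith

lemma Ker.zero : Ker (fun _ _ => 0) := ⟨measurable_const, 0, 0, le_rfl, le_rfl, by simp, by simp⟩

lemma Ker.sum {ι : Type*} (s : Finset ι) {K : ι → ℝ → ℝ → ℂ} (h : ∀ i ∈ s, Ker (K i)) :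
    Ker (fun x y => ∑ i ∈ s, K i x y) := by
  classical
  induction s using Finset.induction_on with
  | empty => simpa using Ker.zero
  | insert i s hi ih =>
    simp only [Finset.sum_insert hi]
    exact (h i (by simp)).add (ih fun j hj => h j (by simp [hj]))

lemma Ker.ind {K : ℝ → ℝ → ℂ} (h : Ker K) {E : Set (ℝ × ℝ)} (hE : MeasurableSet E) :
    Ker (fun x y => E.indicator (fun z => K z.1 z.2) (x, y)) := by
  refine ⟨h.meas.indicator hE, ?_⟩
  obtain ⟨M, R, hM, hR, h1, h2⟩ := h.bd
  refine ⟨M, R, hM, hR, fun x y => ?_, fun x y hxy => ?_⟩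
  · exact (norm_indicator_le_norm_self _ _).trans (h1 x y)
  · rw [Set.indicator_apply_eq_zero]; exact fun _ => h2 x y hxy

lemma Bd.add {K K' : ℝ → ℝ → ℂ} {A A' : ℝ} (hA : 0 ≤ A) (hA' : 0 ≤ A') (k : Ker K) (k' : Ker K')
    (h : Bd K A) (h' : Bd K' A') : Bd (fun x y => K x y + K' x y) (A + A') := by
  intro f hf
  have e : Tp (fun x y => K x y + K' x y) f = Tp K f + Tp K' f := by
    funext x
    simp only [Tp, add_mul, Pi.add_apply]
    exact integral_add (k.int hf x) (k'.int hf x)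
  rw [e, ENNReal.ofReal_add hA hA', add_mul]
  exact (eLpNorm_add_le (k.aesm hf) (k'.aesm hf) (by norm_num)).trans (add_le_add (h f hf) (h' f hf))

lemma Bd.zero {A : ℝ} : Bd (fun _ _ => 0) A := by
  intro f hf
  have : Tp (fun _ _ => 0) f = 0 := by funext x; simp [Tp]
  rw [this]; simp

lemma Bd.sum {ι : Type*} (s : Finset ι) {K : ι → ℝ → ℝ → ℂ} {A : ι → ℝ} (hA : ∀ i ∈ s, 0 ≤ A i)
    (k : ∀ i ∈ s, Ker (K i)) (h : ∀ i ∈ s, Bd (K i) (A i)) :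
    Bd (fun x y => ∑ i ∈ s, K i x y) (∑ i ∈ s, A i) := by
  classical
  induction s using Finset.induction_on with
  | empty => simpa using Bd.zero
  | insert i s hi ih =>
    simp only [Finset.sum_insert hi]
    exact (h i (by simp)).add (hA i (by simp)) (Finset.sum_nonneg fun j hj => hA j (by simp [hj]))
      (k i (by simp)) (Ker.sum s fun j hj => k j (by simp [hj]))
      (ih (fun j hj => hA j (by simp [hj])) (fun j hj => k j (by simp [hj])) fun j hj => h j (by simp [hj]))

lemma Bd.neg {K : ℝ → ℝ → ℂ} {A : ℝ} (h : Bd K A) : Bd (fun x y => - K x y) A := by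
  intro f hf
  have e : Tp (fun x y => - K x y) f = - Tp K f := by
    funext x; simp [Tp, integral_neg]
  rw [e, eLpNorm_neg]; exact h f hf

lemma Ker.neg {K : ℝ → ℝ → ℂ} (h : Ker K) : Ker (fun x y => - K x y) := by
  refine ⟨h.meas.neg, ?_⟩
  simpa using h.bd

/-- Hilbert-Schmidt / trivial bound -/
lemma Bd_trivial {K : ℝ → ℝ → ℂ} {M α β : ℝ} (hM : 0 ≤ M) (hα : 0 ≤ α) (hβ : 0 ≤ β) {E F : Set ℝ}
    (hE : MeasurableSet E) (hF : MeasurableSet F) (hEα : volume E ≤ ENNReal.ofReal α)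
    (hFβ : volume F ≤ ENNReal.ofReal β) (hb : ∀ x y, ‖K x y‖ ≤ M)
    (h0 : ∀ x y, x ∉ E ∨ y ∉ F → K x y = 0) : Bd K (M * Real.sqrt (α * β)) := by
  apply Bd_of_sq
  intro f hf
  have h1 : ∀ x, ‖Tp K f x‖ₑ ≤ E.indicator (fun _ => ENNReal.ofReal M * ∫⁻ y in F, ‖f y‖ₑ) x := by
    intro x
    by_cases hx : x ∈ E
    · rw [Set.indicator_of_mem hx]
      refine (enorm_integral_le_lintegral_enorm _).trans ?_
      rw [← lintegral_indicator hF, ← lintegral_const_mul' _ _ ENNReal.ofReal_ne_top]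
      refine lintegral_mono fun y => ?_
      by_cases hy : y ∈ F
      · rw [Set.indicator_of_mem hy, enorm_mul]
        gcongr
        rw [← ofReal_norm]
        exact ENNReal.ofReal_le_ofReal (hb x y)
      · simp [h0 x y (Or.inr hy)]
    · rw [Set.indicator_of_notMem hx]
      have : Tp K f x = 0 := by
        simp [Tp, h0 x _ (Or.inl hx)]
      simp [this]
  have h2 : (∫⁻ y in F, ‖f y‖ₑ)^2 ≤ ENNReal.ofReal β * ∫⁻ y, ‖f y‖ₑ^2 := by
    have := eLpNorm_le_eLpNorm_mul_rpow_measure_univ (p := 1) (q := 2) (μ := volume.restrict F)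
      (by norm_num) hf.1.restrict
    rw [eLpNorm_one_eq_lintegral_enorm] at this
    have h3 := pow_le_pow_left' this 2
    refine h3.trans ?_
    rw [mul_pow, ← eL2_sq, mul_comm]
    gcongr
    · rw [Measure.restrict_apply_univ, ← ENNReal.rpow_natCast, ← ENNReal.rpow_mul]
      norm_num
      exact hFβ
    · exact Measure.restrict_le_self
  calc ∫⁻ x, ‖Tp K f x‖ₑ^2 ≤ ∫⁻ x, E.indicator (fun _ => (ENNReal.ofReal M * ∫⁻ y in F, ‖f y‖ₑ)^2) x := by
        refine lintegral_mono fun x => ?_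
        have := pow_le_pow_left' (h1 x) 2
        by_cases hx : x ∈ E
        · simpa [hx] using this
        · simpa [hx] using this
    _ = (ENNReal.ofReal M * ∫⁻ y in F, ‖f y‖ₑ)^2 * volume E := by
        rw [lintegral_indicator hE, setLIntegral_const]
    _ ≤ ENNReal.ofReal M ^ 2 * (ENNReal.ofReal β * ∫⁻ y, ‖f y‖ₑ^2) * ENNReal.ofReal α := by
        rw [mul_pow]; gcongr
    _ = _ := by
        rw [ENNReal.ofReal_mul hM, mul_pow, ← ENNReal.ofReal_pow (Real.sqrt_nonneg _),
          Real.sq_sqrt (by positivity), ENNReal.ofReal_mul hα]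
        ring

/-- Almost orthogonality -/
lemma Bd_orth {ι : Type*} [DecidableEq ι] (s : Finset ι) {K : ι → ℝ → ℝ → ℂ} {A : ℝ} 
    (k : ∀ i ∈ s, Ker (K i)) (h : ∀ i ∈ s, Bd (K i) A) (F : ι → Set ℝ) (I : ι → Set ℝ)
    (hI : ∀ i ∈ s, MeasurableSet (I i)) (hd : ∀ i ∈ s, ∀ j ∈ s, i ≠ j → Disjoint (I i) (I j))
    (h0 : ∀ i ∈ s, ∀ x y, x ∉ F i ∨ y ∉ I i → K i x y = 0) (N : ℕ)
    (hN : ∀ x, ∀ t ⊆ s, (∀ i ∈ t, x ∈ F i) → t.card ≤ N) :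
    Bd (fun x y => ∑ i ∈ s, K i x y) (Real.sqrt N * A) := by
  classical
  apply Bd_of_sq
  intro f hf
  have hfi : ∀ i ∈ s, MemLp ((I i).indicator f) 2 volume := fun i hi => hf.indicator (hI i hi)
  have e1 : ∀ x, Tp (fun x y => ∑ i ∈ s, K i x y) f x = ∑ i ∈ s, Tp (K i) ((I i).indicator f) x := by
    intro x
    simp only [Tp, Finset.sum_mul]
    rw [integral_finsetSum _ fun i hi => (k i hi).int hf x]
    refine Finset.sum_congr rfl fun i hi => integral_congr_ae (Filter.Eventually.of_forall fun y => ?_)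
    by_cases hy : y ∈ I i
    · simp [hy]
    · simp [hy, h0 i hi x y (Or.inr hy)]
  have e2 : ∀ x, ‖Tp (fun x y => ∑ i ∈ s, K i x y) f x‖ₑ^2 ≤
      (N : ENNReal) * ∑ i ∈ s, ‖Tp (K i) ((I i).indicator f) x‖ₑ^2 := by
    intro x
    rw [e1]
    set t := s.filter (fun i => x ∈ F i) with ht
    have hz : ∑ i ∈ s, Tp (K i) ((I i).indicator f) x = ∑ i ∈ t, Tp (K i) ((I i).indicator f) x := by
      symm
      apply Finset.sum_subset (Finset.filter_subset _ _)
      intro i hi hit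
      have : x ∉ F i := fun hh => hit (by simp [ht, hi, hh])
      simp [Tp, h0 i hi x _ (Or.inl this)]
    rw [hz]
    have hc := hN x t (Finset.filter_subset _ _) (fun i hi => by simp [ht] at hi; exact hi.2)
    have hr : ‖∑ i ∈ t, Tp (K i) ((I i).indicator f) x‖^2 ≤ N * ∑ i ∈ t, ‖Tp (K i) ((I i).indicator f) x‖^2 := by
      calc ‖∑ i ∈ t, Tp (K i) ((I i).indicator f) x‖^2 ≤ (∑ i ∈ t, ‖Tp (K i) ((I i).indicator f) x‖)^2 := by
            gcongr; exact norm_sum_le _ _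
        _ ≤ t.card * ∑ i ∈ t, ‖Tp (K i) ((I i).indicator f) x‖^2 := sq_sum_le_card_mul_sum_sq
        _ ≤ _ := by gcongr
    have hr2 := ENNReal.ofReal_le_ofReal hr
    rw [ENNReal.ofReal_mul (by positivity), ENNReal.ofReal_sum_of_nonneg (fun i _ => by positivity),
      ENNReal.ofReal_natCast, ENNReal.ofReal_pow (norm_nonneg _), ofReal_norm] at hr2
    refine hr2.trans ?_
    gcongr
    refine (Finset.sum_le_sum_of_subset (Finset.filter_subset _ _)).trans ?_
    refine Finset.sum_le_sum fun i _ => ?_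
    rw [ENNReal.ofReal_pow (norm_nonneg _), ofReal_norm]
  calc ∫⁻ x, ‖Tp (fun x y => ∑ i ∈ s, K i x y) f x‖ₑ^2 
      ≤ ∫⁻ x, (N : ENNReal) * ∑ i ∈ s, ‖Tp (K i) ((I i).indicator f) x‖ₑ^2 := lintegral_mono e2
    _ = (N : ENNReal) * ∑ i ∈ s, ∫⁻ x, ‖Tp (K i) ((I i).indicator f) x‖ₑ^2 := by
        rw [lintegral_const_mul' _ _ (by simp), lintegral_finsetSum']
        intro i hi
        exact (((k i hi).aesm (hfi i hi)).enorm).pow_const 2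
    _ ≤ (N : ENNReal) * ∑ i ∈ s, ENNReal.ofReal A ^ 2 * ∫⁻ x, ‖(I i).indicator f x‖ₑ^2 := by
        gcongr with i hi
        exact (h i hi).sq _ (hfi i hi)
    _ = (N : ENNReal) * (ENNReal.ofReal A ^ 2 * ∑ i ∈ s, ∫⁻ x in I i, ‖f x‖ₑ^2) := by
        rw [← Finset.mul_sum]
        congr 2
        refine Finset.sum_congr rfl fun i hi => ?_
        rw [← lintegral_indicator (hI i hi)]
        refine lintegral_congr fun x => ?_
        by_cases hx : x ∈ I i <;> simp [hx]
    _ ≤ (N : ENNReal) * (ENNReal.ofReal A ^ 2 * ∫⁻ x, ‖f x‖ₑ^2) := by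
        gcongr
        rw [← lintegral_biUnion_finset (fun i hi j hj hij => hd i hi j hj hij) hI]
        exact setLIntegral_le_lintegral _ _
    _ = _ := by
        rw [ENNReal.ofReal_mul (Real.sqrt_nonneg _), mul_pow, ← ENNReal.ofReal_pow (Real.sqrt_nonneg _),
          Real.sq_sqrt (by positivity), ENNReal.ofReal_natCast]
        ring

/-- T*T -/
lemma Bd_TT {K : ℝ → ℝ → ℂ} (k : Ker K) {A : ℝ} (hA : 0 ≤ A)
    (h : ∀ y, ∫⁻ y', ‖∫ x, K x y * (starRingEnd ℂ) (K x y')‖ₑ ≤ ENNReal.ofReal A) :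
    Bd K (Real.sqrt (2 * A)) := by
  apply Bd_of_sq
  intro f hf
  set L : ℝ → ℝ → ℂ := fun y y' => ∫ x, K x y * (starRingEnd ℂ) (K x y') with hL
  obtain ⟨M, R, hM, hR, h1, h2⟩ := k.bd
  set B := Set.Icc (-R) R with hB
  have hfB : Integrable (fun y => ‖B.indicator f y‖) volume :=
    ((integrable_indicator_iff measurableSet_Icc).2 (k.loc hf R)).norm
  have hcb : ∀ t : ℝ, t ∉ B → R < |t| := by
    intro t ht; rw [hB, Set.mem_Icc, ← abs_le] at ht; push Not at ht; exact ht
  -- the triple integrand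
  set H : ℝ → ℝ × ℝ → ℂ := fun x z => (K x z.1 * f z.1) * (starRingEnd ℂ) (K x z.2 * f z.2) with hH
  have hHint : Integrable (Function.uncurry H) (volume.prod (volume.prod volume)) := by
    have hdom : Integrable (fun w : ℝ × (ℝ × ℝ) => B.indicator (fun _ => M * M) w.1 * 
        (‖B.indicator f w.2.1‖ * ‖B.indicator f w.2.2‖)) (volume.prod (volume.prod volume)) := by
      refine Integrable.mul_prod (f := B.indicator (fun _ => M * M)) (g := fun z : ℝ × ℝ => ‖B.indicator f z.1‖ * ‖B.indicator f z.2‖) ?_ (hfB.mul_prod hfB)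
      rw [integrable_indicator_iff measurableSet_Icc]
      exact integrableOn_const (by simp [hB])
    refine hdom.mono' ?_ ?_
    · have m1 : Measurable (fun w : ℝ × (ℝ × ℝ) => K w.1 w.2.1) :=
        k.meas.comp (measurable_fst.prodMk (measurable_fst.comp measurable_snd))
      have m2 : Measurable (fun w : ℝ × (ℝ × ℝ) => K w.1 w.2.2) :=
        k.meas.comp (measurable_fst.prodMk (measurable_snd.comp measurable_snd))
      have f1 : AEStronglyMeasurable (fun w : ℝ × (ℝ × ℝ) => f w.2.1) (volume.prod (volume.prod volume)) :=
        (hf.1.comp_fst (ν := (volume : Measure ℝ))).comp_snd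
      have f2 : AEStronglyMeasurable (fun w : ℝ × (ℝ × ℝ) => f w.2.2) (volume.prod (volume.prod volume)) :=
        (hf.1.comp_snd (μ := (volume : Measure ℝ))).comp_snd
      exact (m1.aestronglyMeasurable.mul f1).mul
        (Complex.continuous_conj.comp_aestronglyMeasurable (m2.aestronglyMeasurable.mul f2))
    · refine Filter.Eventually.of_forall fun w => ?_
      simp only [Function.uncurry, hH]
      by_cases hx : w.1 ∈ B
      · by_cases hy : w.2.1 ∈ B
        · by_cases hy' : w.2.2 ∈ B
          · rw [Set.indicator_of_mem hx, Set.indicator_of_mem hy, Set.indicator_of_mem hy', norm_mul,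
              RCLike.norm_conj, norm_mul, norm_mul]
            have a1 := h1 w.1 w.2.1
            have a2 := h1 w.1 w.2.2
            calc ‖K w.1 w.2.1‖ * ‖f w.2.1‖ * (‖K w.1 w.2.2‖ * ‖f w.2.2‖) ≤ 
              M * ‖f w.2.1‖ * (M * ‖f w.2.2‖) := by gcongr
              _ = _ := by ring
          · rw [h2 w.1 w.2.2 (Or.inr (hcb _ hy'))]; simp [hy']
        · rw [h2 w.1 w.2.1 (Or.inr (hcb _ hy))]; simp [hy]
      · rw [h2 w.1 w.2.1 (Or.inl (hcb _ hx))]; simp [hx]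
  have e1 : ∀ x, Tp K f x * (starRingEnd ℂ) (Tp K f x) = ∫ z, H x z ∂(volume.prod volume) := by
    intro x
    rw [hH]
    simp only
    rw [integral_prod_mul (fun y => K x y * f y) (fun y => (starRingEnd ℂ) (K x y * f y)), integral_conj]
    rfl
  have e2 : ∫⁻ x, ‖Tp K f x‖ₑ^2 = ‖∫ x, ∫ z, H x z ∂(volume.prod volume)‖ₑ := by
    have hI : Integrable (fun x => Tp K f x * (starRingEnd ℂ) (Tp K f x)) volume := by
      simp only [e1]
      exact hHint.integral_prod_left
    have hI2 : Integrable (fun x => ‖Tp K f x‖^2) volume := by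
      have := hI.norm
      refine this.congr (Filter.Eventually.of_forall fun x => ?_)
      simp only [norm_mul, RCLike.norm_conj]; ring
    have e3 : ∫ x, Tp K f x * (starRingEnd ℂ) (Tp K f x) = ((∫ x, ‖Tp K f x‖^2 : ℝ) : ℂ) := by
      rw [← integral_complex_ofReal]
      refine integral_congr_ae (Filter.Eventually.of_forall fun x => ?_)
      simp only [Complex.mul_conj, Complex.normSq_eq_norm_sq]
    simp only [← e1]
    rw [e3, ← ofReal_norm, Complex.norm_real, Real.norm_eq_abs, abs_of_nonneg (integral_nonneg fun x => by positivity),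
      ofReal_integral_eq_lintegral_ofReal hI2 (Filter.Eventually.of_forall fun x => by positivity)]
    refine lintegral_congr fun x => ?_
    rw [ENNReal.ofReal_pow (norm_nonneg _), ofReal_norm]
  have e4 : ∀ z : ℝ × ℝ, ∫ x, H x z = (f z.1 * (starRingEnd ℂ) (f z.2)) * L z.1 z.2 := by
    intro z
    simp only [hH, hL]
    rw [← integral_const_mul]
    refine integral_congr_ae (Filter.Eventually.of_forall fun x => ?_)
    simp only [map_mul]; ring
  have hLm : Measurable (fun z : ℝ × ℝ => L z.1 z.2) := by
    have m : StronglyMeasurable (fun w : (ℝ × ℝ) × ℝ => K w.2 w.1.1 * (starRingEnd ℂ) (K w.2 w.1.2)) := by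
      apply Measurable.stronglyMeasurable
      exact (k.meas.comp (measurable_snd.prodMk (measurable_fst.comp measurable_fst))).mul
        (Complex.continuous_conj.measurable.comp (k.meas.comp (measurable_snd.prodMk (measurable_snd.comp measurable_fst))))
    exact (m.integral_prod_right').measurable
  have hsym : ∀ y y', ‖L y y'‖ₑ = ‖L y' y‖ₑ := by
    intro y y'
    have : L y y' = (starRingEnd ℂ) (L y' y) := by
      simp only [hL]
      rw [← integral_conj]
      refine integral_congr_ae (Filter.Eventually.of_forall fun x => ?_)
      simp only [map_mul, Complex.conj_conj]; ring
    rw [this, ← ofReal_norm, RCLike.norm_conj, ofReal_norm]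
  have hfm : AEMeasurable (fun y => ‖f y‖ₑ^2) volume := hf.1.enorm.pow_const 2
  have m1 : AEMeasurable (fun z : ℝ × ℝ => ‖f z.1‖ₑ^2 * ‖L z.1 z.2‖ₑ) (volume.prod volume) :=
    (hf.1.comp_fst.enorm.pow_const 2).mul hLm.enorm.aemeasurable
  have m2 : AEMeasurable (fun z : ℝ × ℝ => ‖f z.2‖ₑ^2 * ‖L z.1 z.2‖ₑ) (volume.prod volume) :=
    (hf.1.comp_snd.enorm.pow_const 2).mul hLm.enorm.aemeasurable
  have b1 : ∫⁻ z : ℝ × ℝ, ‖f z.1‖ₑ^2 * ‖L z.1 z.2‖ₑ ∂(volume.prod volume) ≤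
      ENNReal.ofReal A * ∫⁻ y, ‖f y‖ₑ^2 := by
    rw [lintegral_prod _ m1]
    rw [← lintegral_const_mul' _ _ ENNReal.ofReal_ne_top]
    refine lintegral_mono fun y => ?_
    simp only
    rw [lintegral_const_mul' _ _ (by simp), mul_comm]
    gcongr
    exact h y
  have b2 : ∫⁻ z : ℝ × ℝ, ‖f z.2‖ₑ^2 * ‖L z.1 z.2‖ₑ ∂(volume.prod volume) ≤
      ENNReal.ofReal A * ∫⁻ y, ‖f y‖ₑ^2 := by
    rw [lintegral_prod_symm _ m2]
    rw [← lintegral_const_mul' _ _ ENNReal.ofReal_ne_top]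
    refine lintegral_mono fun y => ?_
    simp only
    rw [lintegral_const_mul' _ _ (by simp), mul_comm]
    gcongr
    simp only [hsym _ y]
    exact h y
  rw [e2, integral_integral_swap hHint]
  simp only [e4]
  calc ‖∫ z : ℝ × ℝ, f z.1 * (starRingEnd ℂ) (f z.2) * L z.1 z.2 ∂(volume.prod volume)‖ₑ
      ≤ ∫⁻ z : ℝ × ℝ, ‖f z.1 * (starRingEnd ℂ) (f z.2) * L z.1 z.2‖ₑ ∂(volume.prod volume) :=
        enorm_integral_le_lintegral_enorm _
    _ ≤ ∫⁻ z : ℝ × ℝ, (‖f z.1‖ₑ^2 * ‖L z.1 z.2‖ₑ + ‖f z.2‖ₑ^2 * ‖L z.1 z.2‖ₑ) ∂(volume.prod volume) := by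
        refine lintegral_mono fun z => ?_
        have hc : ‖(starRingEnd ℂ) (f z.2)‖ₑ = ‖f z.2‖ₑ := by
          rw [← ofReal_norm, RCLike.norm_conj, ofReal_norm]
        rw [enorm_mul, enorm_mul, hc, ← add_mul]
        gcongr
        rcases le_total ‖f z.1‖ₑ ‖f z.2‖ₑ with hh | hh
        · calc ‖f z.1‖ₑ * ‖f z.2‖ₑ ≤ ‖f z.2‖ₑ * ‖f z.2‖ₑ := by gcongr
            _ = ‖f z.2‖ₑ^2 := (sq _).symm
            _ ≤ _ := le_add_self
        · calc ‖f z.1‖ₑ * ‖f z.2‖ₑ ≤ ‖f z.1‖ₑ * ‖f z.1‖ₑ := by gcongr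
            _ = ‖f z.1‖ₑ^2 := (sq _).symm
            _ ≤ _ := le_self_add
    _ = _ := lintegral_add_left' m1 _
    _ ≤ _ := add_le_add b1 b2
    _ = _ := by
        rw [← ENNReal.ofReal_pow (Real.sqrt_nonneg _), Real.sq_sqrt (by positivity),
          ENNReal.ofReal_mul (by norm_num)]
        simp
        ring

/-! scaling -/
lemma map_affine (x0 X : ℝ) (hX : X ≠ 0) :
    Measure.map (fun u : ℝ => x0 + X * u) volume = ENNReal.ofReal |X⁻¹| • (volume : Measure ℝ) := by
  have : (fun u : ℝ => x0 + X * u) = (fun v => x0 + v) ∘ (fun u => X * u) := rfl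
  rw [this, ← Measure.map_map (measurable_const_add x0) (measurable_const_mul X),
    Real.map_volume_mul_left hX, Measure.map_smul, map_add_left_eq_self]

lemma lint_affine (x0 X : ℝ) (hX : X ≠ 0) (g : ℝ → ENNReal) (hg : AEMeasurable g volume) :
    ∫⁻ x, g x = ENNReal.ofReal |X| * ∫⁻ u, g (x0 + X * u) := by
  have hm : Measurable (fun u : ℝ => x0 + X * u) := by fun_prop
  have h := lintegral_map' (μ := volume) (f := g) (g := fun u : ℝ => x0 + X * u) (by
    rw [map_affine x0 X hX]; exact hg.smul_measure _) hm.aemeasurable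
  rw [map_affine x0 X hX, lintegral_smul_measure] at h
  rw [← h, smul_eq_mul, ← mul_assoc, ← ENNReal.ofReal_mul (abs_nonneg _), ← abs_mul, mul_inv_cancel₀ hX]
  simp

lemma Ker.scale {K : ℝ → ℝ → ℂ} (k : Ker K) (x0 X y0 Y : ℝ) (hX : X ≠ 0) (hY : Y ≠ 0) :
    Ker (fun u v => K (x0 + X * u) (y0 + Y * v)) := by
  refine ⟨k.meas.comp (by fun_prop : Measurable fun z : ℝ × ℝ => (x0 + X * z.1, y0 + Y * z.2)), ?_⟩
  obtain ⟨M, R, hM, hR, h1, h2⟩ := k.bd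
  refine ⟨M, (R + |x0|)/|X| + (R + |y0|)/|Y|, hM, by positivity, fun x y => h1 _ _, ?_⟩
  intro u v huv
  have hX' := abs_pos.2 hX
  have hY' := abs_pos.2 hY
  have p1 : 0 ≤ (R + |x0|)/|X| := by positivity
  have p2 : 0 ≤ (R + |y0|)/|Y| := by positivity
  apply h2
  rcases huv with h | h
  · left
    have : (R + |x0|)/|X| < |u| := by linarith
    rw [div_lt_iff₀ hX'] at this
    have h3 := abs_sub_abs_le_abs_sub (X*u) (-x0)
    rw [abs_mul, abs_neg, sub_neg_eq_add, add_comm (X*u)] at h3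
    nlinarith
  · right
    have : (R + |y0|)/|Y| < |v| := by linarith
    rw [div_lt_iff₀ hY'] at this
    have h3 := abs_sub_abs_le_abs_sub (Y*v) (-y0)
    rw [abs_mul, abs_neg, sub_neg_eq_add, add_comm (Y*v)] at h3
    nlinarith

lemma Bd_scale {K : ℝ → ℝ → ℂ} (k : Ker K) {x0 X y0 Y A : ℝ} (hX : X ≠ 0) (hY : Y ≠ 0)
    (h : Bd (fun u v => K (x0 + X * u) (y0 + Y * v)) A) : Bd K (Real.sqrt (|X| * |Y|) * A) := by
  apply Bd_of_sq
  intro f hf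
  set g : ℝ → ℂ := fun v => f (y0 + Y * v) with hg
  have hgm : MemLp g 2 volume := by
    have hm : Measurable (fun u : ℝ => y0 + Y * u) := by fun_prop
    have : MemLp f 2 (Measure.map (fun u : ℝ => y0 + Y * u) volume) := by
      rw [map_affine y0 Y hY]; exact hf.smul_measure (by simp)
    exact this.comp_of_map hm.aemeasurable
  have e1 : ∀ u, Tp K f (x0 + X * u) = (|Y| : ℝ) • Tp (fun u v => K (x0 + X * u) (y0 + Y * v)) g u := by
    intro u
    simp only [Tp, hg]
    have h1 := Measure.integral_comp_mul_left (fun v => K (x0 + X * u) (y0 + v) * f (y0 + v)) Y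
    rw [h1, integral_add_left_eq_self (fun v => K (x0 + X * u) v * f v) y0, smul_smul, abs_inv,
      mul_inv_cancel₀ (abs_pos.2 hY).ne', one_smul]
  rw [lint_affine x0 X hX _ (((k.aesm hf).enorm).pow_const 2)]
  have e2 : ∫⁻ y, ‖f y‖ₑ^2 = ENNReal.ofReal |Y| * ∫⁻ v, ‖g v‖ₑ^2 :=
    lint_affine y0 Y hY _ (hf.1.enorm.pow_const 2)
  rw [e2]
  have e3 : ∫⁻ u, ‖Tp K f (x0 + X * u)‖ₑ^2 = ENNReal.ofReal |Y|^2 * 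
      ∫⁻ u, ‖Tp (fun u v => K (x0 + X * u) (y0 + Y * v)) g u‖ₑ^2 := by
    rw [← lintegral_const_mul' _ _ (by simp)]
    refine lintegral_congr fun u => ?_
    rw [e1, enorm_smul, mul_pow]
    congr 2
    rw [← ofReal_norm, Real.norm_eq_abs, abs_abs]
  rw [e3]
  have := h.sq g hgm
  calc _ ≤ ENNReal.ofReal |X| * (ENNReal.ofReal |Y|^2 * (ENNReal.ofReal A ^2 * ∫⁻ v, ‖g v‖ₑ^2)) := by gcongr
    _ = _ := by
      rw [ENNReal.ofReal_mul (Real.sqrt_nonneg _), mul_pow, ← ENNReal.ofReal_pow (Real.sqrt_nonneg _),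
          Real.sq_sqrt (by positivity), ENNReal.ofReal_mul (abs_nonneg _)]
      ring

/-- integral of `|y-y'|^{-s}` -/
lemma lint_pow {s : ℝ} (hs0 : 0 ≤ s) (hs : s < 1) (p r y : ℝ) (hr : 0 ≤ r) (hy : y ∈ Set.Icc p (p + r)) :
    ∫⁻ y' in Set.Icc p (p+r), ENNReal.ofReal (|y - y'| ^ (-s)) ≤ ENNReal.ofReal (2 / (1 - s) * r^(1-s)) := by
  have hbase : ∫⁻ t in Set.Icc (-r) r, ENNReal.ofReal (|t| ^ (-s)) ≤ ENNReal.ofReal (2 / (1 - s) * r^(1-s)) := by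
    have h1 : ∫⁻ t in Set.Icc 0 r, ENNReal.ofReal (|t| ^ (-s)) ≤ ENNReal.ofReal (1 / (1 - s) * r^(1-s)) := by
      have hi : IntervalIntegrable (fun t : ℝ => t ^ (-s)) volume 0 r :=
        intervalIntegral.intervalIntegrable_rpow' (by linarith)
      rw [intervalIntegrable_iff_integrableOn_Icc_of_le hr] at hi
      have hI : ∫ t in (0:ℝ)..r, t^(-s) = 1 / (1-s) * r^(1-s) := by
        rw [integral_rpow (Or.inl (by linarith)), Real.zero_rpow (by linarith)]
        rw [show -s + 1 = 1 - s by ring]; ring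
      rw [← hI, intervalIntegral.integral_of_le hr, ← integral_Icc_eq_integral_Ioc,
        ofReal_integral_eq_lintegral_ofReal hi]
      · refine le_of_eq (setLIntegral_congr_fun measurableSet_Icc fun t ht => ?_)
        rw [abs_of_nonneg ht.1]
      · filter_upwards [ae_restrict_mem measurableSet_Icc] with t ht
        exact Real.rpow_nonneg ht.1 _
    have h2 : ∫⁻ t in Set.Icc (-r) 0, ENNReal.ofReal (|t| ^ (-s)) = ∫⁻ t in Set.Icc 0 r, ENNReal.ofReal (|t| ^ (-s)) := by
      rw [← lintegral_indicator measurableSet_Icc, ← lintegral_indicator measurableSet_Icc,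
        ← lintegral_neg_eq_self]
      refine lintegral_congr fun t => ?_
      by_cases ht : t ∈ Set.Icc 0 r
      · rw [Set.indicator_of_mem ht, Set.indicator_of_mem, abs_neg]
        exact ⟨by linarith [ht.2], by linarith [ht.1]⟩
      · rw [Set.indicator_of_notMem ht, Set.indicator_of_notMem]
        intro h; exact ht ⟨by linarith [h.2], by linarith [h.1]⟩
    calc ∫⁻ t in Set.Icc (-r) r, ENNReal.ofReal (|t| ^ (-s)) ≤ ∫⁻ t in Set.Icc (-r) 0 ∪ Set.Icc 0 r, ENNReal.ofReal (|t| ^ (-s)) := by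
          apply lintegral_mono_set
          intro t ht
          rcases le_total t 0 with h | h
          · exact Or.inl ⟨ht.1, h⟩
          · exact Or.inr ⟨h, ht.2⟩
      _ ≤ _ := lintegral_union_le _ _ _
      _ ≤ ENNReal.ofReal (1 / (1 - s) * r^(1-s)) + ENNReal.ofReal (1 / (1 - s) * r^(1-s)) := by
          rw [h2]; exact add_le_add h1 h1
      _ = _ := by
          have : 0 < 1 - s := by linarith
          rw [← ENNReal.ofReal_add (by positivity) (by positivity)]; congr 1; ring
  refine le_trans ?_ hbase
  rw [← lintegral_indicator measurableSet_Icc, ← lintegral_indicator measurableSet_Icc,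
    ← lintegral_add_left_eq_self _ y]
  refine lintegral_mono fun t => ?_
  by_cases ht : y + t ∈ Set.Icc p (p+r)
  · rw [Set.indicator_of_mem ht, Set.indicator_of_mem, show y - (y + t) = -t by ring, abs_neg]
    exact ⟨by linarith [ht.1, hy.2], by linarith [ht.2, hy.1]⟩
  · rw [Set.indicator_of_notMem ht]; exact zero_le

lemma geom_small {q : ℝ} (hq0 : 0 ≤ q) (hq : q < 1) (N : ℕ) : ∑ m ∈ Finset.range N, q^m ≤ 1 / (1-q) := by
  rw [one_div, ← tsum_geometric_of_lt_one hq0 hq]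
  exact (summable_geometric_of_lt_one hq0 hq).sum_le_tsum _ fun i _ => by positivity

lemma geom_sum {ρ e1 e2 : ℝ} (hρ : 1 < ρ) (h1 : 0 < e1) (h2 : 0 < e2) : ∃ C > (0:ℝ), ∀ N : ℕ, ∀ t : ℝ, 0 < t →
    ∑ m ∈ Finset.range N, min ((t / ρ^m)^e1) ((t / ρ^m)^(-e2)) ≤ C := by
  have hρ0 : 0 < ρ := by linarith
  set q := (1/ρ)^e1 with hq
  have hq1 : q < 1 := Real.rpow_lt_one (by positivity) (by rw [div_lt_one hρ0]; exact hρ) h1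
  have hq0 : 0 ≤ q := by positivity
  set C1 := 1 / (1-q) with hC1
  have hC10 : 0 < C1 := by have : 0 < 1 - q := by linarith
                           positivity
  have hr : 1 < ρ^e2 := Real.one_lt_rpow hρ h2
  set E := 1 / (ρ^e2 - 1) with hE
  have hE0 : 0 < E := by have : 0 < ρ^e2 - 1 := by linarith
                         positivity
  have small : ∀ N : ℕ, ∀ t : ℝ, 0 < t → t ≤ 1 → 
      ∑ m ∈ Finset.range N, min ((t / ρ^m)^e1) ((t / ρ^m)^(-e2)) ≤ C1 := by
    intro N t ht ht1
    refine le_trans (Finset.sum_le_sum fun m _ => ?_) (geom_small hq0 hq1 N)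
    refine (min_le_left _ _).trans ?_
    rw [hq, ← Real.rpow_natCast ((1/ρ)^e1), ← Real.rpow_mul (by positivity), mul_comm, Real.rpow_mul (by positivity), Real.rpow_natCast]
    apply Real.rpow_le_rpow (by positivity) _ h1.le
    rw [div_pow, one_pow]; gcongr
  have big : ∀ N : ℕ, ∀ t : ℝ, 1 < t → 
      ∑ m ∈ Finset.range N, min ((t / ρ^m)^e1) ((t / ρ^m)^(-e2)) ≤ C1 + (E + 1) - E * t^(-e2) := by
    intro N
    induction N with
    | zero =>
      intro t ht
      have : t^(-e2) ≤ 1 := Real.rpow_le_one_of_one_le_of_nonpos ht.le (by linarith)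
      simp; nlinarith
    | succ N ih =>
      intro t ht
      have ht0 : 0 < t := by linarith
      rw [Finset.sum_range_succ']
      have e : ∀ m, t / ρ^(m+1) = (t/ρ) / ρ^m := by intro m; rw [pow_succ]; field_simp
      simp only [e]
      have hlast : min ((t / ρ^0)^e1) ((t / ρ^0)^(-e2)) ≤ t^(-e2) := by
        refine (min_le_right _ _).trans ?_; simp
      have hp : 0 ≤ t^(-e2) := by positivity
      rcases le_or_gt (t/ρ) 1 with h | h
      · have := small N (t/ρ) (by positivity) h
        have : t^(-e2) ≤ 1 := Real.rpow_le_one_of_one_le_of_nonpos ht.le (by linarith)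
        nlinarith
      · have h3 := ih (t/ρ) h
        have h4 : (t/ρ)^(-e2) = t^(-e2) * ρ^e2 := by
          rw [Real.div_rpow ht0.le hρ0.le, Real.rpow_neg hρ0.le, div_inv_eq_mul]
        rw [h4] at h3
        have h5 : E * (t^(-e2) * ρ^e2) = E * t^(-e2) + t^(-e2) := by
          have : E * (ρ^e2 - 1) = 1 := by
            rw [hE]; field_simp [show ρ^e2 - 1 ≠ 0 by linarith]
          calc E * (t^(-e2) * ρ^e2) = E * t^(-e2) + t^(-e2) * (E * (ρ^e2 - 1)) := by ring
            _ = _ := by rw [this, mul_one]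
        linarith
  refine ⟨C1 + (E+1), by positivity, fun N t ht => ?_⟩
  rcases le_or_gt t 1 with h | h
  · linarith [small N t ht h]
  · have := big N t h
    have : 0 ≤ E * t^(-e2) := by positivity
    linarith

structure Fam (G : ℕ → ℕ → ℝ → ℝ → ℝ) : Prop where
  dx : ∀ α β y x, HasDerivAt (fun x => G α β x y) (G (α+1) β x y) x
  dy : ∀ α β x y, HasDerivAt (fun y => G α β x y) (G α (β+1) x y) y
  c : ∀ α β, Continuous (fun z : ℝ × ℝ => G α β z.1 z.2)

lemma Fam.chx {G} (h : Fam G) (α β : ℕ) (y : ℝ) : Chn (fun k x => G (k+α) β x y) := by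
  intro k x
  have := h.dx (k+α) β y x
  rwa [show k + α + 1 = k + 1 + α by ring] at this

lemma Fam.chy {G} (h : Fam G) (α β : ℕ) (x : ℝ) : Chn (fun k y => G α (k+β) x y) := by
  intro k y
  have := h.dy α (k+β) x y
  rwa [show k + β + 1 = k + 1 + β by ring] at this

structure Amp (A A1 : ℝ → ℝ → ℂ) (A0 : ℝ) : Prop where
  dx : ∀ y x, HasDerivAt (fun x => A x y) (A1 x y) x
  c : Continuous (fun z : ℝ × ℝ => A z.1 z.2)
  c1 : Continuous (fun z : ℝ × ℝ => A1 z.1 z.2)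
  b : ∀ x y, ‖A x y‖ ≤ A0
  b1 : ∀ x y, ‖A1 x y‖ ≤ A0

def bx (lam : ℝ) (S : ℝ → ℝ → ℝ) (A : ℝ → ℝ → ℂ) (E : Set (ℝ × ℝ)) : ℝ → ℝ → ℂ := fun x y =>
  E.indicator (fun z => Complex.exp (Complex.I * lam * S z.1 z.2) * A z.1 z.2) (x, y)

lemma exp_norm (lam s : ℝ) : ‖Complex.exp (Complex.I * lam * s)‖ = 1 := osc_norm lam (fun _ => s) 0

lemma bx_norm {lam : ℝ} {S : ℝ → ℝ → ℝ} {A : ℝ → ℝ → ℂ} {E : Set (ℝ × ℝ)} (x y : ℝ) :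
    ‖bx lam S A E x y‖ ≤ ‖A x y‖ := by
  unfold bx
  refine (norm_indicator_le_norm_self _ _).trans ?_
  rw [norm_mul, exp_norm, one_mul]

lemma bx_ker {lam : ℝ} {S : ℝ → ℝ → ℝ} {A : ℝ → ℝ → ℂ} {E : Set (ℝ × ℝ)} {A0 R : ℝ} (hE : MeasurableSet E)
    (hR : 0 ≤ R) (hER : E ⊆ Set.Icc (-R) R ×ˢ Set.Icc (-R) R) 
    (hS : Continuous (fun z : ℝ × ℝ => S z.1 z.2)) (hA : Continuous (fun z : ℝ × ℝ => A z.1 z.2))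
    (hb : ∀ x y, ‖A x y‖ ≤ A0) : Ker (bx lam S A E) := by
  refine ⟨?_, A0, R, (norm_nonneg _).trans (hb 0 0), hR, fun x y => (bx_norm x y).trans (hb x y), ?_⟩
  · have : Measurable (fun z : ℝ × ℝ => Complex.exp (Complex.I * lam * S z.1 z.2) * A z.1 z.2) := by
      apply Continuous.measurable; fun_prop
    exact this.indicator hE
  · intro x y hxy
    unfold bx
    apply Set.indicator_of_notMem
    intro h
    have := hER h
    have h1 := abs_le.2 this.1
    have h2 := abs_le.2 this.2
    simp only at h1 h2
    rcases hxy with h | h <;> linarith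

lemma bx_ker01 {lam : ℝ} {G} (hG : Fam G) {A A1 : ℝ → ℝ → ℂ} {A0 : ℝ} (hA : Amp A A1 A0)
    {E : Set (ℝ × ℝ)} (hE : MeasurableSet E) (h : E ⊆ Set.Icc 0 1 ×ˢ Set.Icc 0 1) : Ker (bx lam (G 0 0) A E) := by
  refine bx_ker hE zero_le_one (h.trans ?_) (hG.c 0 0) hA.c hA.b
  apply Set.prod_mono <;> exact Set.Icc_subset_Icc (by norm_num) le_rfl

lemma pieceTT {lam : ℝ} {G} (hG : Fam G) {A A1 : ℝ → ℝ → ℂ} {A0 : ℝ} (hA : Amp A A1 A0)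
    {F : Set ℝ} (hF : MeasurableSet F) (hF1 : F ⊆ Set.Icc 0 1) {s0 r : ℝ} (hr : 0 ≤ r) (hs0 : 0 ≤ s0)
    (hs1 : s0 + r ≤ 1) {D s : ℝ} (hD : 0 ≤ D) (h0s : 0 ≤ s) (h1s : s < 1)
    (H : ∀ y ∈ Set.Icc s0 (s0+r), ∀ y' ∈ Set.Icc s0 (s0+r), y ≠ y' →
      ‖∫ x in (0:ℝ)..1, F.indicator (fun x => osc lam (fun x => G 0 0 x y - G 0 0 x y') x * 
        (A x y * (starRingEnd ℂ) (A x y'))) x‖ ≤ D * |y - y'|^(-s)) :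
    Bd (bx lam (G 0 0) A (F ×ˢ Set.Ico s0 (s0+r))) (Real.sqrt (2 * (D * (2/(1-s) * r^(1-s))))) := by
  have h1s' : 0 < 1 - s := by linarith
  have hk : Ker (bx lam (G 0 0) A (F ×ˢ Set.Ico s0 (s0+r))) := by
    apply bx_ker01 hG hA (hF.prod measurableSet_Ico)
    apply Set.prod_mono hF1
    exact Set.Ico_subset_Icc_self.trans (Set.Icc_subset_Icc hs0 hs1)
  refine Bd_TT hk (by positivity) ?_
  intro y
  by_cases hy : y ∈ Set.Ico s0 (s0+r)
  swap
  · have : ∀ x, bx lam (G 0 0) A (F ×ˢ Set.Ico s0 (s0+r)) x y = 0 := by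
      intro x; apply Set.indicator_of_notMem; exact fun h => hy h.2
    simp [this]
  have hyI := Set.Ico_subset_Icc_self hy
  have key : ∀ y' , y' ≠ y → ‖∫ x, bx lam (G 0 0) A (F ×ˢ Set.Ico s0 (s0+r)) x y * 
      (starRingEnd ℂ) (bx lam (G 0 0) A (F ×ˢ Set.Ico s0 (s0+r)) x y')‖ₑ ≤ 
      (Set.Icc s0 (s0+r)).indicator (fun y' => ENNReal.ofReal D * ENNReal.ofReal (|y-y'|^(-s))) y' := by
    intro y' hne
    by_cases hy' : y' ∈ Set.Ico s0 (s0+r)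
    swap
    · have : ∀ x, bx lam (G 0 0) A (F ×ˢ Set.Ico s0 (s0+r)) x y' = 0 := by
        intro x; apply Set.indicator_of_notMem; exact fun h => hy' h.2
      simp [this]
    have hyI' := Set.Ico_subset_Icc_self hy'
    rw [Set.indicator_of_mem hyI', ← ENNReal.ofReal_mul hD, ← ofReal_norm]
    apply ENNReal.ofReal_le_ofReal
    refine le_trans (le_of_eq ?_) (H y hyI y' hyI' hne.symm)
    congr 1
    rw [intervalIntegral.integral_of_le zero_le_one, ← integral_Icc_eq_integral_Ioc,
      setIntegral_eq_integral_of_forall_compl_eq_zero]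
    · refine integral_congr_ae (Filter.Eventually.of_forall fun x => ?_)
      by_cases hx : x ∈ F
      · have e : ∀ t ∈ Set.Ico s0 (s0+r), bx lam (G 0 0) A (F ×ˢ Set.Ico s0 (s0+r)) x t = 
            Complex.exp (Complex.I * lam * G 0 0 x t) * A x t := by
          intro t ht
          exact Set.indicator_of_mem (Set.mk_mem_prod hx ht) _
        simp only [e y hy, e y' hy', Set.indicator_of_mem hx, osc]
        rw [map_mul, ← Complex.exp_conj]
        have : Complex.exp (Complex.I * lam * ((G 0 0 x y - G 0 0 x y' : ℝ) : ℂ)) = 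
            Complex.exp (Complex.I * lam * G 0 0 x y) * Complex.exp ((starRingEnd ℂ) (Complex.I * lam * G 0 0 x y')) := by
          rw [← Complex.exp_add]; congr 1
          simp only [map_mul, Complex.conj_I, Complex.conj_ofReal]; push_cast; ring
        rw [this]; ring
      · have e : ∀ t, bx lam (G 0 0) A (F ×ˢ Set.Ico s0 (s0+r)) x t = 0 := by
          intro t; apply Set.indicator_of_notMem; exact fun h => hx h.1
        simp [e, hx]
    · intro x hx
      exact Set.indicator_of_notMem (fun h => hx (hF1 h)) _
  calc _ ≤ ∫⁻ y', (Set.Icc s0 (s0+r)).indicator (fun y' => ENNReal.ofReal D * ENNReal.ofReal (|y-y'|^(-s))) y' := by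
        apply lintegral_mono_ae
        have : ∀ᵐ y' : ℝ, y' ≠ y := by simp [ae_iff]
        filter_upwards [this] with y' hy'
        exact key y' hy'
    _ = ENNReal.ofReal D * ∫⁻ y' in Set.Icc s0 (s0+r), ENNReal.ofReal (|y-y'|^(-s)) := by
        rw [lintegral_indicator measurableSet_Icc, lintegral_const_mul' _ _ ENNReal.ofReal_ne_top]
    _ ≤ _ := by
        rw [ENNReal.ofReal_mul hD]
        gcongr
        exact lint_pow h0s h1s s0 r y hr hyI

lemma Fam.phase {G} (hG : Fam G) (y y' : ℝ) : Chn (fun k x => G k 0 x y - G k 0 x y') := by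
  intro k x
  exact (hG.dx k 0 y x).sub (hG.dx k 0 y' x)

lemma Fam.phase_lb {G} (hG : Fam G) (k : ℕ) {m x y y' : ℝ} {I : Set ℝ} [I.OrdConnected] (hy : y ∈ I) (hy' : y' ∈ I)
    (h : ∀ t ∈ I, m ≤ |G k 1 x t|) : m * |y - y'| ≤ |G k 0 x y - G k 0 x y'| := by
  rcases le_total y y' with hh | hh
  · obtain ⟨z, hz, e⟩ := (hG.chy k 0 x).mvt 0 hh
    simp only [zero_add] at e
    rw [abs_sub_comm (G k 0 x y), abs_sub_comm y, e, abs_mul]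
    gcongr
    exact h z (Set.OrdConnected.out ‹_› hy hy' hz)
  · obtain ⟨z, hz, e⟩ := (hG.chy k 0 x).mvt 0 hh
    simp only [zero_add] at e
    rw [e, abs_mul]
    gcongr
    exact h z (Set.OrdConnected.out ‹_› hy' hy hz)

lemma Amp.w {A A1 : ℝ → ℝ → ℂ} {A0 : ℝ} (hA : Amp A A1 A0) (y y' : ℝ) :
    (∀ x, HasDerivAt (fun x => A x y * (starRingEnd ℂ) (A x y')) 
      (A1 x y * (starRingEnd ℂ) (A x y') + A x y * (starRingEnd ℂ) (A1 x y')) x) ∧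
    Continuous (fun x => A1 x y * (starRingEnd ℂ) (A x y') + A x y * (starRingEnd ℂ) (A1 x y')) ∧
    (∀ x, ‖A x y * (starRingEnd ℂ) (A x y')‖ ≤ 2 * A0^2) ∧ 
    (∀ x, ‖A1 x y * (starRingEnd ℂ) (A x y') + A x y * (starRingEnd ℂ) (A1 x y')‖ ≤ 2 * A0^2) := by
  have hA0 : 0 ≤ A0 := (norm_nonneg _).trans (hA.b 0 0)
  have c : ∀ t, Continuous (fun x => A x t) := fun t => hA.c.comp (by fun_prop : Continuous fun x : ℝ => (x, t))
  have c1 : ∀ t, Continuous (fun x => A1 x t) := fun t => hA.c1.comp (by fun_prop : Continuous fun x : ℝ => (x, t))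
  refine ⟨fun x => (hA.dx y x).mul ?_, ?_, ?_, ?_⟩
  · exact (hA.dx y' x).star
  · exact ((c1 y).mul (Complex.continuous_conj.comp (c y'))).add ((c y).mul (Complex.continuous_conj.comp (c1 y')))
  · intro x
    rw [norm_mul, RCLike.norm_conj]
    have := mul_le_mul (hA.b x y) (hA.b x y') (norm_nonneg _) hA0
    nlinarith
  · intro x
    refine (norm_add_le _ _).trans ?_
    rw [norm_mul, RCLike.norm_conj, norm_mul, RCLike.norm_conj]
    have := mul_le_mul (hA.b1 x y) (hA.b x y') (norm_nonneg _) hA0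
    have := mul_le_mul (hA.b x y) (hA.b1 x y') (norm_nonneg _) hA0
    nlinarith

lemma rpow_root {X : ℝ} (hX : 0 < X) (a : ℕ) : (X^(-(1/((a:ℝ)+1))))^(a+1) * X = 1 := by
  rw [← Real.rpow_natCast, ← Real.rpow_mul hX.le]
  have : -(1/((a:ℝ)+1)) * ((a+1 : ℕ) : ℝ) = -1 := by
    push_cast; field_simp
  rw [this, Real.rpow_neg_one, inv_mul_cancel₀ hX.ne']

/-- raw oscillatory bounds -/
lemma osc_bad (a : ℕ) (ha : 1 ≤ a) (A0 c : ℝ) (hc : 0 < c) (N : ℕ) : ∃ C ≥ (0:ℝ), ∀ G, Fam G → ∀ A A1, Amp A A1 A0 →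
    ∀ lam : ℝ, lam ≠ 0 → (∀ x ∈ Set.Icc (0:ℝ) 1, ∀ y ∈ Set.Icc (0:ℝ) 1, c ≤ |G (a+1) 1 x y|) →
    ∀ F : Set ℝ, MeasurableSet F → ∀ Z : Finset ℝ, Z.card ≤ N → BR Z F → 
    ∀ y ∈ Set.Icc (0:ℝ) 1, ∀ y' ∈ Set.Icc (0:ℝ) 1, y ≠ y' →
      ‖∫ x in (0:ℝ)..1, F.indicator (fun x => osc lam (fun x => G 0 0 x y - G 0 0 x y') x * 
        (A x y * (starRingEnd ℂ) (A x y'))) x‖ ≤ C * (|lam| * |y - y'|)^(-(1/((a:ℝ)+1))) := by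
  obtain ⟨C, hC, H⟩ := V1 a ha
  refine ⟨2^N * (C * (2 * A0^2) * c^(-(1/((a:ℝ)+1)))), by positivity, ?_⟩
  intro G hG A A1 hA lam hl hlow F hF Z hZN hZ y hy y' hy' hne
  have hlam := abs_pos.2 hl
  have hh : 0 < |y - y'| := abs_pos.2 (sub_ne_zero.2 hne)
  have hw := hA.w y y'
  have := H lam hl _ (hG.phase y y') _ _ (2 * A0^2) (c * |y-y'|) ((|lam| * (c * |y-y'|))^(-(1/((a:ℝ)+1))))
    (by positivity) (by positivity) (rpow_root (by positivity) a) (fun x _ => hw.1 x) hw.2.1.continuousOn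
    (fun x _ => hw.2.2.1 x) (fun x _ => hw.2.2.2 x) (fun x hx => hG.phase_lb (a+1) hy hy' (fun t ht => hlow x hx t ht))
    F hF Z hZ
  refine this.trans ?_
  rw [show |lam| * (c * |y-y'|) = c * (|lam| * |y-y'|) by ring, Real.mul_rpow hc.le (by positivity)]
  calc (2:ℝ)^Z.card * (C * (2 * A0^2) * (c^(-(1/((a:ℝ)+1))) * (|lam| * |y-y'|)^(-(1/((a:ℝ)+1))))) ≤
      2^N * (C * (2 * A0^2) * (c^(-(1/((a:ℝ)+1))) * (|lam| * |y-y'|)^(-(1/((a:ℝ)+1))))) := by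
        gcongr; norm_num
    _ = _ := by ring

lemma osc_good (a : ℕ) (ha : 1 ≤ a) (A0 : ℝ) (N : ℕ) : ∃ C ≥ (0:ℝ), ∀ G, Fam G → ∀ A A1, Amp A A1 A0 →
    ∀ lam : ℝ, lam ≠ 0 → (∀ x ∈ Set.Icc (0:ℝ) 1, ∀ y ∈ Set.Icc (0:ℝ) 1, 0 < |G (a+1) 1 x y|) →
    ∀ F : Set ℝ, MeasurableSet F → ∀ Z : Finset ℝ, Z.card ≤ N → BR Z F → 
    ∀ p q μ : ℝ, 0 ≤ p → q ≤ 1 → 0 < μ → (∀ x ∈ F, x ∈ Set.Icc (0:ℝ) 1 → ∀ t ∈ Set.Icc p q, μ ≤ |G 1 1 x t|) →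
    ∀ y ∈ Set.Icc p q, ∀ y' ∈ Set.Icc p q, y ≠ y' →
      ‖∫ x in (0:ℝ)..1, F.indicator (fun x => osc lam (fun x => G 0 0 x y - G 0 0 x y') x * 
        (A x y * (starRingEnd ℂ) (A x y'))) x‖ ≤ C * (|lam| * |y - y'| * μ)⁻¹ := by
  refine ⟨2^(N+a) * (2*A0^2*5), by positivity, ?_⟩
  intro G hG A A1 hA lam hl hne0 F hF Z hZN hZ p q μ hp hq hμ hlow y hy y' hy' hne
  have hlam := abs_pos.2 hl
  have hh : 0 < |y - y'| := abs_pos.2 (sub_ne_zero.2 hne)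
  have hw := hA.w y y'
  have hs : Set.Icc p q ⊆ Set.Icc 0 1 := Set.Icc_subset_Icc hp hq
  have := V2 ha hl (hG.phase y y') (μ := μ * |y-y'|) (W := 2*A0^2) (by positivity) (fun x _ => hw.1 x) hw.2.1.continuousOn
    (fun x _ => hw.2.2.1 x) (fun x _ => hw.2.2.2 x) (by
      intro x hx h0
      obtain ⟨m, hm, hm2⟩ := isCompact_Icc.exists_isMinOn (s := Set.Icc (0:ℝ) 1) ⟨0, by simp⟩
        (f := fun t => |G (a+1) 1 x t|) ((hG.c (a+1) 1).comp (by fun_prop : Continuous fun t : ℝ => (x, t))).abs.continuousOn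
      have := hG.phase_lb (a+1) (hs hy) (hs hy') (fun t ht => hm2 ht)
      have h0 : G (a+1) 0 x y - G (a+1) 0 x y' = 0 := h0
      rw [h0, abs_zero] at this
      have := mul_pos (hne0 x hx m hm) hh
      linarith) hF hZ (fun x hx hx1 => hG.phase_lb 1 hy hy' (fun t ht => hlow x hx hx1 t ht))
  refine this.trans ?_
  calc (2:ℝ)^(Z.card + a) * (2*A0^2*(5/(μ*|y-y'|))/|lam|) ≤ 2^(N+a) * (2*A0^2*(5/(μ*|y-y'|))/|lam|) := by
        gcongr; norm_num
    _ = _ := by field_simp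

lemma sq3 {Q L m R : ℝ} (hQ : 0 ≤ Q) (hL : 0 ≤ L) (hm : 0 ≤ m) (hR : 0 ≤ R) (s t u : ℝ) :
    Real.sqrt (Q * (L^s*m^t*R^u)) = Real.sqrt Q * (L^(s/2)*m^(t/2)*R^(u/2)) := by
  rw [Real.sqrt_mul hQ]
  congr 1
  rw [Real.sqrt_eq_rpow, Real.mul_rpow (by positivity) (by positivity), Real.mul_rpow (by positivity) (by positivity),
    ← Real.rpow_mul hL, ← Real.rpow_mul hm, ← Real.rpow_mul hR]
  simp only [mul_one_div]

lemma piece_bad (a : ℕ) (ha : 1 ≤ a) (A0 c : ℝ) (hc : 0 < c) (N : ℕ) : ∃ C ≥ (0:ℝ), ∀ G, Fam G → ∀ A A1, Amp A A1 A0 →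
    ∀ lam : ℝ, lam ≠ 0 → (∀ x ∈ Set.Icc (0:ℝ) 1, ∀ y ∈ Set.Icc (0:ℝ) 1, c ≤ |G (a+1) 1 x y|) →
    ∀ F : Set ℝ, MeasurableSet F → F ⊆ Set.Icc 0 1 → ∀ Z : Finset ℝ, Z.card ≤ N → BR Z F → 
    ∀ s0 r : ℝ, 0 < r → 0 ≤ s0 → s0 + r ≤ 1 → 
    Bd (bx lam (G 0 0) A (F ×ˢ Set.Ico s0 (s0+r))) 
      (C * (|lam|^(-(1/(2*((a:ℝ)+1)))) * r^((a:ℝ)/(2*((a:ℝ)+1))))) := by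
  obtain ⟨C, hC, H⟩ := osc_bad a ha A0 c hc N
  set s : ℝ := 1/((a:ℝ)+1) with hs
  have ha' : (1:ℝ) ≤ a := by exact_mod_cast ha
  have hs1 : s < 1 := by rw [hs, div_lt_one (by positivity)]; linarith
  have h1s' : 0 < 1 - s := by linarith
  refine ⟨Real.sqrt (2 * (C * (2/(1-s)))), by positivity, ?_⟩
  intro G hG A A1 hA lam hl hlow F hF hF1 Z hZN hZ s0 r hr hs0 hs01
  have hlam := abs_pos.2 hl
  have hsub : Set.Icc s0 (s0+r) ⊆ Set.Icc 0 1 := Set.Icc_subset_Icc hs0 hs01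
  have := pieceTT (lam := lam) hG hA hF hF1 hr.le hs0 hs01 (D := C * |lam|^(-s)) (s := s) (by positivity)
    (by positivity) hs1 (by
      intro y hy y' hy' hne
      refine (H G hG A A1 hA lam hl hlow F hF Z hZN hZ y (hsub hy) y' (hsub hy') hne).trans (le_of_eq ?_)
      rw [Real.mul_rpow (abs_nonneg _) (abs_nonneg _)]; ring)
  convert this using 1
  rw [show 2 * (C * |lam|^(-s) * (2/(1-s) * r^(1-s))) = (2 * (C * (2/(1-s)))) * (|lam|^(-s) * (1:ℝ)^(1:ℝ) * r^(1-s)) by rw [Real.one_rpow]; ring,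
    sq3 (by positivity) (by positivity) (by positivity) (by positivity), Real.one_rpow, mul_one]
  have e1 : -(1/(2*((a:ℝ)+1))) = -s/2 := by rw [hs]; field_simp
  have e2 : (a:ℝ)/(2*((a:ℝ)+1)) = (1-s)/2 := by rw [hs]; field_simp; ring
  rw [e1, e2]

lemma piece_good (a : ℕ) (ha : 1 ≤ a) (A0 c : ℝ) (hc : 0 < c) (N : ℕ) : ∃ C ≥ (0:ℝ), ∀ G, Fam G → ∀ A A1, Amp A A1 A0 →
    ∀ lam : ℝ, lam ≠ 0 → (∀ x ∈ Set.Icc (0:ℝ) 1, ∀ y ∈ Set.Icc (0:ℝ) 1, c ≤ |G (a+1) 1 x y|) →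
    ∀ F : Set ℝ, MeasurableSet F → F ⊆ Set.Icc 0 1 → ∀ Z : Finset ℝ, Z.card ≤ N → BR Z F → 
    ∀ s0 r μ : ℝ, 0 < r → 0 ≤ s0 → s0 + r ≤ 1 → 0 < μ → (∀ x ∈ F, ∀ t ∈ Set.Icc s0 (s0+r), μ ≤ |G 1 1 x t|) →
    Bd (bx lam (G 0 0) A (F ×ˢ Set.Ico s0 (s0+r))) 
      (C * (|lam|^(-((a+2)/(4*((a:ℝ)+1)))) * μ^(-(1/4:ℝ)) * r^((a:ℝ)/(4*((a:ℝ)+1))))) := by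
  obtain ⟨C1, hC1, H1⟩ := osc_bad a ha A0 c hc N
  obtain ⟨C2, hC2, H2⟩ := osc_good a ha A0 N
  set s : ℝ := (a+2)/(2*((a:ℝ)+1)) with hs
  have ha' : (1:ℝ) ≤ a := by exact_mod_cast ha
  have hs1 : s < 1 := by rw [hs, div_lt_one (by positivity)]; linarith
  have h1s' : 0 < 1 - s := by linarith
  have hs0' : 0 ≤ s := by positivity
  set C := C1 + C2 with hC
  have hC0 : 0 ≤ C := by positivity
  refine ⟨Real.sqrt (2 * (C * (2/(1-s)))), by positivity, ?_⟩
  intro G hG A A1 hA lam hl hlow F hF hF1 Z hZN hZ s0 r μ hr hs0 hs01 hμ hΨ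
  have hlam := abs_pos.2 hl
  have hsub : Set.Icc s0 (s0+r) ⊆ Set.Icc 0 1 := Set.Icc_subset_Icc hs0 hs01
  have := pieceTT (lam := lam) hG hA hF hF1 hr.le hs0 hs01 (D := C * (|lam|^(-s) * μ^(-(1/2:ℝ)))) (s := s) (by positivity)
    hs0' hs1 (by
      intro y hy y' hy' hne
      have b1 := H1 G hG A A1 hA lam hl hlow F hF Z hZN hZ y (hsub hy) y' (hsub hy') hne
      have b2 := H2 G hG A A1 hA lam hl (fun x hx y hy => hc.trans_le (hlow x hx y hy)) F hF Z hZN hZ s0 (s0+r) μ hs0 hs01 hμ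
        (fun x hx _ => hΨ x hx) y hy y' hy' hne
      have hh : 0 < |y - y'| := abs_pos.2 (sub_ne_zero.2 hne)
      set J := ‖∫ x in (0:ℝ)..1, F.indicator (fun x => osc lam (fun x => G 0 0 x y - G 0 0 x y') x * 
        (A x y * (starRingEnd ℂ) (A x y'))) x‖
      have hJ : 0 ≤ J := norm_nonneg _
      set P := |lam| * |y-y'| with hP
      have hP0 : 0 < P := by positivity
      have b1' : J ≤ C * P^(-(1/((a:ℝ)+1))) := b1.trans (by gcongr; linarith)
      have b2' : J ≤ C * (P * μ)⁻¹ := b2.trans (by gcongr; linarith)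
      have : J * J ≤ (C * P^(-(1/((a:ℝ)+1)))) * (C * (P * μ)⁻¹) := by gcongr
      have e : (C * P^(-(1/((a:ℝ)+1)))) * (C * (P * μ)⁻¹) = (C * (P^(-s) * μ^(-(1/2:ℝ))))^2 := by
        have e1 : (P^(-s))^2 = P^(-(1/((a:ℝ)+1))) * P⁻¹ := by
          rw [← Real.rpow_natCast, ← Real.rpow_mul hP0.le, ← Real.rpow_neg_one P, ← Real.rpow_add hP0]
          congr 1; rw [hs]; push_cast; field_simp; ring
        have e2 : (μ^(-(1/2:ℝ)))^2 = μ⁻¹ := by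
          rw [← Real.rpow_natCast, ← Real.rpow_mul hμ.le, ← Real.rpow_neg_one μ]
          congr 1; norm_num
        rw [mul_pow, mul_pow, e1, e2, mul_inv]; ring
      rw [e, ← sq] at this
      have h3 := le_of_pow_le_pow_left₀ two_ne_zero (by positivity) this
      refine h3.trans (le_of_eq ?_)
      rw [hP, Real.mul_rpow (abs_nonneg _) (abs_nonneg _)]; ring)
  convert this using 1
  rw [show 2 * (C * (|lam|^(-s) * μ^(-(1/2:ℝ))) * (2/(1-s) * r^(1-s))) = (2 * (C * (2/(1-s)))) * (|lam|^(-s) * μ^(-(1/2:ℝ)) * r^(1-s)) by ring,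
    sq3 (by positivity) (by positivity) (by positivity) (by positivity)]
  have e1 : -(((a:ℝ)+2)/(4*((a:ℝ)+1))) = -s/2 := by rw [hs]; field_simp; norm_num
  have e2 : (a:ℝ)/(4*((a:ℝ)+1)) = (1-s)/2 := by rw [hs]; field_simp; ring
  rw [e1, e2]
  norm_num

structure HypA (G : ℕ → ℕ → ℝ → ℝ → ℝ) (a b : ℕ) (B c : ℝ) : Prop where
  fam : Fam G
  ub : ∀ α β, 1 ≤ α → α ≤ a+1 → 1 ≤ β → β ≤ 2*b+1 → ∀ x ∈ Set.Icc (0:ℝ) 1, ∀ y ∈ Set.Icc (0:ℝ) 1, |G α β x y| ≤ B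
  la : ∀ x ∈ Set.Icc (0:ℝ) 1, ∀ y ∈ Set.Icc (0:ℝ) 1, c ≤ |G (a+1) 1 x y|
  lb : ∀ x ∈ Set.Icc (0:ℝ) 1, ∀ y ∈ Set.Icc (0:ℝ) 1, c ≤ |G 1 (b+1) x y|

lemma BR_nonneg {h : ℝ → ℝ} (hh : Continuous h) {Z : Finset ℝ} (hZ : ∀ x ∈ Set.Icc (0:ℝ) 1, h x = 0 → x ∈ Z) :
    BR Z {x | 0 ≤ h x} := by
  intro x x' h0 hx h1 hz
  have nz : ∀ t ∈ Set.Icc x x', h t ≠ 0 := by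
    intro t ht h0t
    exact hz t (hZ t ⟨h0.trans ht.1, ht.2.trans h1⟩ h0t) ht
  have hxm := Set.left_mem_Icc.2 hx
  have hxm' := Set.right_mem_Icc.2 hx
  rcases sign_const hh (p := x) (q := x') (fun t ht => nz t (Set.Ioo_subset_Icc_self ht)) with H | H
  · exact ⟨fun _ => H _ hxm', fun _ => H _ hxm⟩
  · exact ⟨fun h => absurd (le_antisymm (H _ hxm) h) (nz _ hxm), fun h => absurd (le_antisymm (H _ hxm') h) (nz _ hxm')⟩

lemma prod_sign (u v k : ℝ) (hk : 0 ≤ k) : k * |v| ≤ |u| ↔ 0 ≤ (u - k*v)*(u+k*v) := by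
  rw [← abs_of_nonneg hk, ← abs_mul, ← sq_le_sq]
  rw [abs_of_nonneg hk]
  constructor <;> intro h <;> nlinarith

/-- good set at scale r -/
def Gd (G : ℕ → ℕ → ℝ → ℝ → ℝ) (b : ℕ) (r s : ℝ) : Set ℝ :=
  {x | ∀ β ∈ Finset.Icc 1 b, (2*((b:ℝ)+1)*r^β)*|G 1 (β+1) x s| ≤ |G 1 1 x s|}

lemma Fam.cx {G} (h : Fam G) (α β : ℕ) (y : ℝ) : Continuous (fun x => G α β x y) :=
  (h.c α β).comp (by fun_prop : Continuous fun t : ℝ => (t, y))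

lemma Fam.cy {G} (h : Fam G) (α β : ℕ) (x : ℝ) : Continuous (fun y => G α β x y) :=
  (h.c α β).comp (by fun_prop : Continuous fun t : ℝ => (x, t))

lemma Gd_meas {G} (h : Fam G) (b : ℕ) (r s : ℝ) : MeasurableSet (Gd G b r s) := by
  have : Gd G b r s = ⋂ β ∈ Finset.Icc 1 b, {x | (2*((b:ℝ)+1)*r^β)*|G 1 (β+1) x s| ≤ |G 1 1 x s|} := by
    ext x; simp [Gd]
  rw [this]
  refine Finset.measurableSet_biInter _ fun β _ => ?_
  exact measurableSet_le (((h.cx 1 (β+1) s).abs.const_smul (2*((b:ℝ)+1)*r^β)).measurable) ((h.cx 1 1 s).abs.measurable)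

lemma pow_le_self' {r : ℝ} (h0 : 0 ≤ r) (h1 : r ≤ 1) {β : ℕ} (hβ : 1 ≤ β) : r^β ≤ r :=
  pow_le_of_le_one h0 h1 (by omega)

lemma nz_comb {u v k B c : ℝ} (hk : 0 ≤ k) (hc : 0 < c) (hu : c ≤ |u|) (hv : |v| ≤ B) (hkB : k * B ≤ c/2) (s : ℝ) (hs : |s| = 1) :
    u + s*k*v ≠ 0 := by
  intro h
  have : u = -(s*k*v) := by linarith
  rw [this, abs_neg, abs_mul, abs_mul, hs, abs_of_nonneg hk] at hu
  have := mul_le_mul_of_nonneg_left hv hk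
  linarith

lemma pos_of_mulB {b : ℕ} {r B c : ℝ} {β : ℕ} (hβ : 1 ≤ β) (hr : 0 < r) (hr1 : r ≤ 1) (hB : 0 ≤ B) (h : 2*((b:ℝ)+1)*r*B ≤ c/2) : 
    2*((b:ℝ)+1)*r^β*B ≤ c/2 := by
  refine le_trans ?_ h
  gcongr
  exact pow_le_self' hr.le hr1 hβ

open Classical in
lemma Gd_BR {G a b B c} (H : HypA G a b B c) (hc : 0 < c) (hB : 0 ≤ B) {r s : ℝ} (hr : 0 < r) (hr1 : r ≤ 1)
    (hrB : 2*((b:ℝ)+1)*r*B ≤ c/2) (hs : s ∈ Set.Icc (0:ℝ) 1) : ∃ Z : Finset ℝ, Z.card ≤ b * (2*a) ∧ BR Z (Gd G b r s) := by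
  have key : ∀ β : ℕ, ∃ Z : Finset ℝ, β ∈ Finset.Icc 1 b → Z.card ≤ 2*a ∧ 
      BR Z {x | (2*((b:ℝ)+1)*r^β)*|G 1 (β+1) x s| ≤ |G 1 1 x s|} := by
    intro β
    by_cases hβ : β ∈ Finset.Icc 1 b
    swap
    · exact ⟨∅, fun h => absurd h hβ⟩
    have hβ' := Finset.mem_Icc.1 hβ
    set k := 2*((b:ℝ)+1)*r^β with hk
    have hk0 : 0 ≤ k := by positivity
    have hkB : k * B ≤ c/2 := pos_of_mulB hβ'.1 hr hr1 hB hrB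
    have z : ∀ t : ℝ, |t| = 1 → ∃ Z : Finset ℝ, Z.card ≤ a ∧ ∀ x ∈ Set.Icc (0:ℝ) 1, G 1 1 x s + t*k*G 1 (β+1) x s = 0 → x ∈ Z := by
      intro t ht
      have := zeros_fin a (fun j x => G (j+1) 1 x s + t*k*G (j+1) (β+1) x s) (by
        intro j x
        exact ((H.fam.chx 1 1 s) j x).add (((H.fam.chx 1 (β+1) s) j x).const_mul _)) 0 1 (by
        intro x hx
        exact nz_comb hk0 hc (H.la x hx s hs) (H.ub (a+1) (β+1) (by omega) (by omega) (by omega) (by omega) x hx s hs) hkB t ht)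
      simpa using this
    obtain ⟨Z1, hZ1, hz1⟩ := z 1 (by simp)
    obtain ⟨Z2, hZ2, hz2⟩ := z (-1) (by simp)
    refine ⟨Z1 ∪ Z2, fun _ => ⟨(Finset.card_union_le _ _).trans (by omega), ?_⟩⟩
    have e : {x | k*|G 1 (β+1) x s| ≤ |G 1 1 x s|} = {x | 0 ≤ (G 1 1 x s - k * G 1 (β+1) x s) * (G 1 1 x s + k * G 1 (β+1) x s)} := by
      ext x; exact prod_sign _ _ _ hk0
    rw [e]
    refine BR_nonneg ?_ ?_
    · have := H.fam.cx 1 1 s; have := H.fam.cx 1 (β+1) s; fun_prop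
    · intro x hx h0
      rcases mul_eq_zero.1 h0 with h | h
      · exact Finset.mem_union_right _ (hz2 x hx (by linarith))
      · exact Finset.mem_union_left _ (hz1 x hx (by linarith))
  choose Z hZ using key
  refine ⟨(Finset.Icc 1 b).biUnion Z, ?_, ?_⟩
  · refine (Finset.card_biUnion_le_card_mul _ _ (2*a) fun β hβ => (hZ β hβ).1).trans ?_
    simp
  · intro x x' h0 hx h1 hz
    refine forall₂_congr fun β hβ => ?_
    exact (hZ β hβ).2 x x' h0 hx h1 fun z hzz => hz z (Finset.mem_biUnion.2 ⟨β, hβ, hzz⟩)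

lemma Gd_lb {G a b B c} (H : HypA G a b B c) (hb : 1 ≤ b) (hc : 0 < c) (hB : 0 ≤ B) {r s : ℝ} (hr : 0 < r) 
    (hrB : 2*((b:ℝ)+1)*r*B ≤ c/2) (hs : 0 ≤ s) (hs1 : s + r ≤ 1) {x : ℝ} (hx : x ∈ Set.Icc (0:ℝ) 1)
    (hG : x ∈ Gd G b r s) : ∀ y ∈ Set.Icc s (s+r), c * r^b ≤ |G 1 1 x y| := by
  set K : ℝ := 2*((b:ℝ)+1) with hK
  have hK0 : 0 < K := by positivity
  set V := |G 1 1 x s| with hV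
  have hsub : ∀ y ∈ Set.Icc s (s+r), y ∈ Set.Icc (0:ℝ) 1 := fun y hy => ⟨hs.trans hy.1, hy.2.trans hs1⟩
  have hsm : s ∈ Set.Icc s (s+r) := ⟨le_rfl, by linarith⟩
  have hbase : ∀ β, 1 ≤ β → β ≤ b → r^β * |G 1 (β+1) x s| ≤ V/K := by
    intro β h1 h2
    have := hG β (Finset.mem_Icc.2 ⟨h1, h2⟩)
    rw [le_div_iff₀ hK0]; linarith
  have hVl : r^b * c ≤ V/K := le_trans (by gcongr; exact H.lb x hx s (hsub s hsm)) (hbase b hb le_rfl)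
  have step : ∀ β y, y ∈ Set.Icc s (s+r) → ∃ z ∈ Set.Icc s (s+r), |G 1 (β+1) x y - G 1 (β+1) x s| ≤ r * |G 1 (β+1+1) x z| := by
    intro β y hy
    obtain ⟨z, hz, e⟩ := (H.fam.chy 1 1 x).mvt β hy.1
    refine ⟨z, ⟨hz.1, hz.2.trans hy.2⟩, ?_⟩
    have e : G 1 (β+1) x y - G 1 (β+1) x s = G 1 (β+1+1) x z * (y - s) := e
    rw [e, abs_mul, abs_of_nonneg (sub_nonneg.2 hy.1), mul_comm]
    gcongr; linarith [hy.2]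
  have ind : ∀ k β : ℕ, 1 ≤ β → β + k = b → ∀ y ∈ Set.Icc s (s+r), r^β * |G 1 (β+1) x y| ≤ (k+2) * (V/K) := by
    intro k
    induction k with
    | zero =>
      intro β h1 hβ y hy
      obtain ⟨z, hz, hd⟩ := step β y hy
      have hz2 := H.ub 1 (β+1+1) le_rfl (by omega) (by omega) (by omega) x hx z (hsub z hz)
      have t := hbase β h1 (by omega)
      have h3 : |G 1 (β+1) x y| ≤ |G 1 (β+1) x s| + r * B := by
        have := abs_sub_abs_le_abs_sub (G 1 (β+1) x y) (G 1 (β+1) x s)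
        have := mul_le_mul_of_nonneg_left hz2 hr.le
        linarith
      have h4 : r * B ≤ c := by
        have : K ≥ 1 := by rw [hK]; have : (0:ℝ) ≤ b := by positivity
                           linarith
        have : r * B ≤ K * r * B := by rw [mul_assoc]; exact le_mul_of_one_le_left (by positivity) this
        linarith
      have : β = b := by omega
      subst this
      calc r^β * |G 1 (β+1) x y| ≤ r^β * (|G 1 (β+1) x s| + c) := by gcongr; linarith
        _ ≤ _ := by push_cast; linarith
    | succ k ih =>
      intro β h1 hβ y hy
      obtain ⟨z, hz, hd⟩ := step β y hy
      have t := hbase β h1 (by omega)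
      have h2 := ih (β+1) (by omega) (by omega) z hz
      have h3 : |G 1 (β+1) x y| ≤ |G 1 (β+1) x s| + r * |G 1 (β+1+1) x z| := by
        have := abs_sub_abs_le_abs_sub (G 1 (β+1) x y) (G 1 (β+1) x s)
        linarith
      calc r^β * |G 1 (β+1) x y| ≤ r^β * (|G 1 (β+1) x s| + r * |G 1 (β+1+1) x z|) := by gcongr
        _ = r^β * |G 1 (β+1) x s| + r^(β+1) * |G 1 (β+1+1) x z| := by ring
        _ ≤ _ := by push_cast; linarith
  intro y hy
  obtain ⟨z, hz, hd⟩ := step 0 y hy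
  have h2 := ind (b-1) 1 le_rfl (by omega) z hz
  rw [pow_one] at h2
  have h3 : ((b-1 : ℕ) : ℝ) + 2 = b + 1 := by rw [Nat.cast_sub hb]; push_cast; ring
  rw [h3] at h2
  have h4 : ((b:ℝ)+1) * (V/K) = V/2 := by rw [hK]; field_simp
  have h5 : V - |G 1 1 x y| ≤ |G 1 (0+1) x y - G 1 (0+1) x s| := by
    rw [abs_sub_comm]; exact abs_sub_abs_le_abs_sub _ _
  have h6 : ((b:ℝ)+1)*(r^b * c) ≤ V/2 := by rw [← h4]; gcongr
  have h7 : r^b*c ≤ ((b:ℝ)+1)*(r^b * c) := le_mul_of_one_le_left (by positivity) (by linarith [(Nat.cast_nonneg b : (0:ℝ) ≤ b)])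
  simp only [zero_add] at *
  linarith

lemma bad_count (a b : ℕ) (B c : ℝ) (hc : 0 < c) (hB : 0 ≤ B) : ∃ N : ℕ, ∀ G, HypA G a b B c →
    ∀ r : ℝ, 0 < r → r ≤ 1 → 2*((b:ℝ)+1)*r*B ≤ c/2 → ∀ x ∈ Set.Icc (0:ℝ) 1, 
    ∀ t : Finset ℕ, (∀ n ∈ t, (n:ℝ)*r ≤ 1 ∧ x ∉ Gd G b r (n*r)) → t.card ≤ N := by
  classical
  obtain ⟨c0, hc0, HSL⟩ := SL b
  obtain ⟨C1, hC1, HM⟩ := markov b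
  set C2 := C1 * (1 + B/(c0*c)) with hC2
  have hC20 : 0 ≤ C2 := by positivity
  set K : ℝ := 2*((b:ℝ)+1) with hK
  have hK0 : 0 < K := by positivity
  obtain ⟨M, hM⟩ := exists_nat_ge (K * C2)
  refine ⟨b * ((M+1) * (2*b+1)), ?_⟩
  intro G H r hr hr1 hrB x hx t ht
  have hcov : t ⊆ (Finset.Icc 1 b).biUnion (fun β => t.filter (fun n : ℕ => |G 1 1 x (n*r)| < (K*r^β)*|G 1 (β+1) x (n*r)|)) := by
    intro n hn
    have := (ht n hn).2
    simp only [Gd, Set.mem_ofPred_eq, not_forall, not_le] at this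
    obtain ⟨β, hβ, h⟩ := this
    exact Finset.mem_biUnion.2 ⟨β, hβ, Finset.mem_filter.2 ⟨hn, h⟩⟩
  refine (Finset.card_le_card hcov).trans ?_
  refine (Finset.card_biUnion_le_card_mul _ _ ((M+1)*(2*b+1)) ?_).trans (by simp)
  intro β hβ
  have hβ' := Finset.mem_Icc.1 hβ
  set k := K*r^β with hk
  have hk0 : 0 ≤ k := by positivity
  have hkB : k * B ≤ c/2 := pos_of_mulB hβ'.1 hr hr1 hB hrB
  set tb := t.filter (fun n : ℕ => |G 1 1 x (n*r)| < k*|G 1 (β+1) x (n*r)|) with htb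
  have z : ∀ s : ℝ, |s| = 1 → ∃ Z : Finset ℝ, Z.card ≤ b ∧ ∀ y ∈ Set.Icc (0:ℝ) 1, G 1 1 x y + s*k*G 1 (β+1) x y = 0 → y ∈ Z := by
    intro s hs
    have := zeros_fin b (fun j y => G 1 (j+1) x y + s*k*G 1 (j+(β+1)) x y) (by
      intro j y
      exact ((H.fam.chy 1 1 x) j y).add (((H.fam.chy 1 (β+1) x) j y).const_mul _)) 0 1 (by
      intro y hy
      exact nz_comb hk0 hc (H.lb x hx y hy) (H.ub 1 (b+(β+1)) (by omega) (by omega) (by omega) (by omega) x hx y hy) hkB s hs)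
    simpa using this
  obtain ⟨Z1, hZ1, hz1⟩ := z 1 (by simp)
  obtain ⟨Z2, hZ2, hz2⟩ := z (-1) (by simp)
  set Z := Z1 ∪ Z2 with hZ
  have hZc : Z.card ≤ 2*b := (Finset.card_union_le _ _).trans (by omega)
  set h : ℝ → ℝ := fun y => (G 1 1 x y - k * G 1 (β+1) x y) * (G 1 1 x y + k * G 1 (β+1) x y) with hh
  have hcont : Continuous h := by
    have := H.fam.cy 1 1 x; have := H.fam.cy 1 (β+1) x; fun_prop
  have hzero : ∀ y ∈ Set.Icc (0:ℝ) 1, h y = 0 → y ∈ Z := by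
    intro y hy h0
    rcases mul_eq_zero.1 h0 with h | h
    · exact Finset.mem_union_right _ (hz2 y hy (by linarith))
    · exact Finset.mem_union_left _ (hz1 y hy (by linarith))
  have hI : ∀ n ∈ tb, (n:ℝ)*r ∈ Set.Icc (0:ℝ) 1 := fun n hn => ⟨by positivity, (ht n (Finset.mem_filter.1 hn).1).1⟩
  have pair : ∀ n ∈ tb, ∀ n' ∈ tb, n < n' → (Z.filter (fun z => z ≤ n*r)).card = (Z.filter (fun z => z ≤ n'*r)).card →
      n' ≤ n + M := by
    intro n hn n' hn' hlt hcard
    have hle : (n:ℝ)*r < n'*r := by gcongr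
    have hfe : Z.filter (fun z => z ≤ n*r) = Z.filter (fun z => z ≤ n'*r) := by
      apply Finset.eq_of_subset_of_card_le
      · intro z hz
        rw [Finset.mem_filter] at hz ⊢
        exact ⟨hz.1, hz.2.trans hle.le⟩
      · exact hcard.ge
    have hsub : ∀ y ∈ Set.Icc ((n:ℝ)*r) (n'*r), y ∈ Set.Icc (0:ℝ) 1 := fun y hy => 
      ⟨(hI n hn).1.trans hy.1, hy.2.trans (hI n' hn').2⟩
    have hneg : ∀ y ∈ Set.Icc ((n:ℝ)*r) (n'*r), h y ≤ 0 := by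
      have hn0 : h (n*r) < 0 := by
        have := (Finset.mem_filter.1 hn).2
        rw [← not_le, prod_sign _ _ _ hk0] at this
        exact not_le.1 this
      rcases sign_const hcont (p := n*r) (q := n'*r) (by
        intro y hy h0
        have h1 := hzero y (hsub y (Set.Ioo_subset_Icc_self hy)) h0
        have h2 : y ∈ Z.filter (fun z => z ≤ n'*r) := Finset.mem_filter.2 ⟨h1, hy.2.le⟩
        rw [← hfe] at h2
        exact absurd (Finset.mem_filter.1 h2).2 (not_le.2 hy.1)) with h1 | h1
      · exact absurd (h1 (n*r) ⟨le_rfl, hle.le⟩) (not_le.2 hn0)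
      · exact h1
    have hcmp : ∀ y ∈ Set.Icc ((n:ℝ)*r) (n'*r), |G 1 1 x y| ≤ k * |G 1 (β+1) x y| := by
      intro y hy
      by_contra hcon
      have h1 := (prod_sign (G 1 1 x y) (G 1 (β+1) x y) k hk0).1 (not_le.1 hcon).le
      have h2 : h y = 0 := le_antisymm (hneg y hy) h1
      have h3 := not_le.1 hcon
      rcases mul_eq_zero.1 h2 with h | h
      · rw [show G 1 1 x y = k * G 1 (β+1) x y by linarith, abs_mul, abs_of_nonneg hk0] at h3
        exact lt_irrefl _ h3
      · rw [show G 1 1 x y = - (k * G 1 (β+1) x y) by linarith, abs_neg, abs_mul, abs_of_nonneg hk0] at h3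
        exact lt_irrefl _ h3
    set ℓ := (n':ℝ)*r - n*r with hℓ
    have hℓ0 : 0 < ℓ := sub_pos.2 hle
    obtain ⟨y0, hy0, hmax⟩ := isCompact_Icc.exists_isMaxOn (s := Set.Icc ((n:ℝ)*r) (n'*r)) ⟨n*r, le_rfl, hle.le⟩
      (f := fun y => |G 1 1 x y|) (H.fam.cy 1 1 x).abs.continuousOn
    set A := |G 1 1 x y0| with hA
    obtain ⟨y1, hy1, hs⟩ := HSL _ (H.fam.chy 1 1 x) (n*r) (n'*r) c hle.le hc.le (fun y hy => H.lb x hx y (hsub y hy))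
    have hAl : c0*c*ℓ^b ≤ A := hs.trans (by simpa using hmax hy1)
    have hA0 : 0 < A := lt_of_lt_of_le (by positivity) hAl
    have hm := HM _ (H.fam.chy 1 1 x) (n*r) (n'*r) A B hle hA0.le hB (fun y hy => by simpa using hmax hy) 
      (fun y hy => H.ub 1 (b+1) le_rfl (by omega) (by omega) (by omega) x hx y (hsub y hy)) β hβ'.2 y0 hy0
    have hm2 : |G 1 (β+1) x y0| * ℓ^β ≤ C2 * A := by
      refine hm.trans ?_
      rw [hC2, mul_assoc]
      gcongr
      have : ℓ^b ≤ A/(c0*c) := by rw [le_div_iff₀ (by positivity)]; linarith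
      calc A + B*ℓ^b ≤ A + B*(A/(c0*c)) := by gcongr
        _ = _ := by ring
    have hm3 : ℓ^β ≤ k * C2 := by
      have h1 := hcmp y0 hy0
      have : A * ℓ^β ≤ A * (k * C2) := by
        calc A * ℓ^β ≤ (k * |G 1 (β+1) x y0|) * ℓ^β := by gcongr
          _ = k * (|G 1 (β+1) x y0| * ℓ^β) := by ring
          _ ≤ k * (C2 * A) := by gcongr
          _ = _ := by ring
      exact le_of_mul_le_mul_left this hA0
    have hd : ((n':ℝ) - n)^β ≤ K * C2 := by
      have : ((n':ℝ) - n)^β * r^β ≤ (K * C2) * r^β := by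
        rw [← mul_pow, show ((n':ℝ)-n)*r = ℓ by rw [hℓ]; ring]
        rw [hk] at hm3; linarith
      exact le_of_mul_le_mul_right this (by positivity)
    have h1 : (1:ℝ) ≤ (n':ℝ) - n := by
      have : (n:ℝ) + 1 ≤ n' := by exact_mod_cast hlt
      linarith
    have h2 : (n':ℝ) - n ≤ M := by
      calc (n':ℝ) - n = ((n':ℝ) - n)^1 := (pow_one _).symm
        _ ≤ ((n':ℝ) - n)^β := pow_le_pow_right₀ h1 hβ'.1
        _ ≤ _ := hd.trans hM
    have : (n':ℝ) ≤ ((n + M : ℕ) : ℝ) := by push_cast; linarith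
    exact_mod_cast this
  have := Finset.card_le_mul_card_image_of_maps_to (s := tb) (t := Finset.range (2*b+1))
    (f := fun n : ℕ => (Z.filter (fun z => z ≤ n*r)).card) (fun n _ => by
      rw [Finset.mem_range]
      exact Nat.lt_succ_of_le ((Finset.card_filter_le _ _).trans hZc)) (M+1) (by
      intro v hv
      set fb := tb.filter (fun n : ℕ => (Z.filter (fun z => z ≤ n*r)).card = v) with hfb
      rcases fb.eq_empty_or_nonempty with he | hne
      · rw [he]; simp
      set n0 := fb.min' hne with hn0
      have hn0m := fb.min'_mem hne
      have : fb ⊆ Finset.Icc n0 (n0+M) := by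
        intro n hn
        have h1 : n0 ≤ n := Finset.min'_le _ _ hn
        rw [Finset.mem_Icc]
        refine ⟨h1, ?_⟩
        rcases h1.eq_or_lt with h2 | h2
        · omega
        · exact pair n0 (Finset.mem_filter.1 hn0m).1 n (Finset.mem_filter.1 hn).1 h2 
            ((Finset.mem_filter.1 hn0m).2.trans (Finset.mem_filter.1 hn).2.symm)
      exact (Finset.card_le_card this).trans (by rw [Nat.card_Icc]; omega))
  simpa using this

def cs (F : ℕ → Set ℝ) (j : ℕ) : Set (ℝ × ℝ) := {z | z.2 ∈ Set.Ico (0:ℝ) 1 ∧ z.1 ∈ F ⌊2^j * z.2⌋₊}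

lemma cell_mem (j n : ℕ) {y : ℝ} (hy : 0 ≤ y) : y ∈ Set.Ico ((n:ℝ)*(1/2)^j) (n*(1/2)^j+(1/2)^j) ↔ ⌊2^j * y⌋₊ = n := by
  rw [Nat.floor_eq_iff (by positivity)]
  have h2 : (0:ℝ) < 2^j := by positivity
  rw [one_div, inv_pow, Set.mem_Ico, ← div_eq_mul_inv, div_le_iff₀ h2]
  have : (n:ℝ)/2^j + (2^j)⁻¹ = (n+1)/2^j := by rw [add_div, one_div]
  rw [this, lt_div_iff₀ h2, mul_comm y]

lemma cell_lt (j : ℕ) {y : ℝ} (hy : 0 ≤ y) (hy1 : y < 1) : ⌊2^j * y⌋₊ < 2^j := by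
  rw [Nat.floor_lt (by positivity)]
  push_cast
  have h2 : (0:ℝ) < 2^j := by positivity
  nlinarith

lemma cell_end (j n : ℕ) (hn : n < 2^j) : (n:ℝ)*(1/2)^j+(1/2)^j ≤ 1 := by
  have : (n:ℝ)+1 ≤ 2^j := by exact_mod_cast hn
  have h2 : (0:ℝ) < 2^j := by positivity
  calc (n:ℝ)*(1/2)^j+(1/2)^j = (n+1)/2^j := by rw [one_div, inv_pow]; field_simp
    _ ≤ 1 := by rw [div_le_one h2]; exact this

lemma cell_half (j : ℕ) (y : ℝ) : ⌊2^j * y⌋₊ = ⌊2^(j+1) * y⌋₊ / 2 := by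
  rw [← Nat.floor_div_natCast]
  congr 1
  push_cast; rw [pow_succ]; field_simp

lemma cs_meas (F : ℕ → Set ℝ) (hF : ∀ n, MeasurableSet (F n)) (j : ℕ) : MeasurableSet (cs F j) := by
  have : cs F j = ⋃ n : ℕ, F n ×ˢ (Set.Ico (0:ℝ) 1 ∩ {y | ⌊2^j * y⌋₊ = n}) := by
    ext z; simp only [cs, Set.mem_ofPred_eq, Set.mem_iUnion, Set.mem_prod, Set.mem_inter_iff]
    constructor
    · rintro ⟨h1, h2⟩; exact ⟨_, h2, h1, rfl⟩
    · rintro ⟨n, h1, h2, rfl⟩; exact ⟨h2, h1⟩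
  rw [this]
  refine MeasurableSet.iUnion fun n => (hF n).prod (measurableSet_Ico.inter ?_)
  have : Measurable (fun y : ℝ => ⌊2^j * y⌋₊) := Nat.measurable_floor.comp (by fun_prop)
  exact this (measurableSet_singleton n)

lemma lev {lam : ℝ} {G} (hG : Fam G) {A A1 : ℝ → ℝ → ℂ} {A0 : ℝ} (hA : Amp A A1 A0) (j : ℕ) (F : ℕ → Set ℝ)
    (hF : ∀ n, MeasurableSet (F n)) (hF1 : ∀ n, F n ⊆ Set.Icc 0 1) {D : ℝ}
    (h : ∀ n < 2^j, Bd (bx lam (G 0 0) A (F n ×ˢ Set.Ico ((n:ℝ)*(1/2)^j) (n*(1/2)^j+(1/2)^j))) D) (N : ℕ)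
    (hN : ∀ x ∈ Set.Icc (0:ℝ) 1, ∀ t : Finset ℕ, (∀ n ∈ t, n < 2^j ∧ x ∈ F n) → t.card ≤ N) :
    Bd (bx lam (G 0 0) A (cs F j)) (Real.sqrt N * D) := by
  have hk : ∀ n ∈ Finset.range (2^j), Ker (bx lam (G 0 0) A (F n ×ˢ Set.Ico ((n:ℝ)*(1/2)^j) (n*(1/2)^j+(1/2)^j))) := by
    intro n hn
    refine bx_ker01 hG hA ((hF n).prod measurableSet_Ico) (Set.prod_mono (hF1 n) ?_)
    exact Set.Ico_subset_Icc_self.trans (Set.Icc_subset_Icc (by positivity) (cell_end j n (Finset.mem_range.1 hn)))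
  have := Bd_orth (Finset.range (2^j)) hk (fun n hn => h n (Finset.mem_range.1 hn)) F 
    (fun n => Set.Ico ((n:ℝ)*(1/2)^j) (n*(1/2)^j+(1/2)^j)) (fun _ _ => measurableSet_Ico) (by
      intro n _ n' _ hne
      rw [Set.disjoint_left]
      intro y hy hy'
      have h0 : 0 ≤ y := le_trans (by positivity) hy.1
      exact hne (((cell_mem j n h0).1 hy).symm.trans ((cell_mem j n' h0).1 hy'))) (by
      intro n _ x y hxy
      apply Set.indicator_of_notMem
      rintro ⟨h1, h2⟩
      rcases hxy with h | h
      · exact h h1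
      · exact h h2) N (by
      intro x t ht hx
      rcases t.eq_empty_or_nonempty with rfl | ⟨n, hn⟩
      · simp
      · exact hN x (hF1 n (hx n hn)) t fun n hn => ⟨Finset.mem_range.1 (ht hn), hx n hn⟩)
  convert this using 1
  funext x y
  by_cases hy : y ∈ Set.Ico (0:ℝ) 1
  · rw [Finset.sum_eq_single ⌊2^j * y⌋₊]
    · unfold bx
      have hm := (cell_mem j ⌊2^j * y⌋₊ hy.1).2 rfl
      by_cases hx : x ∈ F ⌊2^j * y⌋₊
      · rw [Set.indicator_of_mem (show (x,y) ∈ cs F j from ⟨hy, hx⟩), Set.indicator_of_mem (Set.mk_mem_prod hx hm)]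
      · rw [Set.indicator_of_notMem (fun h : (x,y) ∈ cs F j => hx h.2), Set.indicator_of_notMem (fun h => hx h.1)]
    · intro n _ hne
      apply Set.indicator_of_notMem
      rintro ⟨_, h2⟩
      exact hne ((cell_mem j n hy.1).1 h2).symm
    · intro h
      exact absurd (Finset.mem_range.2 (cell_lt j hy.1 hy.2)) h
  · rw [Finset.sum_eq_zero]
    · exact Set.indicator_of_notMem (fun h : (x,y) ∈ cs F j => hy h.1) _
    · intro n hn
      apply Set.indicator_of_notMem
      rintro ⟨_, h2⟩
      exact hy ⟨le_trans (by positivity) h2.1, h2.2.trans_le (cell_end j n (Finset.mem_range.1 hn))⟩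

lemma BR_Ico : BR {1} (Set.Ico 0 1) := by
  intro x x' h0 hx h1 hz
  have : x' < 1 := by
    rcases h1.eq_or_lt with h | h
    · exact absurd ⟨hx.trans h1, h.ge⟩ (hz 1 (by simp))
    · exact h
  exact ⟨fun _ => ⟨h0.trans hx, this⟩, fun _ => ⟨h0, hx.trans_lt this⟩⟩

lemma glev (a b : ℕ) (ha : 1 ≤ a) (A0 c : ℝ) (hc : 0 < c) (N0 N : ℕ) : ∃ C ≥ (0:ℝ), ∀ G, Fam G → ∀ A A1, Amp A A1 A0 →
    ∀ lam : ℝ, lam ≠ 0 → (∀ x ∈ Set.Icc (0:ℝ) 1, ∀ y ∈ Set.Icc (0:ℝ) 1, c ≤ |G (a+1) 1 x y|) → ∀ j : ℕ,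
    ∀ F : ℕ → Set ℝ, (∀ n, MeasurableSet (F n)) → (∀ n, F n ⊆ Set.Icc 0 1) → 
    (∀ n < 2^j, ∃ Z : Finset ℝ, Z.card ≤ N0 ∧ BR Z (F n)) →
    (∀ n < 2^j, ∀ x ∈ F n, ∀ t ∈ Set.Icc ((n:ℝ)*(1/2)^j) (n*(1/2)^j+(1/2)^j), c * ((1/2)^j)^b ≤ |G 1 1 x t|) →
    (∀ x ∈ Set.Icc (0:ℝ) 1, ∀ t : Finset ℕ, (∀ n ∈ t, n < 2^j ∧ x ∈ F n) → t.card ≤ N) → 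
    Bd (bx lam (G 0 0) A (cs F j)) (C * |lam|^(-((a+2)/(4*((a:ℝ)+1)))) * ((2:ℝ)^(((a:ℝ)*b+b-a)/(4*((a:ℝ)+1))))^j) := by
  obtain ⟨C, hC, H⟩ := piece_good a ha A0 c hc N0
  refine ⟨Real.sqrt N * (C * c^(-(1/4:ℝ))), by positivity, ?_⟩
  intro G hG A A1 hA lam hl hlow j F hF hF1 hBR hΨ hN
  have := lev (lam := lam) hG hA j F hF hF1 (D := C * (|lam|^(-((a+2)/(4*((a:ℝ)+1)))) * (c * ((1/2)^j)^b)^(-(1/4:ℝ)) * ((1/2:ℝ)^j)^((a:ℝ)/(4*((a:ℝ)+1))))) (by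
    intro n hn
    obtain ⟨Z, hZ, hZ2⟩ := hBR n hn
    exact H G hG A A1 hA lam hl hlow (F n) (hF n) (hF1 n) Z hZ hZ2 _ _ _ (by positivity) (by positivity) 
      (cell_end j n hn) (by positivity) (hΨ n hn)) N hN
  convert this using 1
  rw [Real.mul_rpow hc.le (by positivity)]
  have e : (((1/2:ℝ)^j)^b)^(-(1/4:ℝ)) * ((1/2:ℝ)^j)^((a:ℝ)/(4*((a:ℝ)+1))) = ((2:ℝ)^(((a:ℝ)*b+b-a)/(4*((a:ℝ)+1))))^j := by
    have h2 : (1/2:ℝ)^j = (2:ℝ)^(-(j:ℝ)) := by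
      rw [Real.rpow_neg (by norm_num), Real.rpow_natCast, one_div, inv_pow]
    rw [h2, ← Real.rpow_natCast (_) b, ← Real.rpow_natCast (_) j, ← Real.rpow_mul (by norm_num), ← Real.rpow_mul (by norm_num), 
      ← Real.rpow_mul (by norm_num), ← Real.rpow_mul (by norm_num), ← Real.rpow_add (by norm_num)]
    congr 1; field_simp; ring
  rw [← e]; ring

lemma blev (a : ℕ) (ha : 1 ≤ a) (A0 c : ℝ) (hc : 0 < c) (N0 N : ℕ) : ∃ C ≥ (0:ℝ), ∀ G, Fam G → ∀ A A1, Amp A A1 A0 →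
    ∀ lam : ℝ, lam ≠ 0 → (∀ x ∈ Set.Icc (0:ℝ) 1, ∀ y ∈ Set.Icc (0:ℝ) 1, c ≤ |G (a+1) 1 x y|) → ∀ j : ℕ,
    ∀ F : ℕ → Set ℝ, (∀ n, MeasurableSet (F n)) → (∀ n, F n ⊆ Set.Icc 0 1) → 
    (∀ n < 2^j, ∃ Z : Finset ℝ, Z.card ≤ N0 ∧ BR Z (F n)) →
    (∀ x ∈ Set.Icc (0:ℝ) 1, ∀ t : Finset ℕ, (∀ n ∈ t, n < 2^j ∧ x ∈ F n) → t.card ≤ N) → 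
    Bd (bx lam (G 0 0) A (cs F j)) (C * (|lam|^(-(1/(2*((a:ℝ)+1)))) * ((1/2:ℝ)^j)^((a:ℝ)/(2*((a:ℝ)+1))))) := by
  obtain ⟨C, hC, H⟩ := piece_bad a ha A0 c hc N0
  refine ⟨Real.sqrt N * C, by positivity, ?_⟩
  intro G hG A A1 hA lam hl hlow j F hF hF1 hBR hN
  have := lev (lam := lam) hG hA j F hF hF1 (D := C * (|lam|^(-(1/(2*((a:ℝ)+1)))) * ((1/2:ℝ)^j)^((a:ℝ)/(2*((a:ℝ)+1))))) (by
    intro n hn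
    obtain ⟨Z, hZ, hZ2⟩ := hBR n hn
    exact H G hG A A1 hA lam hl hlow (F n) (hF n) (hF1 n) Z hZ hZ2 _ _ (by positivity) (by positivity) 
      (cell_end j n hn)) N hN
  convert this using 1
  ring

/-- level-j good index family -/
def Fg (G : ℕ → ℕ → ℝ → ℝ → ℝ) (b j n : ℕ) : Set ℝ := Set.Ico 0 1 ∩ Gd G b ((1/2)^j) (n*(1/2)^j)

lemma half_count {t : Finset ℕ} {N : ℕ} (h : (t.image (fun n => n/2)).card ≤ N) : t.card ≤ 2*N := by
  refine (Finset.card_le_mul_card_image (f := fun n => n/2) t 2 ?_).trans (by omega)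
  intro v _
  have : t.filter (fun n => n/2 = v) ⊆ {2*v, 2*v+1} := by
    intro n hn
    have := (Finset.mem_filter.1 hn).2
    simp only [Finset.mem_insert, Finset.mem_singleton]; omega
  exact (Finset.card_le_card this).trans Finset.card_le_two

lemma near_pow {ρ : ℝ} (h : 1 ≤ ρ) : ∃ n : ℕ, ρ ≤ 2^n ∧ (2:ℝ)^n ≤ 2*ρ := by
  obtain ⟨n, h1, h2⟩ := exists_nat_pow_near h (one_lt_two : (1:ℝ) < 2)
  exact ⟨n+1, h2.le, by rw [pow_succ]; linarith⟩

open Classical in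
lemma lemA1 (a b : ℕ) (ha : 1 ≤ a) (hb : 1 ≤ b) (B c A0 : ℝ) (hc : 0 < c) (hB : 0 ≤ B) : ∃ C ≥ (0:ℝ), 
    ∀ G, HypA G a b B c → ∀ A A1, Amp A A1 A0 → ∀ lam : ℝ, 1 ≤ |lam| → 
    Bd (bx lam (G 0 0) A (Set.Ico 0 1 ×ˢ Set.Ico 0 1)) (C * |lam|^(-(((a:ℝ)+b)/(2*((a:ℝ)+b+a*b))))) := by
  obtain ⟨N, hN⟩ := bad_count a b B c hc hB
  obtain ⟨j1, hj1⟩ : ∃ j1 : ℕ, 2*((b:ℝ)+1)*(1/2)^j1*B ≤ c/2 := by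
    have h0 : 0 < c/2/(2*((b:ℝ)+1)*(B+1)) := by positivity
    obtain ⟨n, hn⟩ := exists_pow_lt_of_lt_one h0 (by norm_num : (1/2:ℝ) < 1)
    refine ⟨n, ?_⟩
    rw [lt_div_iff₀ (by positivity)] at hn
    have : (1/2:ℝ)^n*(2*((b:ℝ)+1)*B) ≤ (1/2:ℝ)^n*(2*((b:ℝ)+1)*(B+1)) := by gcongr; linarith
    linarith
  have hsc : ∀ j, j1 ≤ j → 2*((b:ℝ)+1)*(1/2)^j*B ≤ c/2 := by
    intro j hj
    refine le_trans ?_ hj1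
    gcongr 2*((b:ℝ)+1)*?_*B
    exact pow_le_pow_of_le_one (by norm_num) (by norm_num) hj
  have hr1 : ∀ j, (1/2:ℝ)^j ≤ 1 := fun j => pow_le_one₀ (by norm_num) (by norm_num)
  set N0 := 1 + b*(2*a) + b*(2*a) with hN0
  obtain ⟨M1, hM1⟩ : ∃ M1 : ℕ, 2^j1 ≤ M1 := ⟨_, le_rfl⟩
  obtain ⟨Cg, hCg, Hg⟩ := glev a b ha A0 c hc N0 (M1 + 2*N + N)
  obtain ⟨Cb, hCb, Hb⟩ := blev a ha A0 c hc N0 N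
  set κ : ℝ := ((a:ℝ)*b+b-a)/(4*((a:ℝ)+1)) with hκ
  have ha' : (1:ℝ) ≤ a := by exact_mod_cast ha
  have hb' : (1:ℝ) ≤ b := by exact_mod_cast hb
  have hκ0 : 0 < κ := by
    rw [hκ]; apply div_pos
    · nlinarith
    · positivity
  set q : ℝ := (2:ℝ)^κ with hq
  have hq1 : 1 < q := Real.one_lt_rpow (by norm_num) hκ0
  set γ : ℝ := (a:ℝ)/((a:ℝ)+b+a*b) with hγ
  have hγ0 : 0 ≤ γ := by positivity
  set D : ℝ := Cg + 2 * Cg * q/(q-1) with hD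
  have hq1' : 0 < q - 1 := by linarith
  have hD0 : 0 ≤ D := by positivity
  refine ⟨D * (2^j1*2)^κ + Cb, by positivity, ?_⟩
  intro G H A A1 hA lam hlam1
  have hlam : 0 < |lam| := by linarith
  have hl : lam ≠ 0 := abs_pos.1 hlam
  have hG := H.fam
  set L := |lam|^(-((a+2)/(4*((a:ℝ)+1)))) with hL
  have hL0 : 0 ≤ L := by positivity
  -- breaks
  have hst : ∀ j n : ℕ, n < 2^j → (n:ℝ)*(1/2)^j ∈ Set.Icc (0:ℝ) 1 := by
    intro j n hn
    have := cell_end j n hn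
    have h2 : (0:ℝ) < (1/2)^j := by positivity
    exact ⟨by positivity, by linarith⟩
  have hZ : ∀ j, j1 ≤ j → ∀ n : ℕ, n < 2^j → ∃ Z : Finset ℝ, Z.card ≤ b*(2*a) ∧ BR Z (Gd G b ((1/2)^j) (n*(1/2)^j)) :=
    fun j hj n hn => Gd_BR H hc hB (by positivity) (hr1 j) (hsc j hj) (hst j n hn)
  have hlbG : ∀ j, j1 ≤ j → ∀ n : ℕ, n < 2^j → ∀ x ∈ Set.Ico (0:ℝ) 1, x ∈ Gd G b ((1/2)^j) (n*(1/2)^j) → 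
      ∀ t ∈ Set.Icc ((n:ℝ)*(1/2)^j) (n*(1/2)^j+(1/2)^j), c * ((1/2)^j)^b ≤ |G 1 1 x t| :=
    fun j hj n hn x hx hx2 => Gd_lb H hb hc hB (by positivity) (hsc j hj) (by positivity) (cell_end j n hn) 
      (Set.Ico_subset_Icc_self hx) hx2
  have hcnt : ∀ j, j1 ≤ j → ∀ x ∈ Set.Icc (0:ℝ) 1, ∀ t : Finset ℕ, (∀ n ∈ t, n < 2^j ∧ x ∉ Gd G b ((1/2)^j) (n*(1/2)^j)) → t.card ≤ N :=
    fun j hj x hx t ht => hN G H _ (by positivity) (hr1 j) (hsc j hj) x hx t fun n hn => ⟨(hst j n (ht n hn).1).2, (ht n hn).2⟩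
  have hpar : ∀ j n : ℕ, n < 2^(j+1) → n/2 < 2^j := by intro j n hn; rw [pow_succ] at hn; omega
  have mG : ∀ j n : ℕ, MeasurableSet (Gd G b ((1/2)^j) (n*(1/2)^j)) := fun j n => Gd_meas hG _ _ _
  -- induction over levels
  have main : ∀ k : ℕ, Bd (bx lam (G 0 0) A (cs (Fg G b (j1+k)) (j1+k))) (D * L * q^(j1+k)) := by
    intro k
    induction k with
    | zero =>
      refine (Hg G hG A A1 hA lam hl H.la j1 (Fg G b j1) (fun n => measurableSet_Ico.inter (mG _ _))
        (fun n x hx => Set.Ico_subset_Icc_self hx.1) ?_ ?_ ?_).mono ?_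
      · intro n hn
        obtain ⟨Z, hZ1, hZ2⟩ := hZ j1 le_rfl n hn
        refine ⟨_, (Finset.card_union_le _ _).trans ?_, BR_Ico.inter hZ2⟩
        simp; omega
      · intro n hn x hx
        exact hlbG j1 le_rfl n hn x hx.1 hx.2
      · intro x hx t ht
        have : t ⊆ Finset.range (2^j1) := fun n hn => Finset.mem_range.2 (ht n hn).1
        have := Finset.card_le_card this
        rw [Finset.card_range] at this; omega
      · simp only [add_zero]
        gcongr
        rw [hD]; 
        have : 0 ≤ 2 * Cg * q/(q-1) := by positivity
        linarith
    | succ k ih =>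
      set j := j1 + k with hj
      have hjj : j1 + (k+1) = j+1 := by omega
      rw [hjj]
      set U : ℕ → Set ℝ := fun n => Set.Ico 0 1 ∩ (Gd G b ((1/2)^j) ((n/2:ℕ)*(1/2)^j))ᶜ ∩ Gd G b ((1/2)^(j+1)) (n*(1/2)^(j+1)) with hU
      set W : ℕ → Set ℝ := fun n => Set.Ico 0 1 ∩ Gd G b ((1/2)^j) ((n/2:ℕ)*(1/2)^j) ∩ (Gd G b ((1/2)^(j+1)) (n*(1/2)^(j+1)))ᶜ with hW
      have mU : ∀ n, MeasurableSet (U n) := fun n => (measurableSet_Ico.inter (mG _ _).compl).inter (mG _ _)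
      have mW : ∀ n, MeasurableSet (W n) := fun n => (measurableSet_Ico.inter (mG _ _)).inter (mG _ _).compl
      have sU : ∀ n, U n ⊆ Set.Icc 0 1 := fun n x hx => Set.Ico_subset_Icc_self hx.1.1
      have sW : ∀ n, W n ⊆ Set.Icc 0 1 := fun n x hx => Set.Ico_subset_Icc_self hx.1.1
      have bU : Bd (bx lam (G 0 0) A (cs U (j+1))) (Cg * L * q^(j+1)) := by
        refine Hg G hG A A1 hA lam hl H.la (j+1) U mU sU ?_ ?_ ?_
        · intro n hn
          obtain ⟨Z, hZ1, hZ2⟩ := hZ j (by omega) (n/2) (hpar j n hn)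
          obtain ⟨Z', hZ1', hZ2'⟩ := hZ (j+1) (by omega) n hn
          refine ⟨_, ?_, (BR_Ico.inter hZ2.compl).inter hZ2'⟩
          refine (Finset.card_union_le _ _).trans ?_
          have := Finset.card_union_le {(1:ℝ)} Z
          rw [Finset.card_singleton] at this; omega
        · intro n hn x hx
          exact hlbG (j+1) (by omega) n hn x hx.1.1 hx.2
        · intro x hx t ht
          have : t.card ≤ 2*N := by
            apply half_count
            apply hcnt j (by omega) x hx
            intro n hn
            obtain ⟨m, hm, rfl⟩ := Finset.mem_image.1 hn
            exact ⟨hpar j m (ht m hm).1, (ht m hm).2.1.2⟩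
          omega
      have bW : Bd (bx lam (G 0 0) A (cs W (j+1))) (Cg * L * q^(j+1)) := by
        refine Hg G hG A A1 hA lam hl H.la (j+1) W mW sW ?_ ?_ ?_
        · intro n hn
          obtain ⟨Z, hZ1, hZ2⟩ := hZ j (by omega) (n/2) (hpar j n hn)
          obtain ⟨Z', hZ1', hZ2'⟩ := hZ (j+1) (by omega) n hn
          refine ⟨_, ?_, (BR_Ico.inter hZ2).inter hZ2'.compl⟩
          refine (Finset.card_union_le _ _).trans ?_
          have := Finset.card_union_le {(1:ℝ)} Z
          rw [Finset.card_singleton] at this; omega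
        · intro n hn x hx t ht
          have h1 := hlbG j (by omega) (n/2) (hpar j n hn) x hx.1.1 hx.1.2 t (by
            have hp : (1/2:ℝ)^j = 2 * (1/2)^(j+1) := by rw [pow_succ]; ring
            have h0 : (0:ℝ) < (1/2)^(j+1) := by positivity
            have e1 : (2:ℝ) * ((n/2:ℕ):ℝ) ≤ n := by exact_mod_cast Nat.mul_div_le n 2
            have e2 : (n:ℝ) ≤ 2 * ((n/2:ℕ):ℝ) + 1 := by exact_mod_cast (by omega : n ≤ 2*(n/2)+1)
            rw [hp]
            constructor
            · nlinarith [ht.1]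
            · nlinarith [ht.2])
          refine le_trans ?_ h1
          gcongr c * ?_^b
          exact pow_le_pow_of_le_one (by norm_num) (by norm_num) (by omega)
        · intro x hx t ht
          have : t.card ≤ N := hcnt (j+1) (by omega) x hx t fun n hn => ⟨(ht n hn).1, (ht n hn).2.2⟩
          omega
      have kE : ∀ F : ℕ → Set ℝ, (∀ n, MeasurableSet (F n)) → (∀ n, F n ⊆ Set.Icc 0 1) → ∀ j, Ker (bx lam (G 0 0) A (cs F j)) := by
        intro F hF hF1 j
        refine bx_ker01 hG hA (cs_meas F hF j) ?_
        intro z hz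
        exact ⟨hF1 _ hz.2, Set.Ico_subset_Icc_self hz.1⟩
      have kF := kE (Fg G b j) (fun n => measurableSet_Ico.inter (mG _ _)) (fun n x hx => Set.Ico_subset_Icc_self hx.1) j
      have kU := kE U mU sU (j+1)
      have kW := kE W mW sW (j+1)
      have tot := Bd.add (by positivity) (by positivity) kF (kU.add kW.neg) ih 
        (Bd.add (by positivity) (by positivity) kU kW.neg bU bW.neg)
      have ee : bx lam (G 0 0) A (cs (Fg G b (j+1)) (j+1)) = fun x y => bx lam (G 0 0) A (cs (Fg G b j) j) x y + 
          (bx lam (G 0 0) A (cs U (j+1)) x y + - bx lam (G 0 0) A (cs W (j+1)) x y) := by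
        funext x y
        unfold bx
        simp only [Set.indicator, cs, Set.mem_ofPred_eq, hU, hW, Fg, Set.mem_inter_iff, Set.mem_compl_iff, cell_half j y]
        by_cases h1 : y ∈ Set.Ico (0:ℝ) 1 <;> by_cases h2 : x ∈ Set.Ico (0:ℝ) 1 <;> 
          by_cases h3 : x ∈ Gd G b ((1/2)^j) ((⌊2^(j+1)*y⌋₊/2 : ℕ)*(1/2)^j) <;>
          by_cases h4 : x ∈ Gd G b ((1/2)^(j+1)) (⌊2^(j+1)*y⌋₊*(1/2)^(j+1)) <;> simp only [h1, h2, h3, h4, true_and, and_true, not_true_eq_false, not_false_eq_true, and_false, false_and, and_self, if_true, if_false] <;> try ring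
      rw [ee]
      refine tot.mono ?_
      have : D * q^j + 2 * Cg * q^(j+1) ≤ D * q^(j+1) := by
        have h1 : 2 * Cg * q ≤ D * (q - 1) := by
          rw [hD, add_mul, div_mul_cancel₀ _ hq1'.ne']
          have : 0 ≤ Cg * (q-1) := by positivity
          linarith
        have h2 := mul_le_mul_of_nonneg_right h1 (by positivity : 0 ≤ q^j)
        rw [pow_succ]
        nlinarith
      calc D * L * q^j + (Cg * L * q^(j+1) + Cg * L * q^(j+1)) = L * (D * q^j + 2 * Cg * q^(j+1)) := by ring
        _ ≤ L * (D * q^(j+1)) := by gcongr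
        _ = _ := by ring
  set ρ := |lam|^γ with hρ
  have hρ1 : 1 ≤ ρ := Real.one_le_rpow hlam1 hγ0
  obtain ⟨n, hn1, hn2⟩ := near_pow hρ1
  have hmain := main n
  set J := j1 + n with hJ
  have hBdJ := Hb G hG A A1 hA lam hl H.la J (fun n => Set.Ico 0 1 ∩ (Gd G b ((1/2)^J) (n*(1/2)^J))ᶜ) 
    (fun n => measurableSet_Ico.inter (mG _ _).compl) (fun n x hx => Set.Ico_subset_Icc_self hx.1) (by
      intro n hn
      obtain ⟨Z, hZ1, hZ2⟩ := hZ J (by omega) n hn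
      refine ⟨_, (Finset.card_union_le _ _).trans ?_, BR_Ico.inter hZ2.compl⟩
      simp; omega) (by
      intro x hx t ht
      exact hcnt J (by omega) x hx t fun n hn => ⟨(ht n hn).1, (ht n hn).2.2⟩)
  have kE : ∀ F : ℕ → Set ℝ, (∀ n, MeasurableSet (F n)) → (∀ n, F n ⊆ Set.Icc 0 1) → ∀ j, Ker (bx lam (G 0 0) A (cs F j)) := by
    intro F hF hF1 j
    refine bx_ker01 hG hA (cs_meas F hF j) ?_
    intro z hz
    exact ⟨hF1 _ hz.2, Set.Ico_subset_Icc_self hz.1⟩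
  have tot := Bd.add (by positivity) (by positivity) 
    (kE (Fg G b J) (fun n => measurableSet_Ico.inter (mG _ _)) (fun n x hx => Set.Ico_subset_Icc_self hx.1) J)
    (kE (fun n => Set.Ico 0 1 ∩ (Gd G b ((1/2)^J) (n*(1/2)^J))ᶜ) (fun n => measurableSet_Ico.inter (mG _ _).compl) 
      (fun n x hx => Set.Ico_subset_Icc_self hx.1) J) hmain hBdJ
  have ee : bx lam (G 0 0) A (Set.Ico 0 1 ×ˢ Set.Ico 0 1) = fun x y => bx lam (G 0 0) A (cs (Fg G b J) J) x y + 
      bx lam (G 0 0) A (cs (fun n => Set.Ico 0 1 ∩ (Gd G b ((1/2)^J) (n*(1/2)^J))ᶜ) J) x y := by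
    funext x y
    unfold bx
    simp only [Set.indicator, cs, Set.mem_ofPred_eq, Fg, Set.mem_inter_iff, Set.mem_compl_iff, Set.mem_prod]
    by_cases h1 : y ∈ Set.Ico (0:ℝ) 1 <;> by_cases h2 : x ∈ Set.Ico (0:ℝ) 1 <;> 
      by_cases h3 : x ∈ Gd G b ((1/2)^J) (⌊2^J*y⌋₊*(1/2)^J) <;> simp only [h1, h2, h3, true_and, and_true, not_true_eq_false, not_false_eq_true, and_false, false_and, and_self, if_true, if_false] <;> try ring
  rw [ee]
  refine tot.mono ?_
  set θ : ℝ := ((a:ℝ)+b)/(2*((a:ℝ)+b+a*b)) with hθ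
  have hden : 0 < (a:ℝ)+b+a*b := by positivity
  have b1 : q^J ≤ (2^j1*2)^κ * ρ^κ := by
    rw [hq, ← Real.rpow_natCast, ← Real.rpow_mul (by norm_num), mul_comm κ, Real.rpow_mul (by norm_num), Real.rpow_natCast,
      ← Real.mul_rpow (by positivity) (by positivity)]
    gcongr
    rw [hJ, pow_add, mul_assoc]
    gcongr
  have b2 : L * ρ^κ = |lam|^(-θ) := by
    rw [hL, hρ, ← Real.rpow_mul hlam.le, ← Real.rpow_add hlam]
    congr 1
    rw [hγ, hκ, hθ]; field_simp; ring
  have b3 : ((1/2:ℝ)^J)^((a:ℝ)/(2*((a:ℝ)+1))) ≤ |lam|^(-(γ*((a:ℝ)/(2*((a:ℝ)+1))))) := by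
    rw [Real.rpow_neg hlam.le, Real.rpow_mul hlam.le, ← Real.inv_rpow (by positivity)]
    gcongr
    rw [one_div, inv_pow]
    gcongr
    refine hn1.trans ?_
    exact pow_le_pow_right₀ (by norm_num) (by omega)
  have b4 : |lam|^(-(1/(2*((a:ℝ)+1)))) * |lam|^(-(γ*((a:ℝ)/(2*((a:ℝ)+1))))) = |lam|^(-θ) := by
    rw [← Real.rpow_add hlam]
    congr 1
    rw [hγ, hθ]; field_simp; ring
  calc _ ≤ D * L * ((2^j1*2)^κ * ρ^κ) + Cb * (|lam|^(-(1/(2*((a:ℝ)+1)))) * |lam|^(-(γ*((a:ℝ)/(2*((a:ℝ)+1)))))) := by gcongr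
    _ = D * (2^j1*2)^κ * (L * ρ^κ) + Cb * |lam|^(-θ) := by rw [b4]; ring
    _ = _ := by rw [b2]; ring

lemma triv01 {lam : ℝ} {G : ℕ → ℕ → ℝ → ℝ → ℝ} {A A1 : ℝ → ℝ → ℂ} {A0 : ℝ} (hA : Amp A A1 A0) :
    Bd (bx lam (G 0 0) A (Set.Ico 0 1 ×ˢ Set.Ico 0 1)) A0 := by
  have := Bd_trivial (K := bx lam (G 0 0) A (Set.Ico 0 1 ×ˢ Set.Ico 0 1)) (M := A0) (α := 1) (β := 1) 
    ((norm_nonneg _).trans (hA.b 0 0)) zero_le_one zero_le_one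
    (E := Set.Ico 0 1) (F := Set.Ico 0 1) measurableSet_Ico measurableSet_Ico (by simp) (by simp) 
    (fun x y => (bx_norm x y).trans (hA.b x y)) (by
      intro x y h
      apply Set.indicator_of_notMem
      rintro ⟨h1, h2⟩
      rcases h with h | h
      · exact h h1
      · exact h h2)
  simpa using this

lemma min_wrap {K : ℝ → ℝ → ℂ} {C A0 θ lam : ℝ} (hC : 0 ≤ C) (hA0 : 0 ≤ A0) (hl : lam ≠ 0) (hθ : 0 ≤ θ)
    (h1 : Bd K A0) (h2 : 1 ≤ |lam| → Bd K (C * |lam|^(-θ))) : Bd K ((C + A0) * min 1 (|lam|^(-θ))) := by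
  have hlam := abs_pos.2 hl
  rcases le_total 1 |lam| with h | h
  · refine (h2 h).mono ?_
    have : |lam|^(-θ) ≤ 1 := Real.rpow_le_one_of_one_le_of_nonpos h (by linarith)
    rw [min_eq_right this]
    gcongr; linarith
  · refine h1.mono ?_
    have : 1 ≤ |lam|^(-θ) := Real.one_le_rpow_of_pos_of_le_one_of_nonpos hlam h (by linarith)
    rw [min_eq_left this]; linarith

lemma lemA (a b : ℕ) (ha : 1 ≤ a) (hb : 1 ≤ b) (B c A0 : ℝ) (hc : 0 < c) (hB : 0 ≤ B) : ∃ C ≥ (0:ℝ), 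
    ∀ G, HypA G a b B c → ∀ A A1, Amp A A1 A0 → ∀ lam : ℝ, lam ≠ 0 → 
    Bd (bx lam (G 0 0) A (Set.Ico 0 1 ×ˢ Set.Ico 0 1)) (C * min 1 (|lam|^(-(((a:ℝ)+b)/(2*((a:ℝ)+b+a*b)))))) := by
  obtain ⟨C, hC, H⟩ := lemA1 a b ha hb B c A0 hc hB
  refine ⟨C + |A0|, by positivity, ?_⟩
  intro G hG A A1 hA lam hl
  exact min_wrap hC (abs_nonneg _) hl (by positivity) ((triv01 hA).mono (le_abs_self _)) (H G hG A A1 hA lam)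

lemma Fam.phase_ub {G} (hG : Fam G) (k : ℕ) {m x y y' : ℝ} {I : Set ℝ} [I.OrdConnected] (hy : y ∈ I) (hy' : y' ∈ I)
    (h : ∀ t ∈ I, |G k 1 x t| ≤ m) : |G k 0 x y - G k 0 x y'| ≤ m * |y - y'| := by
  rcases le_total y y' with hh | hh
  · obtain ⟨z, hz, e⟩ := (hG.chy k 0 x).mvt 0 hh
    simp only [zero_add] at e
    rw [abs_sub_comm (G k 0 x y), abs_sub_comm y, e, abs_mul]
    gcongr
    exact h z (Set.OrdConnected.out ‹_› hy hy' hz)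
  · obtain ⟨z, hz, e⟩ := (hG.chy k 0 x).mvt 0 hh
    simp only [zero_add] at e
    rw [e, abs_mul]
    gcongr
    exact h z (Set.OrdConnected.out ‹_› hy' hy hz)

lemma V_bound {φ : ℕ → ℝ → ℝ} {p q m M : ℝ} (hpq : p ≤ q) (hpq1 : q - p ≤ 1) (hm : 0 < m) (hM : 0 ≤ M)
    (h1 : ∀ x ∈ Set.Icc p q, m ≤ |φ 1 x|) (h2 : ∀ x ∈ Set.Icc p q, |φ 2 x| ≤ M) :
    ∫ x in p..q, |φ 2 x| / (φ 1 x)^2 ≤ M/m^2 := by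
  have := intervalIntegral.norm_integral_le_of_norm_le_const (a := p) (b := q) (C := M/m^2) (f := fun x => |φ 2 x| / (φ 1 x)^2) (by
    intro x hx
    rw [Set.uIoc_of_le hpq] at hx
    have hx' := Set.Ioc_subset_Icc_self hx
    rw [Real.norm_eq_abs, abs_of_nonneg (by positivity), ← sq_abs (φ 1 x)]
    gcongr
    · exact h2 x hx'
    · exact h1 x hx')
  refine (le_abs_self _).trans (this.trans ?_)
  rw [abs_of_nonneg (by linarith)]
  exact mul_le_of_le_one_right (by positivity) hpq1

lemma lemA0 (B c A0 σ : ℝ) (hc : 0 < c) (hB : 0 ≤ B) (hσ : 0 < σ) (hσ1 : σ < 1) : ∃ C ≥ (0:ℝ), 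
    ∀ G, Fam G → (∀ x ∈ Set.Icc (0:ℝ) 1, ∀ y ∈ Set.Icc (0:ℝ) 1, c ≤ |G 1 1 x y|) → 
    (∀ x ∈ Set.Icc (0:ℝ) 1, ∀ y ∈ Set.Icc (0:ℝ) 1, |G 2 1 x y| ≤ B) → ∀ A A1, Amp A A1 A0 → ∀ lam : ℝ, lam ≠ 0 → 
    Bd (bx lam (G 0 0) A (Set.Ico 0 1 ×ˢ Set.Ico 0 1)) (C * min 1 (|lam|^(-(σ/2)))) := by
  set P := 2*A0^2 with hP
  set Q := P * (3/c + B/c^2) with hQ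
  have hP0 : 0 ≤ P := by positivity
  have hQ0 : 0 ≤ Q := by positivity
  have h1s : 0 < 1 - σ := by linarith
  refine ⟨Real.sqrt (2*((P+Q)*(2/(1-σ)))) + |A0|, by positivity, ?_⟩
  intro G hG hlow hup A A1 hA lam hl
  refine min_wrap (by positivity) (abs_nonneg _) hl (by positivity) ((triv01 hA).mono (le_abs_self _)) fun _ => ?_
  have hlam := abs_pos.2 hl
  have := pieceTT (lam := lam) hG hA measurableSet_Ico Set.Ico_subset_Icc_self (s0 := 0) (r := 1) zero_le_one le_rfl (by norm_num)
    (D := (P+Q) * |lam|^(-σ)) (s := σ) (by positivity) hσ.le hσ1 (by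
      rw [zero_add]
      intro y hy y' hy' hne
      have hh : 0 < |y - y'| := abs_pos.2 (sub_ne_zero.2 hne)
      have hw := hA.w y y'
      have e : ∫ x in (0:ℝ)..1, (Set.Ico 0 1).indicator (fun x => osc lam (fun x => G 0 0 x y - G 0 0 x y') x * 
        (A x y * (starRingEnd ℂ) (A x y'))) x = ∫ x in (0:ℝ)..1, osc lam (fun x => G 0 0 x y - G 0 0 x y') x * 
        (A x y * (starRingEnd ℂ) (A x y')) := by
        refine intervalIntegral.integral_congr_ae ?_
        have : ∀ᵐ x : ℝ, x ≠ 1 := by simp [ae_iff]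
        filter_upwards [this] with x hx hxx
        rw [Set.uIoc_of_le zero_le_one] at hxx
        exact Set.indicator_of_mem (show x ∈ Set.Ico (0:ℝ) 1 from ⟨hxx.1.le, lt_of_le_of_ne hxx.2 hx⟩) _
      rw [e]
      set J := ‖∫ x in (0:ℝ)..1, osc lam (fun x => G 0 0 x y - G 0 0 x y') x * 
        (A x y * (starRingEnd ℂ) (A x y'))‖ with hJ
      have b1 : J ≤ P := by
        have := intervalIntegral.norm_integral_le_of_norm_le_const (a := 0) (b := 1) (C := P) 
          (f := fun x => osc lam (fun x => G 0 0 x y - G 0 0 x y') x * (A x y * (starRingEnd ℂ) (A x y'))) (by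
          intro x _
          rw [norm_mul, osc_norm, one_mul]; exact hw.2.2.1 x)
        simpa using this
      have b2 : J ≤ Q * (|lam| * |y-y'|)⁻¹ := by
        have := vdc_gen hl (hG.phase y y') zero_le_one (by norm_num) (m := c * |y-y'|) (W := P) (by positivity) (fun x _ => hw.1 x)
          hw.2.1.continuousOn (fun x _ => hw.2.2.1 x) (fun x _ => hw.2.2.2 x) 
          (fun x hx => hG.phase_lb 1 hy hy' (fun t ht => hlow x hx t ht))
          (V_bound (φ := fun k x => G k 0 x y - G k 0 x y') (m := c * |y-y'|) (M := B * |y-y'|) zero_le_one (by norm_num) (by positivity) (by positivity) 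
            (fun x hx => hG.phase_lb 1 hy hy' (fun t ht => hlow x hx t ht))
            (fun x hx => hG.phase_ub 2 hy hy' (fun t ht => hup x hx t ht)))
        refine this.trans (le_of_eq ?_)
        rw [hQ]; field_simp
      rw [mul_assoc, ← Real.mul_rpow (by positivity) (by positivity)]
      set T := |lam| * |y-y'| with hT
      have hT0 : 0 < T := by positivity
      rcases le_total T 1 with h | h
      · have : 1 ≤ T^(-σ) := Real.one_le_rpow_of_pos_of_le_one_of_nonpos hT0 h (by linarith)
        nlinarith
      · have : T⁻¹ ≤ T^(-σ) := by
          rw [← Real.rpow_neg_one]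
          exact Real.rpow_le_rpow_of_exponent_le h (by linarith)
        calc J ≤ Q * T⁻¹ := b2
          _ ≤ (P+Q) * T^(-σ) := by gcongr; linarith)
  simp only [zero_add] at this
  convert this using 1
  rw [show 2 * ((P+Q) * |lam|^(-σ) * (2/(1-σ) * (1:ℝ)^(1-σ))) = (2 * ((P+Q) * (2/(1-σ)))) * (|lam|^(-σ) * (1:ℝ)^(1:ℝ) * (1:ℝ)^(1:ℝ)) by 
      rw [Real.one_rpow, Real.one_rpow]; ring,
    sq3 (by positivity) (by positivity) (by positivity) (by positivity), Real.one_rpow, mul_one, mul_one, neg_div]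

lemma lint_cauchy {D lam : ℝ} (hD : 0 ≤ D) (hl : lam ≠ 0) (y : ℝ) : 
    ∫⁻ y', ENNReal.ofReal (D / (1 + (|lam| * |y-y'|)^2)) = ENNReal.ofReal (D * (Real.pi/|lam|)) := by
  have e : ∀ y', D / (1 + (|lam| * |y-y'|)^2) = D * (1 + (lam * (y - y'))^2)⁻¹ := by
    intro y'; rw [mul_pow, sq_abs, sq_abs, ← mul_pow, div_eq_mul_inv]
  simp only [e]
  have hi : Integrable (fun y' => D * (1 + (lam * (y - y'))^2)⁻¹) := by
    apply Integrable.const_mul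
    exact ((integrable_inv_one_add_sq).comp_mul_left' hl).comp_sub_left y
  rw [← ofReal_integral_eq_lintegral_ofReal hi (Filter.Eventually.of_forall fun y' => by positivity)]
  congr 1
  rw [integral_const_mul, integral_sub_left_eq_self (fun t => (1 + (lam * t)^2)⁻¹) volume y,
    Measure.integral_comp_mul_left (fun t => (1 + t^2)⁻¹), integral_univ_inv_one_add_sq, abs_inv, smul_eq_mul]
  field_simp

lemma nondeg (A0 c B e : ℝ) (hc : 0 < c) (hB : 0 ≤ B) (he : 0 < e) (he1 : e ≤ 1/2) : ∃ C ≥ (0:ℝ), ∀ G, Fam G → 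
    (∀ x ∈ Set.Icc (-e) e, ∀ y ∈ Set.Icc (-e) e, c ≤ |G 1 1 x y|) →
    (∀ x ∈ Set.Icc (-e) e, ∀ y ∈ Set.Icc (-e) e, |G 2 1 x y| ≤ B) → 
    (∀ x ∈ Set.Icc (-e) e, ∀ y ∈ Set.Icc (-e) e, |G 3 1 x y| ≤ B) → ∀ A A1 A2, Amp A A1 A0 → Amp A1 A2 A0 →
    (∀ x y, e ≤ |x| ∨ e ≤ |y| → A x y = 0) → ∀ lam : ℝ, lam ≠ 0 → 
    Bd (fun x y => Complex.exp (Complex.I * lam * G 0 0 x y) * A x y) (C * |lam|^(-(1/2:ℝ))) := by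
  set W := 4*A0^2 with hW
  have hW0 : 0 ≤ W := by positivity
  set R := 1/c + 3*B/c^2 + 2*B^2/c^3 with hR
  have hR0 : 0 ≤ R := by positivity
  set Q := W * R * (3/c + B/c^2) with hQ
  have hQ0 : 0 ≤ Q := by positivity
  refine ⟨Real.sqrt (2*((W+Q)*Real.pi)), by positivity, ?_⟩
  intro G hG hlow hup2 hup3 A A1 A2 hA hA1 hsupp lam hl
  have hlam := abs_pos.2 hl
  set K : ℝ → ℝ → ℂ := fun x y => Complex.exp (Complex.I * lam * G 0 0 x y) * A x y with hK
  have hA00 : 0 ≤ A0 := (norm_nonneg _).trans (hA.b 0 0)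
  have hker : Ker K := by
    refine ⟨?_, A0, e, hA00, he.le, ?_, ?_⟩
    · apply Continuous.measurable
      have := hG.c 0 0
      have := hA.c
      fun_prop
    · intro x y; rw [hK]; simp only; rw [norm_mul, exp_norm, one_mul]; exact hA.b x y
    · intro x y h
      rw [hK]; simp only; rw [hsupp x y (h.imp le_of_lt le_of_lt), mul_zero]
  have key : ∀ y y', y ≠ y' → ‖∫ x, K x y * (starRingEnd ℂ) (K x y')‖ ≤ (W+Q) / (1 + (|lam| * |y-y'|)^2) := by
    intro y y' hne
    by_cases hyy : y ∈ Set.Icc (-e) e ∧ y' ∈ Set.Icc (-e) e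
    swap
    · have hz : ∀ x, K x y * (starRingEnd ℂ) (K x y') = 0 := by
        intro x
        rw [not_and_or] at hyy
        rcases hyy with h | h
        · have : K x y = 0 := by
            rw [hK]; simp only; rw [hsupp x y (Or.inr (le_of_lt (not_le.1 fun h' => h (abs_le.1 h')))), mul_zero]
          rw [this, zero_mul]
        · have : K x y' = 0 := by
            rw [hK]; simp only; rw [hsupp x y' (Or.inr (le_of_lt (not_le.1 fun h' => h (abs_le.1 h')))), mul_zero]
          rw [this, map_zero, mul_zero]
      simp only [hz, integral_zero, norm_zero]
      positivity
    obtain ⟨hy, hy'⟩ := hyy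
    set h := |y - y'| with hh
    have hh0 : 0 < h := abs_pos.2 (sub_ne_zero.2 hne)
    set φ : ℕ → ℝ → ℝ := fun k x => G k 0 x y - G k 0 x y' with hφd
    have hφ : Chn φ := hG.phase y y'
    set w : ℝ → ℂ := fun x => A x y * (starRingEnd ℂ) (A x y') with hw
    set w1 : ℝ → ℂ := fun x => A1 x y * (starRingEnd ℂ) (A x y') + A x y * (starRingEnd ℂ) (A1 x y') with hw1
    set w2 : ℝ → ℂ := fun x => (A2 x y * (starRingEnd ℂ) (A x y') + A1 x y * (starRingEnd ℂ) (A1 x y')) +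
      (A1 x y * (starRingEnd ℂ) (A1 x y') + A x y * (starRingEnd ℂ) (A2 x y')) with hw2
    have hwA := hA.w y y'
    have dw1 : ∀ x, HasDerivAt w1 (w2 x) x := by
      intro x
      exact ((hA1.dx y x).mul (hA.dx y' x).star).add ((hA.dx y x).mul (hA1.dx y' x).star)
    have pr : ∀ u v : ℂ, ‖u‖ ≤ A0 → ‖v‖ ≤ A0 → ‖u * (starRingEnd ℂ) v‖ ≤ A0^2 := by
      intro u v hu hv
      rw [norm_mul, RCLike.norm_conj, sq]; gcongr
    have bw : ∀ x, ‖w x‖ ≤ W := fun x => (hwA.2.2.1 x).trans (by rw [hW]; nlinarith)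
    have bw1 : ∀ x, ‖w1 x‖ ≤ W := fun x => (hwA.2.2.2 x).trans (by rw [hW]; nlinarith)
    have bw2 : ∀ x, ‖w2 x‖ ≤ W := by
      intro x
      refine (norm_add_le _ _).trans ((add_le_add (norm_add_le _ _) (norm_add_le _ _)).trans ?_)
      have := pr _ _ (hA1.b1 x y) (hA.b x y')
      have := pr _ _ (hA1.b x y) (hA1.b x y')
      have := pr _ _ (hA.b x y) (hA1.b1 x y')
      rw [hW]; linarith
    have cA : ∀ t, Continuous (fun x => A x t) := fun t => hA.c.comp (by fun_prop : Continuous fun x : ℝ => (x, t))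
    have cA1 : ∀ t, Continuous (fun x => A1 x t) := fun t => hA.c1.comp (by fun_prop : Continuous fun x : ℝ => (x, t))
    have cA2 : ∀ t, Continuous (fun x => A2 x t) := fun t => hA1.c1.comp (by fun_prop : Continuous fun x : ℝ => (x, t))
    have cw2 : Continuous w2 := by
      have := cA y; have := cA y'; have := cA1 y; have := cA1 y'; have := cA2 y; have := cA2 y'
      have cc := Complex.continuous_conj
      exact (((cA2 y).mul (cc.comp (cA y'))).add ((cA1 y).mul (cc.comp (cA1 y')))).add 
        (((cA1 y).mul (cc.comp (cA1 y'))).add ((cA y).mul (cc.comp (cA2 y'))))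
    have cw1 : Continuous w1 := continuous_iff_continuousAt.2 fun x => (dw1 x).continuousAt
    have cw : Continuous w := continuous_iff_continuousAt.2 fun x => (hwA.1 x).continuousAt
    have l1 : ∀ x ∈ Set.Icc (-e) e, c*h ≤ |φ 1 x| := fun x hx => hG.phase_lb 1 hy hy' (fun t ht => hlow x hx t ht)
    have u2 : ∀ x ∈ Set.Icc (-e) e, |φ 2 x| ≤ B*h := fun x hx => hG.phase_ub 2 hy hy' (fun t ht => hup2 x hx t ht)
    have u3 : ∀ x ∈ Set.Icc (-e) e, |φ 3 x| ≤ B*h := fun x hx => hG.phase_ub 3 hy hy' (fun t ht => hup3 x hx t ht)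
    have hch : 0 < c*h := by positivity
    have ne1 : ∀ x ∈ Set.Icc (-e) e, φ 1 x ≠ 0 := fun x hx h0 => by
      have := l1 x hx; rw [h0, abs_zero] at this; linarith
    set J := ∫ x in (-e)..e, osc lam (φ 0) x * w x with hJ
    have eJ : ∫ x, K x y * (starRingEnd ℂ) (K x y') = J := by
      rw [hJ, intervalIntegral.integral_of_le (by linarith), ← integral_Icc_eq_integral_Ioc,
        setIntegral_eq_integral_of_forall_compl_eq_zero]
      · refine integral_congr_ae (Filter.Eventually.of_forall fun x => ?_)
        simp only [hK, osc, hφd, hw]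
        rw [map_mul, ← Complex.exp_conj]
        have : Complex.exp (Complex.I * lam * ((G 0 0 x y - G 0 0 x y' : ℝ) : ℂ)) = 
            Complex.exp (Complex.I * lam * G 0 0 x y) * Complex.exp ((starRingEnd ℂ) (Complex.I * lam * G 0 0 x y')) := by
          rw [← Complex.exp_add]; congr 1
          simp only [map_mul, Complex.conj_I, Complex.conj_ofReal]; push_cast; ring
        rw [this]; ring
      · intro x hx
        have : A x y = 0 := hsupp x y (Or.inl (le_of_lt (not_le.1 fun h' => hx (abs_le.1 h'))))
        simp [hw, this]
    rw [eJ]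
    have b1 : ‖J‖ ≤ W := by
      have := intervalIntegral.norm_integral_le_of_norm_le_const (a := -e) (b := e) (C := W) 
        (f := fun x => osc lam (φ 0) x * w x) (by
          intro x _
          rw [norm_mul, osc_norm, one_mul]; exact bw x)
      refine this.trans ?_
      rw [abs_of_nonneg (by linarith)]
      exact mul_le_of_le_one_right hW0 (by linarith)
    set g : ℝ → ℂ := fun x => w1 x / φ 1 x - w x * φ 2 x / (φ 1 x)^2 with hg
    set g1 : ℝ → ℂ := fun x => w2 x / φ 1 x - 2 * (w1 x * φ 2 x / (φ 1 x)^2) - w x * φ 3 x / (φ 1 x)^2 + 2 * (w x * (φ 2 x)^2 / (φ 1 x)^3) with hg1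
    have ibp1 := ibp (lam := lam) hφ (by linarith : -e ≤ e) (fun x _ => hwA.1 x) cw1.continuousOn ne1
    have z1 : A e y = 0 := hsupp e y (Or.inl (le_abs_self _))
    have z2 : A (-e) y = 0 := hsupp (-e) y (Or.inl (by rw [abs_neg]; exact le_abs_self _))
    rw [z1, z2] at ibp1
    simp only [zero_mul, zero_div, sub_zero, zero_sub] at ibp1
    have ofc : ∀ k, Continuous (fun x => (φ k x : ℂ)) := fun k => Complex.continuous_ofReal.comp (hφ.cont k)
    have ne1c : ∀ x ∈ Set.Icc (-e) e, (φ 1 x : ℂ) ≠ 0 := fun x hx => by exact_mod_cast ne1 x hx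
    have dg : ∀ x ∈ Set.Icc (-e) e, HasDerivAt g (g1 x) x := by
      intro x hx
      have d1 := (hφ 1 x).ofReal_comp
      have d2 := (hφ 2 x).ofReal_comp
      have dw : HasDerivAt w (w1 x) x := hwA.1 x
      have := ((dw1 x).div d1 (ne1c x hx)).sub ((dw.mul d2).div (d1.pow 2) (pow_ne_zero 2 (ne1c x hx)))
      refine HasDerivAt.congr_deriv (f := g) this ?_
      have hn := ne1c x hx
      change (w2 x * φ 1 x - w1 x * φ 2 x) / (φ 1 x)^2 - ((w1 x * φ 2 x + w x * φ 3 x) * (φ 1 x)^2 - 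
        (w x * φ 2 x) * (((2:ℕ):ℂ) * (φ 1 x)^(2-1) * φ 2 x)) / ((φ 1 x : ℂ)^2)^2 = w2 x / φ 1 x - 2 * (w1 x * φ 2 x / (φ 1 x)^2) - w x * φ 3 x / (φ 1 x)^2 + 2 * (w x * (φ 2 x)^2 / (φ 1 x)^3)
      generalize (w x) = aa
      generalize (w1 x) = bb
      generalize (w2 x) = cc
      generalize (φ 1 x : ℂ) = p1 at *
      generalize (φ 2 x : ℂ) = p2
      generalize (φ 3 x : ℂ) = p3
      push_cast
      field_simp
      ring
    have cg1 : ContinuousOn g1 (Set.Icc (-e) e) := by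
      have h1 := (ofc 1).continuousOn (s := Set.Icc (-e) e)
      have h2 := (ofc 2).continuousOn (s := Set.Icc (-e) e)
      have h3 := (ofc 3).continuousOn (s := Set.Icc (-e) e)
      have k0 := cw.continuousOn (s := Set.Icc (-e) e)
      have k1 := cw1.continuousOn (s := Set.Icc (-e) e)
      have k2 := cw2.continuousOn (s := Set.Icc (-e) e)
      refine (((k2.div h1 ne1c).sub (continuousOn_const.mul ((k1.mul h2).div (h1.pow 2) fun x hx => pow_ne_zero 2 (ne1c x hx)))).sub
        ((k0.mul h3).div (h1.pow 2) fun x hx => pow_ne_zero 2 (ne1c x hx))).add 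
        (continuousOn_const.mul ((k0.mul (h2.pow 2)).div (h1.pow 3) fun x hx => pow_ne_zero 3 (ne1c x hx)))
    have nn : ∀ k x, ‖(φ k x : ℂ)‖ = |φ k x| := fun k x => by rw [Complex.norm_real, Real.norm_eq_abs]
    have t1 : ∀ x ∈ Set.Icc (-e) e, ∀ v : ℂ, ‖v‖ ≤ W → ‖v / φ 1 x‖ ≤ W/(c*h) := by
      intro x hx v hv
      rw [norm_div, nn]; gcongr; exact l1 x hx
    have t2 : ∀ x ∈ Set.Icc (-e) e, ∀ v : ℂ, ‖v‖ ≤ W → ∀ k, |φ k x| ≤ B*h → ‖v * φ k x / (φ 1 x)^2‖ ≤ W*(B*h)/(c*h)^2 := by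
      intro x hx v hv k hk
      rw [norm_div, norm_mul, norm_pow, nn, nn]; gcongr; exact l1 x hx
    have t3 : ∀ x ∈ Set.Icc (-e) e, ∀ v : ℂ, ‖v‖ ≤ W → ‖v * (φ 2 x)^2 / (φ 1 x)^3‖ ≤ W*(B*h)^2/(c*h)^3 := by
      intro x hx v hv
      rw [norm_div, norm_mul, norm_pow, norm_pow, nn, nn]; gcongr
      · exact u2 x hx
      · exact l1 x hx
    have eR : W*R/h = W/(c*h) + 3 * (W*(B*h)/(c*h)^2) + 2 * (W*(B*h)^2/(c*h)^3) := by
      rw [hR]; field_simp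
    have bg : ∀ x ∈ Set.Icc (-e) e, ‖g x‖ ≤ W*R/h := by
      intro x hx
      have a1 := t1 x hx (w1 x) (bw1 x)
      have a2 := t2 x hx (w x) (bw x) 2 (u2 x hx)
      have a3 : 0 ≤ W*(B*h)/(c*h)^2 := by positivity
      have a4 : 0 ≤ W*(B*h)^2/(c*h)^3 := by positivity
      rw [eR]
      refine (norm_sub_le _ _).trans ?_
      linarith
    have bg1 : ∀ x ∈ Set.Icc (-e) e, ‖g1 x‖ ≤ W*R/h := by
      intro x hx
      have a1 := t1 x hx (w2 x) (bw2 x)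
      have a2 := t2 x hx (w1 x) (bw1 x) 2 (u2 x hx)
      have a3 := t2 x hx (w x) (bw x) 3 (u3 x hx)
      have a4 := t3 x hx (w x) (bw x)
      rw [eR]
      refine (norm_add_le _ _).trans ((add_le_add_left (norm_sub_le _ _) _).trans ((add_le_add_left (add_le_add_left (norm_sub_le _ _) _) _).trans ?_))
      rw [norm_mul, norm_mul, Complex.norm_ofNat]
      linarith
    have b2 := vdc_gen hl hφ (by linarith : -e ≤ e) (by linarith) (m := c*h) (W := W*R/h) hch dg cg1 bg bg1 l1 
      (V_bound (M := B*h) (by linarith) (by linarith) hch (by positivity) l1 u2)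
    have b3 : |lam| * ‖J‖ ≤ W*R/h * (3/(c*h) + B*h/(c*h)^2)/|lam| := by
      have := congrArg norm ibp1
      rw [norm_mul, norm_mul, Complex.norm_I, one_mul, Complex.norm_real, Real.norm_eq_abs, norm_neg] at this
      have e2 : ∫ x in (-e)..e, g x * osc lam (φ 0) x = ∫ x in (-e)..e, osc lam (φ 0) x * g x := by
        congr 1; funext x; ring
      have e3 : |lam| * ‖J‖ = ‖∫ x in (-e)..e, g x * osc lam (φ 0) x‖ := this
      rw [e3, e2]; exact b2
    have b4 : ‖J‖ * (|lam| * h)^2 ≤ Q := by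
      rw [le_div_iff₀ hlam] at b3
      have e3 : W*R/h * (3/(c*h) + B*h/(c*h)^2) * h^2 = Q := by rw [hQ]; field_simp
      rw [← e3]
      calc ‖J‖ * (|lam| * h)^2 = (|lam| * ‖J‖ * |lam|) * h^2 := by ring
        _ ≤ _ := by gcongr
    rw [le_div_iff₀ (by positivity)]
    linarith
  have := Bd_TT hker (A := (W+Q)*(Real.pi/|lam|)) (by positivity) (by
    intro y
    rw [← lint_cauchy (by positivity) hl y]
    apply lintegral_mono_ae
    have : ∀ᵐ y' : ℝ, y' ≠ y := by simp [ae_iff]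
    filter_upwards [this] with y' hy'
    rw [← ofReal_norm]
    exact ENNReal.ofReal_le_ofReal (key y y' hy'.symm))
  convert this using 1
  rw [show 2*((W+Q)*(Real.pi/|lam|)) = (2*((W+Q)*Real.pi)) * (|lam|^(-1:ℝ) * (1:ℝ)^(1:ℝ) * (1:ℝ)^(1:ℝ)) by 
      rw [Real.one_rpow, Real.rpow_neg_one]; ring,
    sq3 (by positivity) (by positivity) (by positivity) (by positivity), Real.one_rpow, mul_one, mul_one, neg_div]

lemma pdx_has {f : ℝ × ℝ → ℝ} (h : ∀ z, AnalyticAt ℝ f z) (x y : ℝ) :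
    HasDerivAt (fun t => f (t, y)) (fderiv ℝ f (x, y) (1, 0)) x := by
  have := (h (x,y)).differentiableAt.hasFDerivAt.comp_hasDerivAt x ((hasDerivAt_id x).prodMk (hasDerivAt_const x y))
  exact this

lemma pdy_has {f : ℝ × ℝ → ℝ} (h : ∀ z, AnalyticAt ℝ f z) (x y : ℝ) :
    HasDerivAt (fun t => f (x, t)) (fderiv ℝ f (x, y) (0, 1)) y := by
  have := (h (x,y)).differentiableAt.hasFDerivAt.comp_hasDerivAt y ((hasDerivAt_const y x).prodMk (hasDerivAt_id y))
  exact this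

lemma pdx_eq {f : ℝ × ℝ → ℝ} (h : ∀ z, AnalyticAt ℝ f z) : pdx f = fun z => fderiv ℝ f z (1, 0) := by
  funext z; exact (pdx_has h z.1 z.2).deriv

lemma pdy_eq {f : ℝ × ℝ → ℝ} (h : ∀ z, AnalyticAt ℝ f z) : pdy f = fun z => fderiv ℝ f z (0, 1) := by
  funext z; exact (pdy_has h z.1 z.2).deriv

lemma an_app {f : ℝ × ℝ → ℝ} (h : ∀ z, AnalyticAt ℝ f z) (v : ℝ × ℝ) (z) : AnalyticAt ℝ (fun z => fderiv ℝ f z v) z :=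
  ((ContinuousLinearMap.apply ℝ ℝ v).analyticAt _).comp (h z).fderiv

lemma pdx_an {f : ℝ × ℝ → ℝ} (h : ∀ z, AnalyticAt ℝ f z) : ∀ z, AnalyticAt ℝ (pdx f) z := by
  rw [pdx_eq h]; exact an_app h _

lemma pdy_an {f : ℝ × ℝ → ℝ} (h : ∀ z, AnalyticAt ℝ f z) : ∀ z, AnalyticAt ℝ (pdy f) z := by
  rw [pdy_eq h]; exact an_app h _

lemma pd_comm {f : ℝ × ℝ → ℝ} (h : ∀ z, AnalyticAt ℝ f z) : pdx (pdy f) = pdy (pdx f) := by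
  rw [pdx_eq (pdy_an h), pdy_eq (pdx_an h), pdx_eq h, pdy_eq h]
  funext z
  have hd := (h z).fderiv.differentiableAt.hasFDerivAt
  have h1 : ∀ v : ℝ × ℝ, fderiv ℝ (fun z => fderiv ℝ f z v) z = (ContinuousLinearMap.apply ℝ ℝ v).comp (fderiv ℝ (fderiv ℝ f) z) :=
    fun v => ((ContinuousLinearMap.apply ℝ ℝ v).hasFDerivAt.comp z hd).fderiv
  rw [h1, h1]
  have := (h z).contDiffAt (n := ⊤) |>.isSymmSndFDerivAt_of_omega
  exact this.eq _ _

lemma pdx_it {f : ℝ × ℝ → ℝ} (h : ∀ z, AnalyticAt ℝ f z) : ∀ n z, AnalyticAt ℝ (pdx^[n] f) z := by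
  intro n
  induction n with
  | zero => exact h
  | succ n ih => rw [Function.iterate_succ_apply']; exact pdx_an ih

lemma pdy_it {f : ℝ × ℝ → ℝ} (h : ∀ z, AnalyticAt ℝ f z) : ∀ n z, AnalyticAt ℝ (pdy^[n] f) z := by
  intro n
  induction n with
  | zero => exact h
  | succ n ih => rw [Function.iterate_succ_apply']; exact pdy_an ih

lemma pdxy_it {f : ℝ × ℝ → ℝ} (h : ∀ z, AnalyticAt ℝ f z) (n : ℕ) : pdy (pdx^[n] f) = pdx^[n] (pdy f) := by
  induction n with
  | zero => rfl
  | succ n ih => rw [Function.iterate_succ_apply', Function.iterate_succ_apply', ← pd_comm (pdx_it h n), ih]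

lemma pdyx_it {f : ℝ × ℝ → ℝ} (h : ∀ z, AnalyticAt ℝ f z) (n : ℕ) : pdy^[n] (pdx f) = pdx (pdy^[n] f) := by
  induction n with
  | zero => rfl
  | succ n ih => rw [Function.iterate_succ_apply', Function.iterate_succ_apply', ih, pd_comm (pdy_it h n)]

def GS (S : ℝ × ℝ → ℝ) (α β : ℕ) (x y : ℝ) : ℝ := (pdx^[α] (pdy^[β] S)) (x, y)

lemma GS_fam {S : ℝ × ℝ → ℝ} (h : ∀ z, AnalyticAt ℝ S z) : Fam (GS S) := by
  have ha : ∀ α β z, AnalyticAt ℝ (pdx^[α] (pdy^[β] S)) z := fun α β => pdx_it (pdy_it h β) α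
  refine ⟨fun α β y x => ?_, fun α β x y => ?_, fun α β => ?_⟩
  · have := pdx_has (ha α β) x y
    unfold GS
    rw [Function.iterate_succ_apply', pdx_eq (ha α β)]; exact this
  · have := pdy_has (ha α β) x y
    unfold GS
    rw [Function.iterate_succ_apply', ← pdxy_it (pdy_it h β), pdy_eq (ha α β)]; exact this
  · exact continuous_iff_continuousAt.2 fun z => (ha α β z).continuousAt

lemma GS_P {S : ℝ × ℝ → ℝ} (h : ∀ z, AnalyticAt ℝ S z) (α β : ℕ) : GS S (α+1) (β+1) = GS (pdx (pdy S)) α β := by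
  funext x y
  unfold GS
  rw [pdyx_it (pdy_an h), ← Function.iterate_succ_apply, ← Function.iterate_succ_apply]

lemma ps {P : ℝ × ℝ → ℝ} (h : AnalyticAt ℝ P 0) : ∃ (c : ℕ → ℕ → ℝ) (A ρ s : ℝ), 0 < s ∧ s ≤ 1 ∧ 0 ≤ A ∧ 0 ≤ ρ ∧ ρ * s ≤ 1/2 ∧
    (∀ p q, |c p q| ≤ A * ρ^(p+q)) ∧ ∀ x y, |x| ≤ s → |y| ≤ s → P (x,y) = ∑' z : ℕ × ℕ, c z.1 z.2 * x^z.1 * y^z.2 := by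
  obtain ⟨p, r, hp⟩ := h
  obtain ⟨C, ρ0, hC, hρ0, hpn⟩ := p.le_mul_pow_of_radius_pos (lt_of_lt_of_le hp.r_pos hp.r_le)
  obtain ⟨r1, hr1, hr1r⟩ := ENNReal.lt_iff_exists_nnreal_btwn.1 hp.r_pos
  have hr1' : (0:ℝ) < r1 := by exact_mod_cast hr1
  classical
  set c' : ℕ → ℕ → ℝ := fun n k => ∑ s ∈ Finset.powersetCard k (Finset.univ : Finset (Fin n)), 
    p n (s.piecewise (fun _ => ((1:ℝ),(0:ℝ))) (fun _ => ((0:ℝ),(1:ℝ)))) with hc'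
  have hcb : ∀ n k, |c' n k| ≤ C * (2*ρ0)^n := by
    intro n k
    have h1 : ∀ s : Finset (Fin n), |p n (s.piecewise (fun _ => ((1:ℝ),(0:ℝ))) (fun _ => ((0:ℝ),(1:ℝ))))| ≤ C * ρ0^n := by
      intro s
      refine ((p n).le_opNorm _).trans (le_trans ?_ (hpn n))
      refine mul_le_of_le_one_right (norm_nonneg _) (Finset.prod_le_one (fun _ _ => norm_nonneg _) fun i _ => ?_)
      by_cases hi : i ∈ s <;> simp [hi, Prod.norm_def]
    refine (Finset.abs_sum_le_sum_abs _ _).trans ((Finset.sum_le_sum fun s _ => h1 s).trans ?_)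
    rw [Finset.sum_const, Finset.card_powersetCard, Finset.card_univ, Fintype.card_fin, nsmul_eq_mul, mul_pow]
    have : ((n.choose k : ℕ) : ℝ) ≤ 2^n := by exact_mod_cast Nat.choose_le_two_pow n k
    calc (n.choose k : ℝ) * (C * ρ0^n) ≤ 2^n * (C*ρ0^n) := by gcongr
      _ = _ := by ring
  have key : ∀ n (x y : ℝ), p n (fun _ => (x,y)) = ∑ kl ∈ Finset.HasAntidiagonal.antidiagonal n, c' (kl.1+kl.2) kl.1 * x^kl.1 * y^kl.2 := by
    intro n x y
    have e1 : (fun _ : Fin n => (x,y)) = (fun _ => x • ((1:ℝ),(0:ℝ))) + (fun _ => y • ((0:ℝ),(1:ℝ))) := by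
      funext i; simp
    rw [e1, (p n).map_add_univ, ← Finset.powerset_univ, Finset.sum_powerset, Finset.card_univ, Fintype.card_fin, 
      Finset.Nat.sum_antidiagonal_eq_sum_range_succ (fun k l => c' (k+l) k * x^k * y^l)]
    refine Finset.sum_congr rfl fun k hk => ?_
    have hk' : k ≤ n := by simpa [Nat.lt_succ_iff] using hk
    rw [Nat.add_sub_cancel' hk', hc', mul_assoc, Finset.sum_mul]
    refine Finset.sum_congr rfl fun s hs => ?_
    have hsc := (Finset.mem_powersetCard.1 hs).2
    have e2 : s.piecewise (fun _ : Fin n => x • ((1:ℝ),(0:ℝ))) (fun _ => y • ((0:ℝ),(1:ℝ))) = 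
      fun i => (s.piecewise (fun _ => x) (fun _ => y) i) • (s.piecewise (fun _ => ((1:ℝ),(0:ℝ))) (fun _ => ((0:ℝ),(1:ℝ))) i) := by
      funext i; by_cases hi : i ∈ s <;> simp [hi]
    rw [e2, (p n).map_smul_univ, smul_eq_mul, mul_comm]
    congr 1
    rw [Finset.prod_piecewise]
    have e3 : (Finset.univ \ s).card = n - k := by
      rw [Finset.card_sdiff_of_subset (Finset.subset_univ _), Finset.card_univ, Fintype.card_fin, hsc]
    simp only [Finset.univ_inter, Finset.prod_const, hsc, e3]
  set ρ := 2 * ρ0 with hρ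
  have hρp : 0 < ρ := by positivity
  set s := min 1 (min (1/(2*ρ)) (r1/2)) with hs
  have hs0 : 0 < s := by positivity
  have hsρ : ρ * s ≤ 1/2 := by
    calc ρ * s ≤ ρ * (1/(2*ρ)) := by gcongr; exact (min_le_right _ _).trans (min_le_left _ _)
      _ = 1/2 := by field_simp
  refine ⟨fun k l => c' (k+l) k, C, ρ, s, hs0, min_le_left _ _, hC.le, hρp.le, hsρ, fun k l => hcb _ _, fun x y hx hy => ?_⟩
  have hmem : (x,y) ∈ Metric.eball (0:ℝ×ℝ) r := by
    rw [Metric.mem_eball, edist_zero_right]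
    refine lt_trans ?_ hr1r
    rw [← ofReal_norm, ENNReal.ofReal_lt_coe_iff (by positivity)]
    have : s ≤ r1/2 := (min_le_right _ _).trans (min_le_right _ _)
    rw [Prod.norm_def, max_lt_iff]
    simp only [Real.norm_eq_abs]
    constructor <;> linarith
  have hsum := (hp.hasSum hmem).tsum_eq
  rw [zero_add] at hsum
  rw [← hsum]
  have hsm : Summable (fun z : ℕ × ℕ => c' (z.1+z.2) z.1 * x^z.1 * y^z.2) := by
    have g : Summable (fun n : ℕ => ((1:ℝ)/2)^n) := summable_geometric_two
    refine Summable.of_norm_bounded ((g.mul_of_nonneg g (fun n => by positivity) (fun n => by positivity)).mul_left C) fun z => ?_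
    rw [norm_mul, norm_mul, norm_pow, norm_pow, Real.norm_eq_abs, Real.norm_eq_abs, Real.norm_eq_abs]
    calc |c' (z.1+z.2) z.1| * |x|^z.1 * |y|^z.2 ≤ (C * ρ^(z.1+z.2)) * s^z.1 * s^z.2 := by gcongr; exact hcb _ _
      _ = C * ((ρ*s)^z.1 * (ρ*s)^z.2) := by rw [mul_pow, mul_pow, pow_add]; ring
      _ ≤ _ := by gcongr
  refine Eq.trans ?_ (Finset.HasAntidiagonal.sigmaAntidiagonalEquivProd.tsum_eq (fun z : ℕ × ℕ => c' (z.1+z.2) z.1 * x^z.1 * y^z.2))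
  refine Eq.trans ?_ ((Finset.HasAntidiagonal.sigmaAntidiagonalEquivProd.summable_iff.2 hsm).tsum_sigma' (fun n => (hasSum_fintype _).summable)).symm
  refine tsum_congr fun n => ?_
  rw [key, tsum_fintype, ← Finset.sum_coe_sort]
  rfl

def tm (c : ℕ → ℕ → ℝ) (α β : ℕ) (z : ℕ × ℕ) (x y : ℝ) : ℝ :=
  c z.1 z.2 * ((z.1.descFactorial α : ℝ) * (z.2.descFactorial β : ℝ)) * (x^(z.1-α) * y^(z.2-β))

structure Ser (H : ℕ → ℕ → ℝ → ℝ → ℝ) (c : ℕ → ℕ → ℝ) (s : ℝ) : Prop where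
  s0 : 0 < s
  s1 : s ≤ 1
  sm : ∀ α β, Summable (fun z : ℕ × ℕ => |tm c α β z s s|)
  hs : ∀ α β x y, |x| < s → |y| < s → H α β x y = ∑' z : ℕ × ℕ, tm c α β z x y

lemma tm_le (c : ℕ → ℕ → ℝ) (α β : ℕ) (z : ℕ × ℕ) {x y s : ℝ} (hs : 0 ≤ s) (hx : |x| ≤ s) (hy : |y| ≤ s) :
    |tm c α β z x y| ≤ |tm c α β z s s| := by
  unfold tm
  rw [abs_mul, abs_mul (_ * _) (s^_ * s^_), abs_mul (x^_), abs_mul (s^_), abs_pow, abs_pow, abs_pow, abs_pow, abs_of_nonneg hs]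
  gcongr

lemma tm_dx (c : ℕ → ℕ → ℝ) (α β : ℕ) (z : ℕ × ℕ) (x y : ℝ) :
    HasDerivAt (fun x => tm c α β z x y) (tm c (α+1) β z x y) x := by
  unfold tm
  refine (((hasDerivAt_pow (z.1-α) x).mul_const (y^(z.2-β))).const_mul _).congr_deriv ?_
  rw [Nat.descFactorial_succ, Nat.sub_sub]; push_cast; ring

lemma tm_dy (c : ℕ → ℕ → ℝ) (α β : ℕ) (z : ℕ × ℕ) (x y : ℝ) :
    HasDerivAt (fun y => tm c α β z x y) (tm c α (β+1) z x y) y := by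
  unfold tm
  refine (((hasDerivAt_pow (z.2-β) y).const_mul (x^(z.1-α))).const_mul _).congr_deriv ?_
  rw [Nat.descFactorial_succ, Nat.sub_sub]; push_cast; ring

lemma df_pow (p α : ℕ) {s : ℝ} (hs : 0 < s) : (p.descFactorial α : ℝ) * s^(p-α) ≤ (p:ℝ)^α * s^p / s^α := by
  rcases lt_or_ge p α with h | h
  · rw [Nat.descFactorial_eq_zero_iff_lt.2 h]; simp only [Nat.cast_zero, zero_mul]; positivity
  · rw [mul_div_assoc, ← pow_sub₀ s hs.ne' h |>.trans (div_eq_mul_inv _ _).symm]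
    gcongr
    exact_mod_cast Nat.descFactorial_le_pow p α

lemma ser_of {H : ℕ → ℕ → ℝ → ℝ → ℝ} (hH : Fam H) {c : ℕ → ℕ → ℝ} {A ρ s : ℝ} (hs0 : 0 < s) (hs1 : s ≤ 1) (hA : 0 ≤ A) (hρ : 0 ≤ ρ)
    (hρs : ρ * s ≤ 1/2) (hc : ∀ p q, |c p q| ≤ A * ρ^(p+q)) 
    (h0 : ∀ x y, |x| ≤ s → |y| ≤ s → H 0 0 x y = ∑' z : ℕ × ℕ, c z.1 z.2 * x^z.1 * y^z.2) : Ser H c s := by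
  have sm : ∀ α β, Summable (fun z : ℕ × ℕ => |tm c α β z s s|) := by
    intro α β
    have g : ∀ k : ℕ, Summable (fun n : ℕ => (n:ℝ)^k * ((1:ℝ)/2)^n) := fun k =>
      summable_pow_mul_geometric_of_norm_lt_one k (by norm_num)
    refine Summable.of_norm_bounded (((g α).mul_of_nonneg (g β) (fun n => by positivity) (fun n => by positivity)).mul_left (A/(s^α*s^β))) fun z => ?_
    rw [Real.norm_eq_abs, abs_abs]
    unfold tm
    rw [abs_mul, abs_mul, abs_of_nonneg (by positivity : (0:ℝ) ≤ (z.1.descFactorial α : ℝ) * (z.2.descFactorial β : ℝ)),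
      abs_of_nonneg (by positivity : 0 ≤ s^(z.1-α) * s^(z.2-β))]
    calc |c z.1 z.2| * ((z.1.descFactorial α : ℝ) * (z.2.descFactorial β : ℝ)) * (s^(z.1-α) * s^(z.2-β)) 
        = |c z.1 z.2| * (((z.1.descFactorial α : ℝ) * s^(z.1-α)) * ((z.2.descFactorial β : ℝ) * s^(z.2-β))) := by ring
      _ ≤ (A * ρ^(z.1+z.2)) * (((z.1:ℝ)^α * s^z.1 / s^α) * ((z.2:ℝ)^β * s^z.2 / s^β)) := by
        gcongr
        · exact hc _ _
        · exact df_pow _ _ hs0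
        · exact df_pow _ _ hs0
      _ = A/(s^α*s^β) * (((z.1:ℝ)^α * (ρ*s)^z.1) * ((z.2:ℝ)^β * (ρ*s)^z.2)) := by
        rw [mul_pow, mul_pow, pow_add]; field_simp
      _ ≤ _ := by gcongr
  have smx : ∀ α β x y, |x| ≤ s → |y| ≤ s → Summable (fun z : ℕ × ℕ => tm c α β z x y) := fun α β x y hx hy =>
    Summable.of_norm_bounded (sm α β) fun z => tm_le c α β z hs0.le hx hy
  have nh : ∀ x, |x| < s → Set.Ioo (-s) s ∈ nhds x := fun x hx => Ioo_mem_nhds (abs_lt.1 hx).1 (abs_lt.1 hx).2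
  have step1 : ∀ α x y, |x| < s → |y| < s → H α 0 x y = ∑' z : ℕ × ℕ, tm c α 0 z x y := by
    intro α
    induction α with
    | zero => 
      intro x y hx hy
      rw [h0 x y hx.le hy.le]; refine tsum_congr fun z => ?_
      unfold tm; simp [mul_assoc]
    | succ α ih =>
      intro x y hx hy
      have d := hasDerivAt_tsum_of_isPreconnected (g := fun z x => tm c α 0 z x y) (g' := fun z x => tm c (α+1) 0 z x y) (sm (α+1) 0) (isOpen_Ioo (a := -s) (b := s)) isPreconnected_Ioo
        (fun z x _ => tm_dx c α 0 z x y) (fun z x hx => tm_le c (α+1) 0 z hs0.le (abs_lt.2 hx).le hy.le) (y₀ := x) (abs_lt.1 hx)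
        (smx α 0 x y hx.le hy.le) (abs_lt.1 hx)
      refine (hH.dx α 0 y x).unique (d.congr_of_eventuallyEq ?_)
      filter_upwards [nh x hx] with t ht using ih t y (abs_lt.2 ht) hy
  refine ⟨hs0, hs1, sm, fun α β => ?_⟩
  induction β with
  | zero => exact step1 α
  | succ β ih => 
    intro x y hx hy
    have d := hasDerivAt_tsum_of_isPreconnected (g := fun z y => tm c α β z x y) (g' := fun z y => tm c α (β+1) z x y) (sm α (β+1)) (isOpen_Ioo (a := -s) (b := s)) isPreconnected_Ioo
      (fun z y _ => tm_dy c α β z x y) (fun z y hy => tm_le c α (β+1) z hs0.le hx.le (abs_lt.2 hy).le) (y₀ := y) (abs_lt.1 hy)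
      (smx α β x y hx.le hy.le) (abs_lt.1 hy)
    refine (hH.dy α β x y).unique (d.congr_of_eventuallyEq ?_)
    filter_upwards [nh y hy] with t ht using ih x t hx (abs_lt.2 ht)

lemma Ser.zero {H c s} (h : Ser H c s) (α β : ℕ) : H α β 0 0 = c α β * ((α.factorial : ℝ) * β.factorial) := by
  rw [h.hs α β 0 0 (by simpa using h.s0) (by simpa using h.s0), tsum_eq_single (α, β)]
  · simp [tm, Nat.descFactorial_self]
  · intro z hz
    unfold tm
    by_cases h1 : z.1 < α
    · simp [Nat.descFactorial_eq_zero_iff_lt.2 h1]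
    by_cases h2 : z.2 < β
    · simp [Nat.descFactorial_eq_zero_iff_lt.2 h2]
    have : z.1 - α ≠ 0 ∨ z.2 - β ≠ 0 := by
      by_contra hh
      push Not at hh
      exact hz (Prod.ext (by simp; omega) (by simp; omega))
    rcases this with h' | h' <;> simp [zero_pow h']

structure Nw (c : ℕ → ℕ → ℝ) (F : Finset (ℕ × ℕ)) : Prop where
  ne : F.Nonempty
  nz : ∀ m ∈ F, c m.1 m.2 ≠ 0
  anti : ∀ m ∈ F, ∀ m' ∈ F, m.1 ≤ m'.1 → m.2 ≤ m'.2 → m = m'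
  dom : ∀ p q, c p q ≠ 0 → ∃ m ∈ F, m.1 ≤ p ∧ m.2 ≤ q

lemma exF (c : ℕ → ℕ → ℝ) (hne : ∃ p q, c p q ≠ 0) : ∃ F, Nw c F := by
  set L : ℕ × ℕ → Prop := fun z => c z.1 z.2 ≠ 0 with hL
  have hfin : {z | Minimal L z}.Finite := 
    (setOfPred_minimal_antichain L).finite_of_partiallyWellOrderedOn (Set.isPWO_of_wellQuasiOrderedLE _)
  refine ⟨hfin.toFinset, ?_, ?_, ?_, ?_⟩
  · obtain ⟨p, q, h⟩ := hne
    obtain ⟨m, -, hm⟩ := exists_minimal_le_of_wellFoundedLT L (p,q) h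
    exact ⟨m, by simpa using hm⟩
  · intro m hm
    have : Minimal L m := by simpa using hm
    exact this.prop
  · intro m hm m' hm' h1 h2
    have a : Minimal L m := by simpa using hm
    have b : Minimal L m' := by simpa using hm'
    exact (b.eq_of_le a.prop ⟨h1, h2⟩)
  · intro p q h
    obtain ⟨m, h1, hm⟩ := exists_minimal_le_of_wellFoundedLT L (p,q) h
    exact ⟨m, by simpa using hm, h1.1, h1.2⟩

def MM (F : Finset (ℕ × ℕ)) (X Y : ℝ) : ℝ := ∑ m ∈ F, |X|^m.1 * |Y|^m.2

lemma MM_nonneg (F : Finset (ℕ × ℕ)) (X Y : ℝ) : 0 ≤ MM F X Y := Finset.sum_nonneg fun _ _ => by positivity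

lemma MM_ge {F : Finset (ℕ × ℕ)} {m} (hm : m ∈ F) (X Y : ℝ) : |X|^m.1 * |Y|^m.2 ≤ MM F X Y :=
  Finset.single_le_sum (f := fun m : ℕ × ℕ => |X|^m.1 * |Y|^m.2) (fun _ _ => by positivity) hm

lemma MM_pos {F : Finset (ℕ × ℕ)} (hF : F.Nonempty) {X Y : ℝ} (hX : X ≠ 0) (hY : Y ≠ 0) : 0 < MM F X Y :=
  Finset.sum_pos (fun _ _ => by positivity) hF

lemma aux_pow {a b : ℝ} (ha : 0 ≤ a) (ha1 : a ≤ 1) (hb : 0 ≤ b) (hb1 : b ≤ 1) {m z : ℕ × ℕ} (h1 : m.1 ≤ z.1) (h2 : m.2 ≤ z.2) (hne : m ≠ z) :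
    a^z.1 * b^z.2 ≤ a^m.1 * b^m.2 * (a+b) := by
  have : m.1 < z.1 ∨ m.2 < z.2 := by
    by_contra hh
    push Not at hh
    exact hne (Prod.ext (by omega) (by omega))
  rcases this with h | h
  · calc a^z.1 * b^z.2 ≤ a^(m.1+1) * b^m.2 := mul_le_mul (pow_le_pow_of_le_one ha ha1 h) (pow_le_pow_of_le_one hb hb1 h2) (by positivity) (by positivity)
      _ = a^m.1 * b^m.2 * a := by ring
      _ ≤ _ := by gcongr; linarith
  · calc a^z.1 * b^z.2 ≤ a^(m.1) * b^(m.2+1) := mul_le_mul (pow_le_pow_of_le_one ha ha1 h1) (pow_le_pow_of_le_one hb hb1 h) (by positivity) (by positivity)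
      _ = a^m.1 * b^m.2 * b := by ring
      _ ≤ _ := by gcongr; linarith

/-- main part of the rescaled derivative -/
def mp (c : ℕ → ℕ → ℝ) (F : Finset (ℕ × ℕ)) (α β : ℕ) (X Y u v : ℝ) : ℝ := ∑ m ∈ F, X^m.1 * Y^m.2 * tm c α β m u v

lemma expE {H c s F} (hS : Ser H c s) (hF : Nw c F) (α β : ℕ) : ∃ K, 0 ≤ K ∧ ∀ X Y, |X| < s → |Y| < s → ∀ u v, |u| ≤ 1 → |v| ≤ 1 →
    |X^α * Y^β * H α β (X*u) (Y*v) - mp c F α β X Y u v| ≤ K * ((|X|+|Y|) * MM F X Y) := by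
  classical
  have hs0 := hS.s0
  obtain ⟨D, hD⟩ : ∃ D : ℕ, ∀ m ∈ F, m.1 + m.2 ≤ D := ⟨F.sup (fun m => m.1+m.2), fun m hm => Finset.le_sup (f := fun m : ℕ × ℕ => m.1+m.2) hm⟩
  refine ⟨(∑' z, |tm c α β z s s|) * (s^(D+1))⁻¹, mul_nonneg (tsum_nonneg fun _ => abs_nonneg _) (by positivity), fun X Y hX hY u v hu hv => ?_⟩
  have hXu : |X*u| < s := by rw [abs_mul]; nlinarith [abs_nonneg X, abs_nonneg u]
  have hYv : |Y*v| < s := by rw [abs_mul]; nlinarith [abs_nonneg Y, abs_nonneg v]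
  have f1 : ∀ z, X^α * Y^β * tm c α β z (X*u) (Y*v) = X^z.1 * Y^z.2 * tm c α β z u v := by
    intro z
    unfold tm
    by_cases h1 : z.1 < α
    · simp [Nat.descFactorial_eq_zero_iff_lt.2 h1]
    by_cases h2 : z.2 < β
    · simp [Nat.descFactorial_eq_zero_iff_lt.2 h2]
    push Not at h1 h2
    obtain ⟨k, hk⟩ := Nat.exists_eq_add_of_le h1
    obtain ⟨l, hl⟩ := Nat.exists_eq_add_of_le h2
    rw [hk, hl, Nat.add_sub_cancel_left, Nat.add_sub_cancel_left]; ring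
  have hsum : HasSum (fun z => X^z.1 * Y^z.2 * tm c α β z u v) (X^α * Y^β * H α β (X*u) (Y*v)) := by
    rw [hS.hs α β _ _ hXu hYv]
    have : Summable (fun z => tm c α β z (X*u) (Y*v)) := Summable.of_norm_bounded (hS.sm α β) fun z => tm_le c α β z hs0.le hXu.le hYv.le
    have := this.hasSum.mul_left (X^α * Y^β)
    simpa only [f1] using this
  have hfin : HasSum (fun z => if z ∈ F then X^z.1 * Y^z.2 * tm c α β z u v else 0) (mp c F α β X Y u v) := by
    have := hasSum_sum_of_ne_finset_zero (L := SummationFilter.unconditional _) (f := fun z => if z ∈ F then X^z.1 * Y^z.2 * tm c α β z u v else 0) (s := F) (fun z hz => by simp [hz])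
    convert this using 1
    exact Finset.sum_congr rfl fun z hz => by simp [hz]
  have hb := ((hS.sm α β).hasSum.mul_right (s^(D+1))⁻¹).mul_right ((|X|+|Y|) * MM F X Y)
  have := (hsum.sub hfin).norm_le_of_bounded hb
  rw [Real.norm_eq_abs] at this
  refine this fun z => ?_
  have hM := MM_nonneg F X Y
  by_cases hz : z ∈ F
  · simp only [hz, if_true, sub_self, norm_zero]; positivity
  simp only [hz, if_false, sub_zero]
  by_cases hcz : c z.1 z.2 = 0
  · simp [tm, hcz]
  obtain ⟨m, hm, h1, h2⟩ := hF.dom _ _ hcz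
  have hne : m ≠ z := fun h => hz (h ▸ hm)
  have key : |X|^z.1 * |Y|^z.2 ≤ s^z.1 * s^z.2 * (s^(D+1))⁻¹ * ((|X|+|Y|) * MM F X Y) := by
    have a1 : |X|/s ≤ 1 := (div_le_one hs0).2 hX.le
    have a2 : |Y|/s ≤ 1 := (div_le_one hs0).2 hY.le
    have := aux_pow (by positivity) a1 (by positivity) a2 h1 h2 hne
    calc |X|^z.1 * |Y|^z.2 = s^z.1 * s^z.2 * ((|X|/s)^z.1 * (|Y|/s)^z.2) := by rw [div_pow, div_pow]; field_simp
      _ ≤ s^z.1 * s^z.2 * ((|X|/s)^m.1 * (|Y|/s)^m.2 * (|X|/s+|Y|/s)) := by gcongr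
      _ = s^z.1 * s^z.2 * (s^(m.1+m.2+1))⁻¹ * ((|X|+|Y|) * (|X|^m.1 * |Y|^m.2)) := by
        rw [div_pow, div_pow, pow_succ, pow_add]; field_simp
      _ ≤ _ := by
        have := MM_ge hm X Y
        have h3 : s^(D+1) ≤ s^(m.1+m.2+1) := pow_le_pow_of_le_one hs0.le hS.s1 (by have := hD m hm; omega)
        gcongr
  rw [Real.norm_eq_abs, abs_mul, abs_mul, abs_pow, abs_pow]
  have t1 : |tm c α β z u v| ≤ |c z.1 z.2 * ((z.1.descFactorial α : ℝ) * (z.2.descFactorial β : ℝ))| := by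
    unfold tm
    rw [abs_mul _ (_ * _)]
    refine mul_le_of_le_one_right (abs_nonneg _) ?_
    rw [abs_mul, abs_pow, abs_pow]
    exact mul_le_one₀ (pow_le_one₀ (abs_nonneg _) hu) (by positivity) (pow_le_one₀ (abs_nonneg _) hv)
  have t2 : |c z.1 z.2 * ((z.1.descFactorial α : ℝ) * (z.2.descFactorial β : ℝ))| * (s^z.1 * s^z.2) ≤ |tm c α β z s s| := by
    unfold tm
    rw [abs_mul _ (s^_ * s^_), abs_of_nonneg (by positivity : 0 ≤ s^(z.1-α) * s^(z.2-β))]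
    gcongr ?_ * (?_ * ?_)
    · exact pow_le_pow_of_le_one hs0.le hS.s1 (Nat.sub_le _ _)
    · exact pow_le_pow_of_le_one hs0.le hS.s1 (Nat.sub_le _ _)
  set Q := |c z.1 z.2 * ((z.1.descFactorial α : ℝ) * (z.2.descFactorial β : ℝ))| with hQ
  have hQ0 : 0 ≤ Q := abs_nonneg _
  calc |X|^z.1 * |Y|^z.2 * |tm c α β z u v| ≤ (s^z.1 * s^z.2 * (s^(D+1))⁻¹ * ((|X|+|Y|) * MM F X Y)) * Q := by gcongr
    _ = (Q * (s^z.1 * s^z.2)) * (s^(D+1))⁻¹ * ((|X|+|Y|) * MM F X Y) := by ring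
    _ ≤ _ := by gcongr

lemma ubE1 {H c s F} (hS : Ser H c s) (hF : Nw c F) (α β : ℕ) : ∃ B, 0 ≤ B ∧ ∀ X Y, |X| < s → |Y| < s → ∀ u v, |u| ≤ 1 → |v| ≤ 1 →
    |X^α * Y^β * H α β (X*u) (Y*v)| ≤ B * MM F X Y := by
  obtain ⟨K, hK, h⟩ := expE hS hF α β
  set T := ∑ m ∈ F, |tm c α β m 1 1| with hT
  have hT0 : 0 ≤ T := Finset.sum_nonneg fun _ _ => abs_nonneg _
  refine ⟨K*2+T, by positivity, fun X Y hX hY u v hu hv => ?_⟩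
  have h1 := h X Y hX hY u v hu hv
  have hM := MM_nonneg F X Y
  have h2 : |mp c F α β X Y u v| ≤ T * MM F X Y := by
    unfold mp
    refine (Finset.abs_sum_le_sum_abs _ _).trans ?_
    rw [hT, Finset.sum_mul]
    refine Finset.sum_le_sum fun m hm => ?_
    rw [abs_mul, abs_mul, abs_pow, abs_pow, mul_comm]
    exact mul_le_mul (tm_le c α β m zero_le_one hu hv) (MM_ge hm X Y) (by positivity) (abs_nonneg _)
  have h3 : K * ((|X|+|Y|) * MM F X Y) ≤ K * (2 * MM F X Y) := by
    have := hS.s1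
    gcongr; linarith
  have := abs_sub_abs_le_abs_sub (X^α * Y^β * H α β (X*u) (Y*v)) (mp c F α β X Y u v)
  linarith

lemma ubE {H c s F} (hS : Ser H c s) (hF : Nw c F) (n : ℕ) : ∃ B, 0 ≤ B ∧ ∀ α β, α ≤ n → β ≤ n → ∀ X Y, |X| < s → |Y| < s → ∀ u v, |u| ≤ 1 → |v| ≤ 1 →
    |X^α * Y^β * H α β (X*u) (Y*v)| ≤ B * MM F X Y := by
  choose B hB h using fun α β => ubE1 hS hF α β
  refine ⟨∑ α ∈ Finset.range (n+1), ∑ β ∈ Finset.range (n+1), B α β, Finset.sum_nonneg fun _ _ => Finset.sum_nonneg fun _ _ => hB _ _, ?_⟩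
  intro α β hα hβ X Y hX hY u v hu hv
  refine (h α β X Y hX hY u v hu hv).trans ?_
  have := MM_nonneg F X Y
  gcongr
  exact (Finset.single_le_sum (f := fun β => B α β) (fun _ _ => hB _ _) (Finset.mem_range.2 (by omega : β < n+1))).trans
    (Finset.single_le_sum (f := fun α => ∑ β ∈ Finset.range (n+1), B α β) (fun _ _ => Finset.sum_nonneg fun _ _ => hB _ _) (Finset.mem_range.2 (by omega : α < n+1)))

def nd (c : ℕ → ℕ → ℝ) : ℝ := sInf {t : ℝ | ((t, t) : ℝ × ℝ) ∈ convexHull ℝ {z : ℝ × ℝ | ∃ p q : ℕ, c p q ≠ 0 ∧ (p : ℝ) ≤ z.1 ∧ (q : ℝ) ≤ z.2}}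

lemma nd_lb {c F} (hF : Nw c F) {ξ ζ μ : ℝ} (hξ : 0 ≤ ξ) (hζ : 0 ≤ ζ) (h : ∀ m ∈ F, μ ≤ ξ * m.1 + ζ * m.2) : μ ≤ (ξ+ζ) * nd c := by
  set Q := {z : ℝ × ℝ | ∃ p q : ℕ, c p q ≠ 0 ∧ (p : ℝ) ≤ z.1 ∧ (q : ℝ) ≤ z.2} with hQ
  have hsub : convexHull ℝ Q ⊆ {z : ℝ × ℝ | μ ≤ ξ * z.1 + ζ * z.2} := by
    refine convexHull_min ?_ ?_
    · rintro z ⟨p, q, hc, h1, h2⟩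
      obtain ⟨m, hm, h3, h4⟩ := hF.dom p q hc
      have h3' : (m.1:ℝ) ≤ p := by exact_mod_cast h3
      have h4' : (m.2:ℝ) ≤ q := by exact_mod_cast h4
      refine (h m hm).trans ?_
      gcongr <;> linarith
    · have := convex_halfSpace_ge (𝕜 := ℝ) (f := fun z : ℝ × ℝ => ξ * z.1 + ζ * z.2) ⟨fun x y => by simp; ring, fun a x => by simp; ring⟩ μ
      exact this
  have hne : {t : ℝ | ((t, t) : ℝ × ℝ) ∈ convexHull ℝ Q}.Nonempty := by
    obtain ⟨m, hm⟩ := hF.ne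
    exact ⟨max m.1 m.2, subset_convexHull ℝ Q ⟨m.1, m.2, hF.nz m hm, le_max_left _ _, le_max_right _ _⟩⟩
  rcases (add_nonneg hξ hζ).eq_or_lt with h0 | h0
  · obtain ⟨t, ht⟩ := hne
    have := hsub ht
    simp only [Set.mem_ofPred_eq] at this
    have e : ξ * t + ζ * t = (ξ + ζ) * t := by ring
    rw [e, ← h0] at this
    rw [← h0]; linarith
  · have : μ / (ξ+ζ) ≤ nd c := by
      refine le_csInf hne fun t ht => ?_
      have := hsub ht
      simp only [Set.mem_ofPred_eq] at this
      rw [div_le_iff₀ h0]; linarith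
    rw [div_le_iff₀ h0] at this; linarith

lemma nd_nonneg {c F} (hF : Nw c F) : 0 ≤ nd c := by
  have := nd_lb hF (ξ := 1) (ζ := 1) (μ := 0) zero_le_one zero_le_one (fun m _ => by positivity)
  linarith

lemma MM_lb {c F} (hF : Nw c F) {X Y : ℝ} (hX : X ≠ 0) (hY : Y ≠ 0) (hX1 : |X| ≤ 1) (hY1 : |Y| ≤ 1) : (|X| * |Y|)^(nd c) ≤ MM F X Y := by
  have hx := abs_pos.2 hX
  have hy := abs_pos.2 hY
  set ξ := -Real.log |X| with hξ
  set ζ := -Real.log |Y| with hζ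
  have eX : |X| = Real.exp (-ξ) := by rw [hξ, neg_neg, Real.exp_log hx]
  have eY : |Y| = Real.exp (-ζ) := by rw [hζ, neg_neg, Real.exp_log hy]
  have hξ0 : 0 ≤ ξ := by rw [hξ]; linarith [Real.log_nonpos hx.le hX1]
  have hζ0 : 0 ≤ ζ := by rw [hζ]; linarith [Real.log_nonpos hy.le hY1]
  obtain ⟨m, hm, hmin⟩ := F.exists_min_image (fun m => ξ * m.1 + ζ * m.2) hF.ne
  have := nd_lb hF hξ0 hζ0 hmin
  refine le_trans ?_ (MM_ge hm X Y)
  rw [eX, eY, ← Real.exp_add, ← Real.exp_mul, ← Real.exp_nat_mul, ← Real.exp_nat_mul, ← Real.exp_add]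
  apply Real.exp_le_exp.2
  linarith

lemma poly_der {ι : Type*} (J : Finset ι) (e : ι → ℕ) (k : ι → ℝ) (hJ : J.Nonempty) (hk : ∀ m ∈ J, k m ≠ 0)
    (hinj : Set.InjOn e J) (p1 p2 : ℕ) (h1 : ∀ m ∈ J, p1 ≤ e m) (h2 : ∀ m ∈ J, e m ≤ p2) (u0 : ℝ) (hu : u0 ≠ 0)
    (h0 : ∑ m ∈ J, k m * u0^(e m) = 0) : ∃ a, 1 ≤ a ∧ a ≤ p2 - p1 ∧ ∑ m ∈ J, k m * ((e m).descFactorial a * u0^(e m - a)) ≠ 0 := by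
  classical
  open Polynomial in
  set f : ℝ[X] := ∑ m ∈ J, C (k m) * X^(e m) with hf
  set g : ℝ[X] := ∑ m ∈ J, C (k m) * X^(e m - p1) with hg
  have hfg : f = X^p1 * g := by
    rw [hf, hg, Finset.mul_sum]
    refine Finset.sum_congr rfl fun m hm => ?_
    rw [mul_left_comm, ← pow_add, Nat.add_sub_cancel' (h1 m hm)]
  have hf0 : f ≠ 0 := by
    obtain ⟨m0, hm0⟩ := hJ
    intro hz
    have : f.coeff (e m0) = k m0 := by
      rw [hf, Polynomial.finsetSum_coeff, Finset.sum_eq_single m0]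
      · simp
      · intro m hm hne
        have : e m0 ≠ e m := fun h => hne (hinj hm hm0 h.symm)
        simp [Polynomial.coeff_X_pow, this]
      · exact fun h => absurd hm0 h
    rw [hz, Polynomial.coeff_zero] at this
    exact hk m0 hm0 this.symm
  have hder : ∀ a, (derivative^[a] f).eval u0 = ∑ m ∈ J, k m * ((e m).descFactorial a * u0^(e m - a)) := by
    intro a
    rw [hf, Polynomial.iterate_derivative_sum, Polynomial.eval_finsetSum]
    refine Finset.sum_congr rfl fun m hm => ?_
    rw [Polynomial.iterate_derivative_C_mul, Polynomial.iterate_derivative_X_pow_eq_natCast_mul]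
    simp
  by_contra hcon
  push Not at hcon
  have hlt : p2 - p1 < f.rootMultiplicity u0 := by
    refine (Polynomial.lt_rootMultiplicity_iff_isRoot_iterate_derivative hf0).2 fun a ha => ?_
    rw [Polynomial.IsRoot, hder]
    rcases Nat.eq_zero_or_pos a with rfl | h
    · simpa using h0
    · exact hcon a h ha
  have hdvd : (X - C u0)^(p2-p1+1) ∣ f := (pow_dvd_pow _ hlt).trans (Polynomial.pow_rootMultiplicity_dvd f u0)
  rw [hfg] at hdvd
  have hco : IsCoprime (X - C u0) (X : ℝ[X]) := by
    have := Polynomial.isCoprime_X_sub_C_of_isUnit_sub (R := ℝ) (a := u0) (b := 0) (by simpa using hu)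
    simpa using this
  have hdvd2 := (hco.pow).dvd_of_dvd_mul_left hdvd
  have hg0 : g ≠ 0 := fun h => hf0 (by rw [hfg, h, mul_zero])
  have hdeg := Polynomial.natDegree_le_of_dvd hdvd2 hg0
  rw [Polynomial.natDegree_pow, Polynomial.natDegree_X_sub_C] at hdeg
  have : g.natDegree ≤ p2 - p1 := by
    refine Polynomial.natDegree_sum_le_of_forall_le _ _ fun m hm => ?_
    refine (Polynomial.natDegree_C_mul_X_pow_le _ _).trans ?_
    have := h2 m hm; omega
  omega

def okk (d : ℝ) (a b : ℕ) : Prop := (a = 0 ∧ b = 0) ∨ (1 ≤ a ∧ 1 ≤ b ∧ (a:ℝ)*b < d*(a+b))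

lemma LBalg {c F} (hF : Nw c F) (hno : ∀ a b : ℕ, 1 ≤ a → 1 ≤ b → c a 0 ≠ 0 → c 0 b ≠ 0 → nd c * (a+b) < (a:ℝ)*b)
    (w : ℕ × ℕ → ℝ) (hw : ∃ m ∈ F, w m ≠ 0) {u0 v0 : ℝ} (hu : u0 ≠ 0) (hv : v0 ≠ 0)
    (hline : ∀ m1 ∈ F, w m1 ≠ 0 → ∀ m2 ∈ F, w m2 ≠ 0 → m1.1 < m2.1 → m2.2 < m1.2 → ∀ m ∈ F,
      0 ≤ ((m1.2:ℝ) - m2.2) * ((m.1:ℝ) - m1.1) + ((m2.1:ℝ) - m1.1) * ((m.2:ℝ) - m1.2)) :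
    ∃ a b, a ≤ F.sup Prod.fst + F.sup Prod.snd ∧ b ≤ F.sup Prod.fst + F.sup Prod.snd ∧ okk (nd c) a b ∧ 
      ∑ m ∈ F, w m * tm c a 0 m u0 v0 ≠ 0 ∧ ∑ m ∈ F, w m * tm c 0 b m u0 v0 ≠ 0 := by
  classical
  by_cases h00 : ∑ m ∈ F, w m * tm c 0 0 m u0 v0 = 0
  swap
  · exact ⟨0, 0, by simp, by simp, Or.inl ⟨rfl, rfl⟩, h00, h00⟩
  set J := F.filter (fun m => w m ≠ 0) with hJ
  have hJF : ∀ m ∈ J, m ∈ F ∧ w m ≠ 0 := fun m hm => Finset.mem_filter.1 hm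
  have hJne : J.Nonempty := by obtain ⟨m, h1, h2⟩ := hw; exact ⟨m, Finset.mem_filter.2 ⟨h1, h2⟩⟩
  have sumJ : ∀ t : ℕ × ℕ → ℝ, ∑ m ∈ F, w m * t m = ∑ m ∈ J, w m * t m := by
    intro t
    rw [hJ, Finset.sum_filter]
    refine Finset.sum_congr rfl fun m _ => ?_
    by_cases h : w m = 0 <;> simp [h]
  have anti := hF.anti
  obtain ⟨m1, hm1, hmin⟩ := J.exists_min_image Prod.fst hJne
  obtain ⟨m2, hm2, hmax⟩ := J.exists_max_image Prod.fst hJne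
  have hq1 : ∀ m ∈ J, m.2 ≤ m1.2 := fun m hm => by
    by_contra hlt
    have := anti m1 (hJF _ hm1).1 m (hJF _ hm).1 (hmin m hm) (by omega)
    rw [this] at hlt; omega
  have hq2 : ∀ m ∈ J, m2.2 ≤ m.2 := fun m hm => by
    by_contra hlt
    have := anti m (hJF _ hm).1 m2 (hJF _ hm2).1 (hmax m hm) (by omega)
    rw [this] at hlt; omega
  rw [sumJ] at h00
  obtain ⟨a, ha1, ha2, ha⟩ := poly_der J Prod.fst (fun m => w m * c m.1 m.2 * v0^m.2) hJne 
    (fun m hm => mul_ne_zero (mul_ne_zero (hJF m hm).2 (hF.nz m (hJF m hm).1)) (pow_ne_zero _ hv))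
    (fun m hm m' hm' h => by
      have h1 := (hJF _ hm).1
      have h2 := (hJF _ hm').1
      rcases le_total m.2 m'.2 with h' | h'
      · exact anti m h1 m' h2 h.le h'
      · exact (anti m' h2 m h1 h.ge h').symm) m1.1 m2.1 hmin hmax u0 hu (by
      rw [← h00]; refine Finset.sum_congr rfl fun m _ => ?_
      simp [tm]; ring)
  obtain ⟨b, hb1, hb2, hb⟩ := poly_der J Prod.snd (fun m => w m * c m.1 m.2 * u0^m.1) hJne 
    (fun m hm => mul_ne_zero (mul_ne_zero (hJF m hm).2 (hF.nz m (hJF m hm).1)) (pow_ne_zero _ hu))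
    (fun m hm m' hm' h => by
      have h1 := (hJF _ hm).1
      have h2 := (hJF _ hm').1
      rcases le_total m.1 m'.1 with h' | h'
      · exact anti m h1 m' h2 h' h.le
      · exact (anti m' h2 m h1 h' h.ge).symm) m2.2 m1.2 hq2 hq1 v0 hv (by
      rw [← h00]; refine Finset.sum_congr rfl fun m _ => ?_
      simp [tm]; ring)
  have s1 : m2.1 ≤ F.sup Prod.fst := Finset.le_sup (f := Prod.fst) (hJF _ hm2).1
  have s2 : m1.2 ≤ F.sup Prod.snd := Finset.le_sup (f := Prod.snd) (hJF _ hm1).1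
  refine ⟨a, b, by omega, by omega, Or.inr ⟨ha1, hb1, ?_⟩, ?_, ?_⟩
  · have hl := hline m1 (hJF _ hm1).1 (hJF _ hm1).2 m2 (hJF _ hm2).1 (hJF _ hm2).2 (by omega) (by omega)
    obtain ⟨B', hB'⟩ := Nat.exists_eq_add_of_le (show m1.1 ≤ m2.1 by omega)
    obtain ⟨A', hA'⟩ := Nat.exists_eq_add_of_le (show m2.2 ≤ m1.2 by omega)
    have eB : ((m2.1:ℝ) - m1.1) = B' := by rw [hB']; push_cast; ring
    have eA : ((m1.2:ℝ) - m2.2) = A' := by rw [hA']; push_cast; ring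
    rw [eB, eA] at hl
    have hnd := nd_lb hF (ξ := A') (ζ := B') (μ := A' * m1.1 + B' * m1.2) (by positivity) (by positivity) (fun m hm => by
      have := hl m hm; linarith)
    have eq1 : (m1.2:ℝ) = m2.2 + A' := by rw [hA']; push_cast; ring
    rw [eq1] at hnd
    have haB : (a:ℝ) ≤ B' := by exact_mod_cast (by omega : a ≤ B')
    have hbA : (b:ℝ) ≤ A' := by exact_mod_cast (by omega : b ≤ A')
    have ha0 : (1:ℝ) ≤ a := by exact_mod_cast ha1
    have hb0 : (1:ℝ) ≤ b := by exact_mod_cast hb1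
    have hstrict : (A':ℝ) * B' < (A'+B') * nd c := by
      by_cases hz : m1.1 = 0 ∧ m2.2 = 0
      · exfalso
        have := hno m2.1 m1.2 (by omega) (by omega) (by have := hF.nz m2 (hJF _ hm2).1; rwa [hz.2] at this) 
          (by have := hF.nz m1 (hJF _ hm1).1; rwa [hz.1] at this)
        rw [hB', hA', hz.1, hz.2] at this
        rw [hz.1, hz.2] at hnd
        push_cast at this hnd
        nlinarith
      · have : (1:ℝ) ≤ m1.1 + m2.2 := by exact_mod_cast (by omega : 1 ≤ m1.1 + m2.2)
        have h1 : (0:ℝ) ≤ m1.1 := by positivity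
        have h2 : (0:ℝ) ≤ m2.2 := by positivity
        nlinarith
    by_contra hcon
    push Not at hcon
    have k1 : (a:ℝ)*b*(A'+B') ≤ A'*B'*(a+b) := by
      have : (a:ℝ)*b*A' ≤ B'*b*A' := by gcongr
      have : (a:ℝ)*b*B' ≤ a*A'*B' := by gcongr
      linarith
    have k2 : nd c * (a+b) * (A'+B') ≤ (a:ℝ)*b*(A'+B') := by gcongr
    have k3 : (A':ℝ) * B' * (a+b) < (A'+B') * nd c * (a+b) := by gcongr
    linarith
  · rw [sumJ]; convert ha using 1; refine Finset.sum_congr rfl fun m _ => ?_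
    simp [tm]; ring
  · rw [sumJ]; convert hb using 1; refine Finset.sum_congr rfl fun m _ => ?_
    simp [tm]; ring

lemma line_aux {p1 q1 p2 q2 x y : ℝ} {A' B' k : ℝ} (hA : A' = q1 - q2) (hB : B' = p2 - p1) (hA0 : 0 < A') (hk : 0 ≤ k)
    (h : ∀ T : ℝ, ∃ ξ ζ L : ℝ, T < ξ ∧ -k ≤ -(ξ*p1+ζ*q1) - L ∧ -k ≤ -(ξ*p2+ζ*q2) - L ∧ -(ξ*p1+ζ*q1) - L ≤ 0 ∧ 
      -(ξ*p2+ζ*q2) - L ≤ 0 ∧ -(ξ*x+ζ*y) - L ≤ 0) : 0 ≤ A' * (x - p1) + B' * (y - q1) := by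
  by_contra hcon
  push Not at hcon
  set E := A' * (x - p1) + B' * (y - q1) with hE
  obtain ⟨ξ, ζ, L, hT, h1, h2, h3, h4, h5⟩ := h (k * (A' + |y-q1|) / (-E))
  rw [div_lt_iff₀ (by linarith)] at hT
  have e1 : -k ≤ ξ*(x-p1) + ζ*(y-q1) := by linarith
  have e2 : |ζ*A' - ξ*B'| ≤ k := by rw [abs_le, hA, hB]; constructor <;> linarith
  have e3 : (ζ*A' - ξ*B') * (y-q1) ≤ k * |y-q1| := by
    calc _ ≤ |(ζ*A' - ξ*B') * (y-q1)| := le_abs_self _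
      _ = |ζ*A' - ξ*B'| * |y-q1| := abs_mul _ _
      _ ≤ _ := by gcongr
  have e4 : -k * A' ≤ (ξ*(x-p1) + ζ*(y-q1)) * A' := by gcongr
  have : ξ * E = (ξ*(x-p1) + ζ*(y-q1)) * A' - (ζ*A' - ξ*B') * (y-q1) := by rw [hE]; ring
  nlinarith

lemma LB {H c s F} (hS : Ser H c s) (hF : Nw c F) (hno : ∀ a b : ℕ, 1 ≤ a → 1 ≤ b → c a 0 ≠ 0 → c 0 b ≠ 0 → nd c * (a+b) < (a:ℝ)*b) :
    ∃ (N0 : ℕ) (c0 η0 : ℝ), 0 < c0 ∧ 0 < η0 ∧ η0 < s ∧ ∀ X Y, X ≠ 0 → Y ≠ 0 → |X| ≤ η0 → |Y| ≤ η0 → ∀ u ∈ Set.Icc (1/2:ℝ) 1, ∀ v ∈ Set.Icc (1/2:ℝ) 1,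
      ∃ a b, a ≤ N0 ∧ b ≤ N0 ∧ okk (nd c) a b ∧ c0 * MM F X Y ≤ |X^a * H a 0 (X*u) (Y*v)| ∧ c0 * MM F X Y ≤ |Y^b * H 0 b (X*u) (Y*v)| := by
  classical
  have hs0 := hS.s0
  refine ⟨F.sup Prod.fst + F.sup Prod.snd, ?_⟩
  by_contra hcon
  push Not at hcon
  have hcon' := fun n : ℕ => hcon (1/((n:ℝ)+1)) (min (s/2) (1/((n:ℝ)+1))) (by positivity) (by positivity) (lt_of_le_of_lt (min_le_left _ _) (by linarith))
  choose X Y hX hY hXs hYs u hu v hv hh using hcon'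
  have hM : ∀ n, 0 < MM F (X n) (Y n) := fun n => MM_pos hF.ne (hX n) (hY n)
  set w : ℕ → ℕ × ℕ → ℝ := fun n m => X n ^ m.1 * Y n ^ m.2 / MM F (X n) (Y n) with hw
  have aw : ∀ n m, |w n m| = |X n|^m.1 * |Y n|^m.2 / MM F (X n) (Y n) := fun n m => by
    rw [hw]; simp only; rw [abs_div, abs_mul, abs_pow, abs_pow, abs_of_pos (hM n)]
  have aw1 : ∀ n, ∀ m ∈ F, |w n m| ≤ 1 := fun n m hm => by
    rw [aw, div_le_one (hM n)]; exact MM_ge hm _ _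
  have sw : ∀ n, ∑ m ∈ F, |w n m| = 1 := fun n => by
    simp only [aw]; rw [← Finset.sum_div]; exact div_self (hM n).ne'
  have hcomp : IsCompact ((Set.univ.pi fun _ : F => Set.Icc (-1:ℝ) 1) ×ˢ (Set.Icc (1/2:ℝ) 1 ×ˢ Set.Icc (1/2:ℝ) 1)) :=
    (isCompact_univ_pi fun _ => isCompact_Icc).prod (isCompact_Icc.prod isCompact_Icc)
  obtain ⟨z, hz, φ, hφ, hlim⟩ := hcomp.tendsto_subseq (x := fun n => ((fun m : F => w n m), (u n, v n))) (fun n => 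
    ⟨fun m _ => abs_le.1 (aw1 n m m.2), hu n, hv n⟩)
  have lu : Filter.Tendsto (fun n => u (φ n)) Filter.atTop (nhds z.2.1) := (continuous_fst.comp continuous_snd).continuousAt.tendsto.comp hlim
  have lv : Filter.Tendsto (fun n => v (φ n)) Filter.atTop (nhds z.2.2) := (continuous_snd.comp continuous_snd).continuousAt.tendsto.comp hlim
  set w0 : ℕ × ℕ → ℝ := fun m => if h : m ∈ F then z.1 ⟨m, h⟩ else 0 with hw0
  have lw : ∀ m ∈ F, Filter.Tendsto (fun n => w (φ n) m) Filter.atTop (nhds (w0 m)) := by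
    intro m hm
    have : w0 m = z.1 ⟨m, hm⟩ := by rw [hw0]; simp [hm]
    rw [this]
    exact ((continuous_apply (⟨m, hm⟩ : F)).comp continuous_fst).continuousAt.tendsto.comp hlim
  have l0 : Filter.Tendsto (fun n => 1/(((φ n : ℕ):ℝ)+1)) Filter.atTop (nhds 0) := 
    tendsto_one_div_add_atTop_nhds_zero_nat.comp hφ.tendsto_atTop
  have lX : ∀ n, |X n| ≤ 1/((n:ℝ)+1) := fun n => (hXs n).trans (min_le_right _ _)
  have lY : ∀ n, |Y n| ≤ 1/((n:ℝ)+1) := fun n => (hYs n).trans (min_le_right _ _)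
  have hex : ∃ m ∈ F, w0 m ≠ 0 := by
    by_contra hall
    push Not at hall
    have : Filter.Tendsto (fun n => ∑ m ∈ F, |w (φ n) m|) Filter.atTop (nhds (∑ m ∈ F, |w0 m|)) := 
      tendsto_finsetSum _ fun m hm => (lw m hm).abs
    simp only [sw] at this
    have e := tendsto_nhds_unique this tendsto_const_nhds
    rw [Finset.sum_eq_zero (fun m hm => by rw [hall m hm, abs_zero])] at e
    exact zero_ne_one e
  have hu0 : z.2.1 ≠ 0 := by have := hz.2.1.1; intro h; rw [h] at this; norm_num at this
  have hv0 : z.2.2 ≠ 0 := by have := hz.2.2.1; intro h; rw [h] at this; norm_num at this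
  obtain ⟨a, b, ha, hb, hok, hDa, hDb⟩ := LBalg hF hno w0 hex hu0 hv0 (by
    intro m1 hm1 hn1 m2 hm2 hn2 h12 h21 m hm
    obtain ⟨κ, hκ0, hκ1, hκ⟩ : ∃ κ : ℝ, 0 < κ ∧ κ ≤ 1 ∧ ∀ᶠ n in Filter.atTop, κ ≤ |w (φ n) m1| ∧ κ ≤ |w (φ n) m2| := by
      have p1 := abs_pos.2 hn1
      have p2 := abs_pos.2 hn2
      refine ⟨min 1 (min (|w0 m1|/2) (|w0 m2|/2)), by positivity, min_le_left _ _, ?_⟩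
      filter_upwards [(lw m1 hm1).abs.eventually_const_lt (half_lt_self p1), (lw m2 hm2).abs.eventually_const_lt (half_lt_self p2)] with n h1 h2
      exact ⟨((min_le_right _ _).trans (min_le_left _ _)).trans h1.le, ((min_le_right _ _).trans (min_le_right _ _)).trans h2.le⟩
    have h21' : (m2.2:ℝ) < m1.2 := by exact_mod_cast h21
    refine line_aux (k := -Real.log κ) (p2 := m2.1) (q2 := m2.2) rfl rfl (by linarith) (by linarith [Real.log_nonpos hκ0.le hκ1]) fun T => ?_
    have lT : Filter.Tendsto (fun n => Real.log ((φ n : ℕ) + 1 : ℝ)) Filter.atTop Filter.atTop := 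
      Real.tendsto_log_atTop.comp (Filter.tendsto_atTop_add_const_right _ _ (tendsto_natCast_atTop_atTop.comp hφ.tendsto_atTop))
    obtain ⟨n, ⟨h1, h2⟩, h3⟩ := (hκ.and (lT.eventually_gt_atTop T)).exists
    have hx := abs_pos.2 (hX (φ n))
    have hy := abs_pos.2 (hY (φ n))
    have lg : ∀ m, Real.log |w (φ n) m| = -(-Real.log |X (φ n)| * m.1 + -Real.log |Y (φ n)| * m.2) - Real.log (MM F (X (φ n)) (Y (φ n))) := by
      intro m
      rw [aw, Real.log_div (by positivity) (hM _).ne', Real.log_mul (by positivity) (by positivity), Real.log_pow, Real.log_pow]; ring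
    refine ⟨-Real.log |X (φ n)|, -Real.log |Y (φ n)|, Real.log (MM F (X (φ n)) (Y (φ n))), ?_, ?_, ?_, ?_, ?_, ?_⟩
    · refine h3.trans_le ?_
      have := Real.log_le_log hx (lX (φ n))
      rw [one_div, Real.log_inv] at this
      linarith
    · rw [← lg, neg_neg]; exact Real.log_le_log hκ0 h1
    · rw [← lg, neg_neg]; exact Real.log_le_log hκ0 h2
    · rw [← lg]; exact Real.log_nonpos (abs_nonneg _) (aw1 _ _ hm1)
    · rw [← lg]; exact Real.log_nonpos (abs_nonneg _) (aw1 _ _ hm2)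
    · rw [← lg]; exact Real.log_nonpos (abs_nonneg _) (aw1 _ _ hm))
  have lim : ∀ α β, Filter.Tendsto (fun n => X (φ n)^α * Y (φ n)^β * H α β (X (φ n) * u (φ n)) (Y (φ n) * v (φ n)) / MM F (X (φ n)) (Y (φ n)))
      Filter.atTop (nhds (∑ m ∈ F, w0 m * tm c α β m z.2.1 z.2.2)) := by
    intro α β
    obtain ⟨K, hK, hE⟩ := expE hS hF α β
    have t1 : Filter.Tendsto (fun n => ∑ m ∈ F, w (φ n) m * tm c α β m (u (φ n)) (v (φ n))) Filter.atTop (nhds (∑ m ∈ F, w0 m * tm c α β m z.2.1 z.2.2)) := by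
      refine tendsto_finsetSum _ fun m hm => (lw m hm).mul ?_
      unfold tm
      exact ((lu.pow _).mul (lv.pow _)).const_mul _
    have t2 : Filter.Tendsto (fun n => K * (1/(((φ n : ℕ):ℝ)+1) + 1/(((φ n : ℕ):ℝ)+1))) Filter.atTop (nhds 0) := by
      have := (l0.add l0).const_mul K
      simpa using this
    refine tendsto_of_tendsto_of_dist t1 (squeeze_zero (fun _ => dist_nonneg) (fun n => ?_) t2)
    set N := φ n
    have hE1 := hE (X N) (Y N) (lt_of_le_of_lt ((hXs N).trans (min_le_left _ _)) (by linarith)) (lt_of_le_of_lt ((hYs N).trans (min_le_left _ _)) (by linarith))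
      (u N) (v N) (abs_le.2 ⟨by linarith [(hu N).1], (hu N).2⟩) (abs_le.2 ⟨by linarith [(hv N).1], (hv N).2⟩)
    rw [dist_comm, Real.dist_eq]
    have e : ∑ m ∈ F, w N m * tm c α β m (u N) (v N) = mp c F α β (X N) (Y N) (u N) (v N) / MM F (X N) (Y N) := by
      unfold mp; rw [Finset.sum_div]
      refine Finset.sum_congr rfl fun m _ => ?_
      rw [hw]; simp only; ring
    rw [e, ← sub_div, abs_div, abs_of_pos (hM N), div_le_iff₀ (hM N)]
    refine hE1.trans ?_
    rw [← mul_assoc]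
    have := (hM N).le
    gcongr
    · exact lX N
    · exact lY N
  have la := (lim a 0).abs
  have lb := (lim 0 b).abs
  have hev : ∀ r : ℝ, 0 < r → ∀ f : ℕ → ℝ, Filter.Tendsto f Filter.atTop (nhds r) → ∀ᶠ n in Filter.atTop, 1/(((φ n : ℕ):ℝ)+1) ≤ f n := by
    intro r hr f hf
    filter_upwards [hf.eventually_const_lt (half_lt_self hr), l0.eventually_lt_const (half_pos hr)] with n h1 h2
    linarith
  obtain ⟨n, h1, h2⟩ := ((hev _ (abs_pos.2 hDa) _ la).and (hev _ (abs_pos.2 hDb) _ lb)).exists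
  rw [abs_div, abs_of_pos (hM _), le_div_iff₀ (hM _)] at h1 h2
  simp only [pow_zero, mul_one, one_mul] at h1 h2
  exact absurd h2 (not_le.2 (hh (φ n) a b ha hb hok h1))

lemma fin_min {ι : Type*} [DecidableEq ι] (s : Finset ι) (f : ι → ℝ) (θ0 : ℝ) (h : ∀ i ∈ s, θ0 < f i) : ∃ θ > θ0, ∀ i ∈ s, θ ≤ f i := by
  induction s using Finset.induction_on with
  | empty => exact ⟨θ0+1, by linarith, by simp⟩
  | insert i s hi ih =>
    obtain ⟨θ, h1, h2⟩ := ih fun j hj => h j (Finset.mem_insert_of_mem hj)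
    refine ⟨min θ (f i), lt_min h1 (h i (Finset.mem_insert_self _ _)), ?_⟩
    intro j hj
    rcases Finset.mem_insert.1 hj with rfl | hj
    · exact min_le_right _ _
    · exact (min_le_left _ _).trans (h2 j hj)

lemma min_mono {T θ θ' : ℝ} (hT : 0 < T) (hθ : 0 ≤ θ) (h : θ ≤ θ') : min 1 (T^(-θ')) ≤ min 1 (T^(-θ)) := by
  rcases le_total 1 T with h1 | h1
  · exact min_le_min le_rfl (Real.rpow_le_rpow_of_exponent_le h1 (by linarith))
  · have : 1 ≤ T^(-θ) := Real.one_le_rpow_of_pos_of_le_one_of_nonpos hT h1 (by linarith)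
    rw [min_eq_left this]; exact min_le_left _ _

lemma lemU1 {d : ℝ} (hd : 0 < d) (a b : ℕ) (hab : okk d a b) : ∃ θ > 1/(2*(1+d)), ∀ B c A0 : ℝ, 0 < c → 0 ≤ B → ∃ C ≥ (0:ℝ), 
    ∀ G, Fam G → (∀ α β, 1 ≤ α → α ≤ a+2 → 1 ≤ β → β ≤ 2*b+1 → ∀ x ∈ Set.Icc (0:ℝ) 1, ∀ y ∈ Set.Icc (0:ℝ) 1, |G α β x y| ≤ B) →
    (∀ x ∈ Set.Icc (0:ℝ) 1, ∀ y ∈ Set.Icc (0:ℝ) 1, c ≤ |G (a+1) 1 x y|) →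
    (∀ x ∈ Set.Icc (0:ℝ) 1, ∀ y ∈ Set.Icc (0:ℝ) 1, c ≤ |G 1 (b+1) x y|) → ∀ A A1, Amp A A1 A0 → ∀ lam : ℝ, lam ≠ 0 → 
    Bd (bx lam (G 0 0) A (Set.Ico 0 1 ×ˢ Set.Ico 0 1)) (C * min 1 (|lam|^(-θ))) := by
  rcases hab with ⟨rfl, rfl⟩ | ⟨ha, hb, hab⟩
  · set σ := (1 + 1/(1+d))/2 with hσ
    have h1 : 1/(1+d) < 1 := by rw [div_lt_one (by linarith)]; linarith
    have h2 : 0 < 1/(1+d) := by positivity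
    refine ⟨σ/2, ?_, ?_⟩
    · have : 1/(2*(1+d)) = (1/(1+d))/2 := by field_simp
      rw [this]; linarith
    · intro B c A0 hc hB
      obtain ⟨C, hC, h⟩ := lemA0 B c A0 σ hc hB (by linarith) (by linarith)
      refine ⟨C, hC, ?_⟩
      intro G hG hub hla hlb A A1 hA lam hl
      exact h G hG hla (hub 2 1 (by norm_num) (by norm_num) le_rfl (by norm_num)) A A1 hA lam hl
  · have ha' : (1:ℝ) ≤ a := by exact_mod_cast ha
    have hb' : (1:ℝ) ≤ b := by exact_mod_cast hb
    refine ⟨((a:ℝ)+b)/(2*((a:ℝ)+b+a*b)), ?_, ?_⟩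
    · rw [gt_iff_lt, div_lt_div_iff₀ (by positivity) (by positivity)]
      nlinarith
    · intro B c A0 hc hB
      obtain ⟨C, hC, h⟩ := lemA a b ha hb B c A0 hc hB
      refine ⟨C, hC, ?_⟩
      intro G hG hub hla hlb A A1 hA lam hl
      exact h G ⟨hG, fun α β h1 h2 => hub α β h1 (by omega), hla, hlb⟩ A A1 hA lam hl

lemma lemU {d : ℝ} (hd : 0 < d) (N0 : ℕ) : ∃ θ > 1/(2*(1+d)), ∀ B c A0 : ℝ, 0 < c → 0 ≤ B → ∃ C ≥ (0:ℝ), 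
    ∀ a b, a ≤ N0 → b ≤ N0 → okk d a b → 
    ∀ G, Fam G → (∀ α β, 1 ≤ α → α ≤ a+2 → 1 ≤ β → β ≤ 2*b+1 → ∀ x ∈ Set.Icc (0:ℝ) 1, ∀ y ∈ Set.Icc (0:ℝ) 1, |G α β x y| ≤ B) →
    (∀ x ∈ Set.Icc (0:ℝ) 1, ∀ y ∈ Set.Icc (0:ℝ) 1, c ≤ |G (a+1) 1 x y|) →
    (∀ x ∈ Set.Icc (0:ℝ) 1, ∀ y ∈ Set.Icc (0:ℝ) 1, c ≤ |G 1 (b+1) x y|) → ∀ A A1, Amp A A1 A0 → ∀ lam : ℝ, lam ≠ 0 → 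
    Bd (bx lam (G 0 0) A (Set.Ico 0 1 ×ˢ Set.Ico 0 1)) (C * min 1 (|lam|^(-θ))) := by
  classical
  choose! T hT hT2 using fun (m : ℕ × ℕ) (h : okk d m.1 m.2) => lemU1 hd m.1 m.2 h
  set s := (Finset.range (N0+1) ×ˢ Finset.range (N0+1)).filter (fun m => okk d m.1 m.2) with hs
  obtain ⟨θ, hθ, hθ2⟩ := fin_min s T (1/(2*(1+d))) (fun m hm => hT m (Finset.mem_filter.1 hm).2)
  have hθ0 : 0 ≤ θ := le_trans (by positivity) hθ.le
  refine ⟨θ, hθ, ?_⟩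
  intro B c A0 hc hB
  choose! C hC0 hC using fun (m : ℕ × ℕ) (h : okk d m.1 m.2) => hT2 m h B c A0 hc hB
  refine ⟨∑ m ∈ s, C m, Finset.sum_nonneg fun m hm => hC0 m (Finset.mem_filter.1 hm).2, ?_⟩
  intro a b ha hb hab G hG h1 h2 h3 A A1 hA lam hl
  have hm : (a, b) ∈ s := by simp [hs, hab]; omega
  refine (hC (a,b) hab G hG h1 h2 h3 A A1 hA lam hl).mono ?_
  have hlam := abs_pos.2 hl
  apply mul_le_mul
  · exact Finset.single_le_sum (f := C) (fun m hm => hC0 m (Finset.mem_filter.1 hm).2) hm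
  · exact min_mono hlam hθ0 (hθ2 _ hm)
  · positivity
  · exact Finset.sum_nonneg fun m hm => hC0 m (Finset.mem_filter.1 hm).2

def sqr (x0 p y0 q : ℝ) : Set (ℝ × ℝ) := {z | (z.1 - x0)/p ∈ Set.Ico (0:ℝ) 1 ∧ (z.2 - y0)/q ∈ Set.Ico (0:ℝ) 1}

lemma sqr_meas (x0 p y0 q : ℝ) : MeasurableSet (sqr x0 p y0 q) := by
  have h1 : Measurable (fun z : ℝ × ℝ => (z.1 - x0)/p) := by fun_prop
  have h2 : Measurable (fun z : ℝ × ℝ => (z.2 - y0)/q) := by fun_prop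
  exact (h1 measurableSet_Ico).inter (h2 measurableSet_Ico)

lemma sqr_sub1 {x0 p x : ℝ} (hp : p ≠ 0) (h : (x - x0)/p ∈ Set.Ico (0:ℝ) 1) : |x| ≤ |x0| + |p| := by
  have e : x = x0 + p * ((x-x0)/p) := by field_simp; ring
  have h1 : |(x-x0)/p| ≤ 1 := abs_le.2 ⟨by linarith [h.1], h.2.le⟩
  calc |x| = |x0 + p * ((x-x0)/p)| := by rw [← e]
    _ ≤ |x0| + |p| * |(x-x0)/p| := by rw [← abs_mul]; exact abs_add_le _ _
    _ ≤ _ := by nlinarith [abs_nonneg p]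

lemma sqr_ker {lam : ℝ} {G} (hG : Fam G) {A A1 : ℝ → ℝ → ℂ} {A0 : ℝ} (hA : Amp A A1 A0) {x0 p y0 q : ℝ} (hp : p ≠ 0) (hq : q ≠ 0) :
    Ker (bx lam (G 0 0) A (sqr x0 p y0 q)) := by
  refine bx_ker (R := |x0| + |p| + |y0| + |q|) (sqr_meas _ _ _ _) (by positivity) ?_ (hG.c 0 0) hA.c hA.b
  rintro ⟨x, y⟩ ⟨h1, h2⟩
  have e1 := sqr_sub1 hp h1
  have e2 := sqr_sub1 hq h2
  simp only at e1 e2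
  refine ⟨abs_le.1 ?_, abs_le.1 ?_⟩
  · linarith [abs_nonneg y0, abs_nonneg q]
  · linarith [abs_nonneg x0, abs_nonneg p]

def Gr (G : ℕ → ℕ → ℝ → ℝ → ℝ) (x0 p y0 q κ : ℝ) : ℕ → ℕ → ℝ → ℝ → ℝ := fun α β s t => p^α * q^β * G α β (x0 + p*s) (y0 + q*t) / κ

lemma Gr_fam {G} (hG : Fam G) (x0 p y0 q κ : ℝ) : Fam (Gr G x0 p y0 q κ) := by
  refine ⟨?_, ?_, ?_⟩
  · intro α β y x
    have h0 : HasDerivAt (fun s : ℝ => x0 + p * s) p x := by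
      simpa using ((hasDerivAt_id x).const_mul p).const_add x0
    have := (((hG.dx α β (y0+q*y) (x0 + p*x)).comp x h0).const_mul (p^α * q^β)).div_const κ
    refine HasDerivAt.congr_deriv (f := fun _ => _) this ?_
    simp only [Gr]
    ring
  · intro α β x y
    have h0 : HasDerivAt (fun s : ℝ => y0 + q * s) q y := by
      simpa using ((hasDerivAt_id y).const_mul q).const_add y0
    have := (((hG.dy α β (x0+p*x) (y0 + q*y)).comp y h0).const_mul (p^α * q^β)).div_const κ
    refine HasDerivAt.congr_deriv (f := fun _ => _) this ?_
    simp only [Gr]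
    ring
  · intro α β
    have := (hG.c α β).comp (show Continuous (fun z : ℝ × ℝ => (x0 + p*z.1, y0 + q*z.2)) by fun_prop)
    unfold Gr
    exact (continuous_const.mul this).div_const κ

lemma Amp_r {A A1 : ℝ → ℝ → ℂ} {A0 : ℝ} (hA : Amp A A1 A0) (x0 p y0 q : ℝ) (hp1 : |p| ≤ 1) :
    Amp (fun s t => A (x0 + p*s) (y0 + q*t)) (fun s t => (p:ℂ) * A1 (x0 + p*s) (y0 + q*t)) A0 := by
  have hc : Continuous (fun z : ℝ × ℝ => (x0 + p*z.1, y0 + q*z.2)) := by fun_prop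
  refine ⟨?_, hA.c.comp hc, continuous_const.mul (hA.c1.comp hc), fun _ _ => hA.b _ _, ?_⟩
  · intro y x
    have h0 : HasDerivAt (fun s : ℝ => x0 + p * s) p x := by
      simpa using ((hasDerivAt_id x).const_mul p).const_add x0
    have := (hA.dx (y0+q*y) (x0 + p*x)).scomp x h0
    rw [Complex.real_smul] at this
    exact this
  · intro x y
    rw [norm_mul, Complex.norm_real, Real.norm_eq_abs]
    have := hA.b1 (x0 + p*x) (y0+q*y)
    nlinarith [abs_nonneg p, norm_nonneg (A1 (x0 + p*x) (y0+q*y))]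

lemma rescale {G} (hG : Fam G) {A A1 : ℝ → ℝ → ℂ} {A0 : ℝ} (hA : Amp A A1 A0) {lam x0 p y0 q κ D : ℝ} (hp : p ≠ 0) (hq : q ≠ 0) (hκ : κ ≠ 0)
    (h : Bd (bx (lam*κ) (Gr G x0 p y0 q κ 0 0) (fun s t => A (x0 + p*s) (y0 + q*t)) (Set.Ico 0 1 ×ˢ Set.Ico 0 1)) D) :
    Bd (bx lam (G 0 0) A (sqr x0 p y0 q)) (Real.sqrt (|p| * |q|) * D) := by
  refine Bd_scale (sqr_ker hG hA hp hq) (x0 := x0) (y0 := y0) hp hq ?_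
  convert h using 3 with s t
  unfold bx
  by_cases hm : (s, t) ∈ Set.Ico (0:ℝ) 1 ×ˢ Set.Ico (0:ℝ) 1
  · rw [Set.indicator_of_mem hm, Set.indicator_of_mem]
    · simp only [Gr, pow_zero, one_mul]
      congr 2
      push_cast
      have : (κ:ℂ) ≠ 0 := by exact_mod_cast hκ
      field_simp
    · simp only [sqr, Set.mem_ofPred_eq, add_sub_cancel_left, mul_div_cancel_left₀ _ hp, mul_div_cancel_left₀ _ hq]
      exact hm
  · rw [Set.indicator_of_notMem hm, Set.indicator_of_notMem]
    simp only [sqr, Set.mem_ofPred_eq, add_sub_cancel_left, mul_div_cancel_left₀ _ hp, mul_div_cancel_left₀ _ hq]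
    exact hm

lemma sp1 {N : ℕ} (hN : 0 < N) {x0 p x : ℝ} (hp : p ≠ 0) (i : ℕ) :
    (x - (x0 + p*(i/N)))/(p/N) ∈ Set.Ico (0:ℝ) 1 ↔ (i:ℝ) ≤ N*((x-x0)/p) ∧ N*((x-x0)/p) < i+1 := by
  have hN' : (0:ℝ) < N := by exact_mod_cast hN
  have e : (x - (x0 + p*(i/N)))/(p/N) = N*((x-x0)/p) - i := by field_simp; ring
  rw [e, Set.mem_Ico]
  constructor <;> rintro ⟨h1, h2⟩ <;> constructor <;> linarith

lemma split {lam : ℝ} {S : ℝ → ℝ → ℝ} {A : ℝ → ℝ → ℂ} {N : ℕ} (hN : 0 < N) {x0 p y0 q : ℝ} (hp : p ≠ 0) (hq : q ≠ 0) :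
    bx lam S A (sqr x0 p y0 q) = fun x y => ∑ m ∈ Finset.range N ×ˢ Finset.range N, 
      bx lam S A (sqr (x0 + p*((m.1:ℕ)/N)) (p/N) (y0 + q*((m.2:ℕ)/N)) (q/N)) x y := by
  have hN' : (0:ℝ) < N := by exact_mod_cast hN
  ext x y
  have hiff : ∀ m : ℕ × ℕ, (x,y) ∈ sqr (x0 + p*((m.1:ℕ)/N)) (p/N) (y0 + q*((m.2:ℕ)/N)) (q/N) ↔
      ((m.1:ℝ) ≤ N*((x-x0)/p) ∧ N*((x-x0)/p) < m.1+1) ∧ ((m.2:ℝ) ≤ N*((y-y0)/q) ∧ N*((y-y0)/q) < m.2+1) := by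
    intro m
    simp only [sqr, Set.mem_ofPred_eq]
    rw [sp1 hN hp, sp1 hN hq]
  by_cases h : (x,y) ∈ sqr x0 p y0 q
  · have hx : 0 ≤ N*((x-x0)/p) := mul_nonneg hN'.le h.1.1
    have hy : 0 ≤ N*((y-y0)/q) := mul_nonneg hN'.le h.2.1
    have hx1 : N*((x-x0)/p) < N := by have := h.1.2; simp only at this; nlinarith
    have hy1 : N*((y-y0)/q) < N := by have := h.2.2; simp only at this; nlinarith
    rw [Finset.sum_eq_single (⌊N*((x-x0)/p)⌋₊, ⌊N*((y-y0)/q)⌋₊)]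
    · unfold bx
      rw [Set.indicator_of_mem h, Set.indicator_of_mem]
      rw [hiff]
      exact ⟨⟨Nat.floor_le hx, Nat.lt_floor_add_one _⟩, ⟨Nat.floor_le hy, Nat.lt_floor_add_one _⟩⟩
    · intro m _ hm
      unfold bx
      rw [Set.indicator_of_notMem]
      rw [hiff]
      rintro ⟨h1, h2⟩
      apply hm
      ext
      · simp only; symm; rw [Nat.floor_eq_iff hx]; exact h1
      · simp only; symm; rw [Nat.floor_eq_iff hy]; exact h2
    · intro hm
      exfalso; apply hm
      rw [Finset.mem_product]
      simp only [Finset.mem_range]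
      exact ⟨(Nat.floor_lt hx).2 hx1, (Nat.floor_lt hy).2 hy1⟩
  · symm
    unfold bx
    rw [Set.indicator_of_notMem h]
    apply Finset.sum_eq_zero
    intro m hm
    rw [Set.indicator_of_notMem]
    rw [hiff]
    rintro ⟨⟨h1, h2⟩, h3, h4⟩
    apply h
    rw [Finset.mem_product, Finset.mem_range, Finset.mem_range] at hm
    have a1 : (m.1:ℝ) + 1 ≤ N := by exact_mod_cast hm.1
    have a2 : (m.2:ℝ) + 1 ≤ N := by exact_mod_cast hm.2
    have b1 : (0:ℝ) ≤ m.1 := by positivity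
    have b2 : (0:ℝ) ≤ m.2 := by positivity
    refine ⟨⟨?_, ?_⟩, ⟨?_, ?_⟩⟩ <;> simp only <;> by_contra hc <;> push Not at hc <;> nlinarith

lemma fam_lip {Q} (hQ : Fam Q) (α β : ℕ) {m : ℝ} (h1 : ∀ u ∈ Set.Icc (0:ℝ) 1, ∀ v ∈ Set.Icc (0:ℝ) 1, |Q (α+1) β u v| ≤ m)
    (h2 : ∀ u ∈ Set.Icc (0:ℝ) 1, ∀ v ∈ Set.Icc (0:ℝ) 1, |Q α (β+1) u v| ≤ m) {u u' v v' : ℝ} (hu : 0 ≤ u) (huu : u ≤ u') (hu1 : u' ≤ 1)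
    (hv : 0 ≤ v) (hvv : v ≤ v') (hv1 : v' ≤ 1) : |Q α β u' v' - Q α β u v| ≤ m * ((u'-u) + (v'-v)) := by
  obtain ⟨z, hz, e⟩ := (hQ.chx α β v').mvt 0 huu
  obtain ⟨w, hw, e'⟩ := (hQ.chy α β u).mvt 0 hvv
  simp only [zero_add] at e e'
  rw [show 1 + α = α + 1 by ring] at e
  rw [show 1 + β = β + 1 by ring] at e'
  have b1 := h1 z ⟨hu.trans hz.1, hz.2.trans hu1⟩ v' ⟨hv.trans hvv, hv1⟩
  have b2 := h2 u ⟨hu, huu.trans hu1⟩ w ⟨hv.trans hw.1, hw.2.trans hv1⟩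
  have e2 : Q α β u' v' - Q α β u v = Q (α+1) β z v' * (u'-u) + Q α (β+1) u w * (v'-v) := by linarith
  rw [e2]
  refine (abs_add_le _ _).trans ?_
  rw [abs_mul, abs_mul, abs_of_nonneg (sub_nonneg.2 huu), abs_of_nonneg (sub_nonneg.2 hvv), mul_add]
  exact add_le_add (mul_le_mul_of_nonneg_right b1 (by linarith)) (mul_le_mul_of_nonneg_right b2 (by linarith))

set_option maxHeartbeats 1600000 in
lemma block {G c s F} (hG : Fam G) (hS : Ser (fun α β => G (α+1) (β+1)) c s) (hF : Nw c F)
    (hno : ∀ a b : ℕ, 1 ≤ a → 1 ≤ b → c a 0 ≠ 0 → c 0 b ≠ 0 → nd c * (a+b) < (a:ℝ)*b) (hd : 0 < nd c) :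
    ∃ θ > 1/(2*(1+nd c)), ∃ η > 0, η ≤ 1 ∧ ∀ A0 : ℝ, ∃ C ≥ (0:ℝ), ∀ A A1, Amp A A1 A0 → ∀ lam : ℝ, lam ≠ 0 → ∀ X Y : ℝ, X ≠ 0 → Y ≠ 0 → 
      |X| ≤ η → |Y| ≤ η → Bd (bx lam (G 0 0) A (sqr (X/2) (X/2) (Y/2) (Y/2))) 
        (C * Real.sqrt (|X| * |Y|) * min 1 ((|lam| * (|X| * |Y| * MM F X Y))^(-θ))) := by
  obtain ⟨N0, c0, η, hc0, hη, hηs, hLB⟩ := LB hS hF hno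
  obtain ⟨θ, hθ, hU⟩ := lemU hd N0
  obtain ⟨B, hB0, hB⟩ := ubE hS hF (2*N0+2)
  refine ⟨θ, hθ, η, hη, hηs.le.trans hS.s1, ?_⟩
  intro A0
  set N : ℕ := ⌈2*B/c0⌉₊ + 1 with hN
  have hN0 : 0 < N := by omega
  have hNr : (0:ℝ) < N := by exact_mod_cast hN0
  have hN1 : (1:ℝ) ≤ N := by exact_mod_cast hN0
  have hNB : B / N ≤ c0/2 := by
    have h1 := Nat.le_ceil (2*B/c0)
    have h2 : 2*B/c0 ≤ N := by rw [hN]; push_cast; linarith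
    rw [div_le_iff₀ hc0] at h2
    rw [div_le_iff₀ hNr]; linarith
  set h : ℝ := 1/(2*N) with hh
  have hh0 : 0 < h := by positivity
  have hh1 : h ≤ 1 := by rw [hh, div_le_one (by positivity)]; linarith
  obtain ⟨C, hC, hCU⟩ := hU B (h^(N0+2)*(c0/2)) A0 (by positivity) hB0
  refine ⟨N^2*C, by positivity, ?_⟩
  intro A A1 hA lam hl X Y hX hY hXη hYη
  have hM := MM_pos hF.ne hX hY
  set M := MM F X Y with hMd
  set T := |lam| * (|X| * |Y| * M) with hT
  have hX1 : |X| ≤ 1 := hXη.trans (hηs.le.trans hS.s1)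
  have hX2 : X/2 ≠ 0 := by simpa using hX
  have hY2 : Y/2 ≠ 0 := by simpa using hY
  rw [split hN0 hX2 hY2]
  have key : ∀ m ∈ Finset.range N ×ˢ Finset.range N, Bd (bx lam (G 0 0) A (sqr (X/2 + X/2*((m.1:ℕ)/N)) (X/2/N) (Y/2 + Y/2*((m.2:ℕ)/N)) (Y/2/N)))
      (C * Real.sqrt (|X| * |Y|) * min 1 (T^(-θ))) := by
    intro m hm
    rw [Finset.mem_product, Finset.mem_range, Finset.mem_range] at hm
    have a1 : (m.1:ℝ) + 1 ≤ N := by exact_mod_cast hm.1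
    have a2 : (m.2:ℝ) + 1 ≤ N := by exact_mod_cast hm.2
    have b1 : (0:ℝ) ≤ m.1 := by positivity
    have b2 : (0:ℝ) ≤ m.2 := by positivity
    set u := 1/2 + h * m.1 with hu
    set v := 1/2 + h * m.2 with hv
    have hhN : h * N = 1/2 := by rw [hh]; field_simp
    have hu1 : u + h ≤ 1 := by have := mul_le_mul_of_nonneg_left a1 hh0.le; linarith
    have hv1 : v + h ≤ 1 := by have := mul_le_mul_of_nonneg_left a2 hh0.le; linarith
    have hu0 : 1/2 ≤ u := by have := mul_nonneg hh0.le b1; linarith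
    have hv0 : 1/2 ≤ v := by have := mul_nonneg hh0.le b2; linarith
    have hκ : X*Y*M ≠ 0 := by positivity
    have hp : X/2/N ≠ 0 := by positivity
    have hq : Y/2/N ≠ 0 := by positivity
    have hpe : X/2/N = X*h := by rw [hh]; field_simp
    have hqe : Y/2/N = Y*h := by rw [hh]; field_simp
    set x0 := X/2 + X/2*((m.1:ℕ)/N) with hx0
    set y0 := Y/2 + Y/2*((m.2:ℕ)/N) with hy0
    have hx0e : x0 = X*u := by rw [hx0, hu, hh]; field_simp
    have hy0e : y0 = Y*v := by rw [hy0, hv, hh]; field_simp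
    set Q := Gr G 0 X 0 Y (X*Y) with hQ
    have hQf : Fam Q := Gr_fam hG _ _ _ _ _
    have hQe : ∀ α β u v, Q (α+1) (β+1) u v = X^α * Y^β * G (α+1) (β+1) (X*u) (Y*v) := by
      intro α β u v
      simp only [hQ, Gr, zero_add]
      field_simp
      ring
    have hQb : ∀ α β, 1 ≤ α → α ≤ 2*N0+3 → 1 ≤ β → β ≤ 2*N0+3 → ∀ u ∈ Set.Icc (0:ℝ) 1, ∀ v ∈ Set.Icc (0:ℝ) 1, |Q α β u v| ≤ B*M := by
      intro α β h1 h2 h3 h4 u hu v hv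
      obtain ⟨α, rfl⟩ := Nat.exists_eq_add_of_le' h1
      obtain ⟨β, rfl⟩ := Nat.exists_eq_add_of_le' h3
      rw [hQe]
      exact hB α β (by omega) (by omega) X Y (hXη.trans_lt hηs) (hYη.trans_lt hηs) u v (abs_le.2 ⟨by linarith [hu.1], hu.2⟩) (abs_le.2 ⟨by linarith [hv.1], hv.2⟩)
    have hGr : ∀ α β s t, Gr G x0 (X/2/N) y0 (Y/2/N) (X*Y*M) α β s t = h^(α+β) * (Q α β (u + h*s) (v + h*t) / M) := by
      intro α β s t
      simp only [hQ, Gr, zero_add]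
      rw [hpe, hqe, hx0e, hy0e, show X*u + X*h*s = X*(u+h*s) by ring, show Y*v + Y*h*t = Y*(v+h*t) by ring, mul_pow, mul_pow, pow_add]
      field_simp
    have hin : ∀ s ∈ Set.Icc (0:ℝ) 1, u + h*s ∈ Set.Icc (0:ℝ) 1 := fun s hs => ⟨by linarith [mul_nonneg hh0.le hs.1], by linarith [mul_le_mul_of_nonneg_left hs.2 hh0.le]⟩
    have hin' : ∀ s ∈ Set.Icc (0:ℝ) 1, v + h*s ∈ Set.Icc (0:ℝ) 1 := fun s hs => ⟨by linarith [mul_nonneg hh0.le hs.1], by linarith [mul_le_mul_of_nonneg_left hs.2 hh0.le]⟩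
    obtain ⟨a, b, ha, hb, hok, hla, hlb⟩ := hLB X Y hX hY hXη hYη u ⟨hu0, by linarith⟩ v ⟨hv0, by linarith⟩
    have low : ∀ α β, 1 ≤ α → α ≤ N0+1 → 1 ≤ β → β ≤ N0+1 → α + β ≤ N0+2 → c0*M ≤ |Q α β u v| → ∀ s ∈ Set.Icc (0:ℝ) 1, ∀ t ∈ Set.Icc (0:ℝ) 1,
        h^(N0+2)*(c0/2) ≤ |Gr G x0 (X/2/N) y0 (Y/2/N) (X*Y*M) α β s t| := by
      intro α β h1 h2 h3 h4 h5 h6 s hs t ht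
      rw [hGr, abs_mul, abs_div, abs_of_pos hM, abs_of_pos (pow_pos hh0 _)]
      have hl := fam_lip hQf α β (m := B*M) (hQb _ _ (by omega) (by omega) (by omega) (by omega)) (hQb _ _ (by omega) (by omega) (by omega) (by omega))
        (u := u) (u' := u + h*s) (v := v) (v' := v+h*t) (by linarith) (by linarith [mul_nonneg hh0.le hs.1]) (hin s hs).2 (by linarith) (by linarith [mul_nonneg hh0.le ht.1]) (hin' t ht).2
      have h7 : B*M*((u+h*s-u)+(v+h*t-v)) ≤ c0/2*M := by
        have e1 : (u+h*s-u)+(v+h*t-v) ≤ 2*h := by linarith [mul_le_mul_of_nonneg_left hs.2 hh0.le, mul_le_mul_of_nonneg_left ht.2 hh0.le]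
        have e2 : B*(2*h) ≤ c0/2 := by
          have : B*(2*h) = B/N := by rw [hh]; field_simp
          rw [this]; exact hNB
        calc _ ≤ B*M*(2*h) := mul_le_mul_of_nonneg_left e1 (by positivity)
          _ = B*(2*h)*M := by ring
          _ ≤ _ := mul_le_mul_of_nonneg_right e2 hM.le
      have h8 : c0/2 ≤ |Q α β (u+h*s) (v+h*t)| / M := by
        rw [le_div_iff₀ hM]
        have := abs_sub_abs_le_abs_sub (Q α β u v) (Q α β (u+h*s) (v+h*t))
        rw [abs_sub_comm] at this
        linarith
      exact mul_le_mul (pow_le_pow_of_le_one hh0.le hh1 h5) h8 (by positivity) (by positivity)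
    have main := hCU a b ha hb hok (Gr G x0 (X/2/N) y0 (Y/2/N) (X*Y*M)) (Gr_fam hG _ _ _ _ _) ?_ ?_ ?_ _ _ (Amp_r hA x0 (X/2/N) y0 (Y/2/N) ?_) (lam*(X*Y*M)) (mul_ne_zero hl hκ)
    · have := rescale hG hA hp hq hκ main
      refine this.mono ?_
      rw [show |lam*(X*Y*M)| = T by rw [hT, abs_mul, abs_mul, abs_mul, abs_of_pos hM]]
      have e1 : Real.sqrt (|X/2/N| * |Y/2/N|) ≤ Real.sqrt (|X| * |Y|) := by
        apply Real.sqrt_le_sqrt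
        rw [hpe, hqe, abs_mul, abs_mul, abs_of_pos hh0]
        exact mul_le_mul (mul_le_of_le_one_right (abs_nonneg _) hh1) (mul_le_of_le_one_right (abs_nonneg _) hh1) (by positivity) (abs_nonneg _)
      calc _ ≤ Real.sqrt (|X| * |Y|) * (C * min 1 (T^(-θ))) := mul_le_mul_of_nonneg_right e1 (by positivity)
        _ = _ := by ring
    · intro α β h1 h2 h3 h4 s hs t ht
      rw [hGr, abs_mul, abs_div, abs_of_pos hM, abs_of_pos (pow_pos hh0 _)]
      have e1 := hQb α β h1 (by omega) h3 (by omega) _ (hin s hs) _ (hin' t ht)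
      have e2 : |Q α β (u+h*s) (v+h*t)| / M ≤ B := by rwa [div_le_iff₀ hM]
      calc _ ≤ 1 * B := mul_le_mul (pow_le_one₀ hh0.le hh1) e2 (by positivity) (by positivity)
        _ = B := one_mul _
    · refine low (a+1) 1 (by omega) (by omega) (by omega) (by omega) (by omega) ?_
      rw [hQe a 0]; simpa using hla
    · refine low 1 (b+1) (by omega) (by omega) (by omega) (by omega) (by omega) ?_
      rw [hQe 0 b]; simpa using hlb
    · rw [hpe, abs_mul, abs_of_pos hh0]
      exact mul_le_one₀ hX1 hh0.le hh1
  have hk := Bd.sum _ (fun m _ => by positivity) (fun m _ => sqr_ker hG hA (by positivity) (by positivity)) key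
  refine hk.mono ?_
  rw [Finset.sum_const, Finset.card_product, Finset.card_range, nsmul_eq_mul]
  push_cast
  apply le_of_eq; ring

def Is (η σ : ℝ) (i : ℕ) : Set ℝ := {x | η/2^(i+1) ≤ σ*x ∧ σ*x < η/2^i}

lemma Is_meas (η σ : ℝ) (i : ℕ) : MeasurableSet (Is η σ i) := by
  have : Is η σ i = (fun x => σ*x) ⁻¹' (Set.Ico (η/2^(i+1)) (η/2^i)) := rfl
  rw [this]
  exact (measurable_const_mul σ) measurableSet_Ico

lemma Is_uniq {η σ : ℝ} (hη : 0 < η) {i j : ℕ} {x : ℝ} (hi : x ∈ Is η σ i) (hj : x ∈ Is η σ j) : i = j := by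
  by_contra h
  wlog hij : i < j generalizing i j
  · exact this hj hi (Ne.symm h) (by omega)
  have : η/2^j ≤ η/2^(i+1) := div_le_div_of_nonneg_left hη.le (by positivity) (pow_le_pow_right₀ (by norm_num) hij)
  linarith [hi.1, hj.2]

lemma Is_abs {η σ : ℝ} (hη : 0 < η) (hσ : σ = 1 ∨ σ = -1) {i : ℕ} {x : ℝ} (h : x ∈ Is η σ i) : σ * x = |x| ∧ 0 < |x| ∧ |x| < η := by
  have h1 : 0 < σ * x := lt_of_lt_of_le (by positivity) h.1
  have h2 : σ * x = |x| := by
    rcases hσ with rfl | rfl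
    · rw [one_mul] at *; rw [abs_of_pos h1]
    · rw [abs_of_neg (by linarith)]; ring
  refine ⟨h2, h2 ▸ h1, ?_⟩
  have := h.2
  rw [h2] at this
  exact this.trans_le (div_le_self hη.le (one_le_pow₀ (by norm_num)))

lemma Is_cov {η x : ℝ} (K : ℕ) (h1 : η/2^K ≤ |x|) (h2 : |x| < η) : ∃ i < K, η/2^(i+1) ≤ |x| ∧ |x| < η/2^i := by
  induction K with
  | zero => simp at h1; linarith
  | succ K ih =>
    rcases le_or_gt (η/2^K) |x| with h | h
    · obtain ⟨i, hi, h⟩ := ih h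
      exact ⟨i, by omega, h⟩
    · exact ⟨K, by omega, h1, h⟩

lemma Is_sqr1 {η σ : ℝ} (hη : 0 < η) (hσ : σ = 1 ∨ σ = -1) (i : ℕ) (x : ℝ) :
    (x - σ*(η/2^i)/2)/(σ*(η/2^i)/2) ∈ Set.Ico (0:ℝ) 1 ↔ x ∈ Is η σ i := by
  have e : (x - σ*(η/2^i)/2)/(σ*(η/2^i)/2) = (σ*x - η/2^(i+1))/(η/2^(i+1)) := by
    rcases hσ with rfl | rfl <;> rw [pow_succ] <;> field_simp <;> ring
  have hp : 0 < η/2^(i+1) := by positivity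
  have h2 : η/2^i = η/2^(i+1) + η/2^(i+1) := by rw [pow_succ]; field_simp; ring
  rw [e, Set.mem_Ico, div_lt_one hp]
  unfold Is
  rw [Set.mem_ofPred_eq, h2]
  constructor
  · rintro ⟨h, h'⟩
    have := mul_nonneg h hp.le
    rw [div_mul_cancel₀ _ hp.ne'] at this
    constructor <;> linarith
  · rintro ⟨h, h'⟩
    exact ⟨div_nonneg (by linarith) hp.le, by linarith⟩

lemma blk_alg {L P M d θ : ℝ} (hL : 0 < L) (hP : 0 < P) (hd : 0 < d) (hθ : 0 ≤ θ) (hM : P^d ≤ M) :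
    Real.sqrt P * min 1 ((L*(P*M))^(-θ)) ≤ L^(-(1/(2*(1+d)))) * min ((L^(1/(1+d))*P)^(1/2:ℝ)) ((L^(1/(1+d))*P)^(-((1+d)*θ-1/2))) := by
  set e := 1 + d with he
  have he0 : 0 < e := by linarith
  set w := L^(1/e)*P with hw
  have hw0 : 0 < w := by positivity
  have h1 : w^e = L*(P*P^d) := by
    rw [hw, Real.mul_rpow (by positivity) hP.le, ← Real.rpow_mul hL.le, one_div_mul_cancel he0.ne', Real.rpow_one, he, Real.rpow_add hP, Real.rpow_one]
  have h2 : (L*(P*M))^(-θ) ≤ w^(-(e*θ)) := by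
    rw [show -(e*θ) = e*(-θ) by ring, Real.rpow_mul hw0.le, h1]
    refine Real.rpow_le_rpow_of_nonpos (by positivity) ?_ (by linarith)
    gcongr
  have h3 : Real.sqrt P = L^(-(1/(2*e))) * w^(1/2:ℝ) := by
    rw [hw, Real.mul_rpow (by positivity) hP.le, ← Real.rpow_mul hL.le, ← mul_assoc, ← Real.rpow_add hL, Real.sqrt_eq_rpow,
      show -(1/(2*e)) + 1/e*(1/2) = 0 by field_simp; ring, Real.rpow_zero, one_mul]
  rw [h3, mul_assoc]
  refine mul_le_mul_of_nonneg_left ?_ (by positivity)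
  calc w^(1/2:ℝ) * min 1 ((L*(P*M))^(-θ)) ≤ w^(1/2:ℝ) * min 1 (w^(-(e*θ))) := by gcongr
    _ = min (w^(1/2:ℝ)) (w^(-(e*θ-1/2))) := by
      rw [mul_min_of_nonneg _ _ (by positivity), mul_one, ← Real.rpow_add hw0]
      congr 2; ring

lemma caseG {G c s F} (hG : Fam G) (hS : Ser (fun α β => G (α+1) (β+1)) c s) (hF : Nw c F)
    (hno : ∀ a b : ℕ, 1 ≤ a → 1 ≤ b → c a 0 ≠ 0 → c 0 b ≠ 0 → nd c * (a+b) < (a:ℝ)*b) (hd : 0 < nd c) :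
    ∃ ε > (0:ℝ), ∀ A0 : ℝ, ∃ C : ℝ, ∀ A A1, Amp A A1 A0 → (∀ x y, ε ≤ |x| ∨ ε ≤ |y| → A x y = 0) → ∀ lam : ℝ, 1 ≤ |lam| →
      Bd (fun x y => Complex.exp (Complex.I * lam * G 0 0 x y) * A x y) (C * |lam|^(-(1/(2*(1+nd c))))) := by
  classical
  obtain ⟨θ, hθ, η, hη, hη1, hB⟩ := block hG hS hF hno hd
  set d := nd c with hdd
  have he2 : 0 < (1+d)*θ - 1/2 := by
    rw [gt_iff_lt, div_lt_iff₀ (by positivity)] at hθ; linarith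
  have hθ0 : 0 ≤ θ := le_trans (by positivity) hθ.le
  obtain ⟨Cg, hCg, hgs⟩ := geom_sum (ρ := 2) one_lt_two (show (0:ℝ) < 1/2 by norm_num) he2
  refine ⟨η, hη, ?_⟩
  intro A0
  obtain ⟨C, hC, hBk⟩ := hB A0
  refine ⟨4*(C*Cg) + 2*|A0| + 2*|A0|, ?_⟩
  intro A A1 hA hsup lam hlam
  have hL : 0 < |lam| := by linarith
  have hl : lam ≠ 0 := abs_pos.1 hL
  obtain ⟨K, hK⟩ := exists_pow_lt_of_lt_one (show (0:ℝ) < |lam|⁻¹ by positivity) (show (1/2:ℝ) < 1 by norm_num)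
  set δ := η/2^K with hδ
  have hδ0 : 0 < δ := by positivity
  have hδη : δ ≤ η := div_le_self hη.le (one_le_pow₀ (by norm_num))
  have hδl : δ ≤ |lam|⁻¹ := by
    refine le_trans ?_ hK.le
    rw [hδ, one_div, inv_pow, div_eq_mul_inv]
    exact mul_le_of_le_one_left (by positivity) hη1
  set Λ := |lam|^(-(1/(2*(1+d)))) with hΛ
  have hΛ0 : 0 < Λ := by positivity
  set sg : Finset ℝ := {1, -1} with hsg
  have hsgm : ∀ σ ∈ sg, σ = 1 ∨ σ = -1 := by intro σ h; simpa [hsg] using h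
  set E1 : Set (ℝ × ℝ) := {x | |x| < δ} ×ˢ {y | |y| < η} with hE1
  set E2 : Set (ℝ × ℝ) := {x | δ ≤ |x| ∧ |x| < η} ×ˢ {y | |y| < δ} with hE2
  have mlt : ∀ r : ℝ, MeasurableSet {x : ℝ | |x| < r} := fun r => measurableSet_lt (by fun_prop) (by fun_prop)
  have mm : MeasurableSet {x : ℝ | δ ≤ |x| ∧ |x| < η} := MeasurableSet.inter (measurableSet_le measurable_const (by fun_prop : Measurable fun x : ℝ => |x|)) (mlt η)
  have vol : ∀ r : ℝ, volume {x : ℝ | |x| < r} ≤ ENNReal.ofReal (2*r) := by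
    intro r
    have : {x : ℝ | |x| < r} = Metric.ball 0 r := by ext x; simp
    rw [this, Real.volume_ball]
  let bl : (ℝ × ℝ) → (ℕ × ℕ) → ℝ → ℝ → ℂ := fun σ z => bx lam (G 0 0) A (Is η σ.1 z.1 ×ˢ Is η σ.2 z.2)
  have hsq : ∀ σ ∈ sg ×ˢ sg, ∀ z : ℕ × ℕ, sqr (σ.1*(η/2^z.1)/2) (σ.1*(η/2^z.1)/2) (σ.2*(η/2^z.2)/2) (σ.2*(η/2^z.2)/2) = Is η σ.1 z.1 ×ˢ Is η σ.2 z.2 := by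
    intro σ hσ z
    rw [Finset.mem_product] at hσ
    ext ⟨x, y⟩
    simp only [sqr, Set.mem_ofPred_eq, Set.mem_prod]
    rw [Is_sqr1 hη (hsgm _ hσ.1), Is_sqr1 hη (hsgm _ hσ.2)]
  have hX : ∀ σ ∈ sg, ∀ i : ℕ, σ*(η/2^i) ≠ 0 ∧ |σ*(η/2^i)| = η/2^i := by
    intro σ hσ i
    have h0 : |σ*(η/2^i)| = η/2^i := by
      have : 0 < η/2^i := by positivity
      rcases hsgm σ hσ with rfl | rfl
      · rw [one_mul, abs_of_pos this]
      · rw [neg_one_mul, abs_neg, abs_of_pos this]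
    refine ⟨?_, h0⟩
    rw [← abs_pos, h0]; positivity
  have bker : ∀ σ ∈ sg ×ˢ sg, ∀ z, Ker (bl σ z) := by
    intro σ hσ z
    simp only [bl]
    rw [← hsq σ hσ z]
    rw [Finset.mem_product] at hσ
    exact sqr_ker hG hA (div_ne_zero (hX _ hσ.1 _).1 two_ne_zero) (div_ne_zero (hX _ hσ.2 _).1 two_ne_zero)
  have bbd : ∀ σ ∈ sg ×ˢ sg, ∀ z : ℕ × ℕ, Bd (bl σ z) (C * Λ * min ((|lam|^(1/(1+d))*η^2/2^(z.1+z.2))^(1/2:ℝ)) ((|lam|^(1/(1+d))*η^2/2^(z.1+z.2))^(-((1+d)*θ-1/2)))) := by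
    intro σ hσ z
    simp only [bl]
    rw [← hsq σ hσ z]
    rw [Finset.mem_product] at hσ
    obtain ⟨x1, x2⟩ := hX _ hσ.1 z.1
    obtain ⟨y1, y2⟩ := hX _ hσ.2 z.2
    have x3 : |σ.1*(η/2^z.1)| ≤ η := by rw [x2]; exact div_le_self hη.le (one_le_pow₀ (by norm_num))
    have y3 : |σ.2*(η/2^z.2)| ≤ η := by rw [y2]; exact div_le_self hη.le (one_le_pow₀ (by norm_num))
    refine (hBk A A1 hA lam hl _ _ x1 y1 x3 y3).mono ?_
    have hM := MM_lb hF x1 y1 (x3.trans hη1) (y3.trans hη1)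
    have := blk_alg (L := |lam|) (P := |σ.1*(η/2^z.1)| * |σ.2*(η/2^z.2)|) hL (by positivity) hd hθ0 hM
    have e : |lam|^(1/(1+d)) * (|σ.1*(η/2^z.1)| * |σ.2*(η/2^z.2)|) = |lam|^(1/(1+d))*η^2/2^(z.1+z.2) := by
      rw [x2, y2, pow_add]; field_simp
    rw [e] at this
    rw [mul_assoc C, mul_assoc C]
    exact mul_le_mul_of_nonneg_left this hC
  have bsum : ∀ σ ∈ sg ×ˢ sg, Bd (fun x y => ∑ z ∈ Finset.range K ×ˢ Finset.range K, bl σ z x y) (C*Cg*Λ) := by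
    intro σ hσ
    have hσ' := hσ
    rw [Finset.mem_product] at hσ'
    have e : (fun x y => ∑ z ∈ Finset.range K ×ˢ Finset.range K, bl σ z x y) = 
        fun x y => ∑ m ∈ Finset.range (2*K), ∑ z ∈ (Finset.range K ×ˢ Finset.range K).filter (fun z => z.1 + z.2 = m), bl σ z x y := by
      ext x y
      rw [Finset.sum_fiberwise_of_maps_to]
      intro z hz
      rw [Finset.mem_product, Finset.mem_range, Finset.mem_range] at hz
      rw [Finset.mem_range]; omega
    rw [e]
    refine (Bd.sum (Finset.range (2*K)) (A := fun m => C * Λ * min ((|lam|^(1/(1+d))*η^2/2^m)^(1/2:ℝ)) ((|lam|^(1/(1+d))*η^2/2^m)^(-((1+d)*θ-1/2)))) 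
      (fun m _ => by positivity) (fun m _ => Ker.sum _ fun z _ => bker σ hσ z) ?_).mono ?_
    · intro m _
      have := Bd_orth ((Finset.range K ×ˢ Finset.range K).filter (fun z => z.1 + z.2 = m)) (K := bl σ)
        (A := C * Λ * min ((|lam|^(1/(1+d))*η^2/2^m)^(1/2:ℝ)) ((|lam|^(1/(1+d))*η^2/2^m)^(-((1+d)*θ-1/2))))
        (fun z _ => bker σ hσ z) ?_ (fun z => Is η σ.1 z.1) (fun z => Is η σ.2 z.2) (fun z _ => Is_meas _ _ _) ?_ ?_ 1 ?_
      · simpa using this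
      · intro z hz
        have := bbd σ hσ z
        rwa [(Finset.mem_filter.1 hz).2] at this
      · intro z hz z' hz' hne
        rw [Set.disjoint_left]
        intro y h1 h2
        have := Is_uniq hη h1 h2
        have e1 := (Finset.mem_filter.1 hz).2
        have e2 := (Finset.mem_filter.1 hz').2
        exact hne (Prod.ext (by omega) this)
      · intro z _ x y h
        simp only [bl, bx]
        rw [Set.indicator_of_notMem]
        rintro ⟨h1, h2⟩
        tauto
      · intro x t ht hx
        rw [Finset.card_le_one]
        intro z hz z' hz'
        have := Is_uniq hη (hx z hz) (hx z' hz')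
        have e1 := (Finset.mem_filter.1 (ht hz)).2
        have e2 := (Finset.mem_filter.1 (ht hz')).2
        exact Prod.ext this (by omega)
    · rw [← Finset.mul_sum]
      have := hgs (2*K) (|lam|^(1/(1+d))*η^2) (by positivity)
      calc _ ≤ C*Λ*Cg := mul_le_mul_of_nonneg_left this (by positivity)
        _ = _ := by ring
  have ball := Bd.sum (sg ×ˢ sg) (A := fun _ => C*Cg*Λ) (fun _ _ => by positivity) (fun σ hσ => Ker.sum _ fun z _ => bker σ hσ z) bsum
  have kall : Ker (fun x y => ∑ σ ∈ sg ×ˢ sg, ∑ z ∈ Finset.range K ×ˢ Finset.range K, bl σ z x y) := Ker.sum _ fun σ hσ => Ker.sum _ fun z _ => bker σ hσ z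
  have hE1s : E1 ⊆ Set.Icc (-η) η ×ˢ Set.Icc (-η) η := by
    rintro ⟨x, y⟩ ⟨h1, h2⟩
    exact ⟨abs_le.1 (le_trans (le_of_lt h1) hδη), abs_le.1 (le_of_lt h2)⟩
  have hE2s : E2 ⊆ Set.Icc (-η) η ×ˢ Set.Icc (-η) η := by
    rintro ⟨x, y⟩ ⟨h1, h2⟩
    exact ⟨abs_le.1 h1.2.le, abs_le.1 (le_trans (le_of_lt h2) hδη)⟩
  have k1 : Ker (bx lam (G 0 0) A E1) := bx_ker ((mlt δ).prod (mlt η)) hη.le hE1s (hG.c 0 0) hA.c hA.b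
  have k2 : Ker (bx lam (G 0 0) A E2) := bx_ker (mm.prod (mlt δ)) hη.le hE2s (hG.c 0 0) hA.c hA.b
  have hroot : |A0| * Real.sqrt ((2*δ)*(2*η)) ≤ 2*|A0| * Λ := by
    have h1 : Real.sqrt ((2*δ)*(2*η)) ≤ 2*Λ := by
      rw [Real.sqrt_le_left (by positivity)]
      have h2 : |lam|⁻¹ ≤ Λ^2 := by
        rw [hΛ, ← Real.rpow_natCast, ← Real.rpow_mul hL.le, ← Real.rpow_neg_one]
        apply Real.rpow_le_rpow_of_exponent_le hlam
        have : 1/(1+d) ≤ 1 := by rw [div_le_one (by linarith)]; linarith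
        have e : -(1/(2*(1+d))) * ((2:ℕ):ℝ) = -(1/(1+d)) := by push_cast; field_simp
        rw [e]; linarith
      nlinarith
    nlinarith [abs_nonneg A0]
  have hbb : ∀ E x y, ‖bx lam (G 0 0) A E x y‖ ≤ |A0| := fun E x y => (bx_norm x y).trans ((hA.b x y).trans (le_abs_self _))
  have b1 : Bd (bx lam (G 0 0) A E1) (2*|A0| * Λ) := by
    refine (Bd_trivial (abs_nonneg A0) (α := 2*δ) (β := 2*η) (by positivity) (by positivity) (mlt δ) (mlt η) (vol δ) (vol η) (hbb E1) ?_).mono hroot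
    intro x y h
    unfold bx
    rw [Set.indicator_of_notMem]
    rintro ⟨h1, h2⟩
    tauto
  have b2 : Bd (bx lam (G 0 0) A E2) (2*|A0| * Λ) := by
    refine (Bd_trivial (abs_nonneg A0) (α := 2*η) (β := 2*δ) (by positivity) (by positivity) (mlt η) (mlt δ) (vol η) (vol δ) (hbb E2) ?_).mono (by rwa [mul_comm (2*η)])
    intro x y h
    unfold bx
    rw [Set.indicator_of_notMem]
    rintro ⟨h1, h2⟩
    have := h1.2
    tauto
  have fin := Bd.add (by positivity) (by positivity) (kall.add k1) k2 (Bd.add (Finset.sum_nonneg fun _ _ => by positivity) (by positivity) kall k1 ball b1) b2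
  have hcard : (sg ×ˢ sg).card = 4 := by
    rw [Finset.card_product, hsg, Finset.card_pair (by norm_num)]
  rw [Finset.sum_const, hcard] at fin
  have hfun : (fun x y => Complex.exp (Complex.I * lam * G 0 0 x y) * A x y) = fun x y => 
      (∑ σ ∈ sg ×ˢ sg, ∑ z ∈ Finset.range K ×ˢ Finset.range K, bl σ z x y) + bx lam (G 0 0) A E1 x y + bx lam (G 0 0) A E2 x y := by
    ext x y
    have key0 : ¬ (δ ≤ |x| ∧ |x| < η ∧ δ ≤ |y| ∧ |y| < η) → (∑ σ ∈ sg ×ˢ sg, ∑ z ∈ Finset.range K ×ˢ Finset.range K, bl σ z x y) = 0 := by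
      intro h
      apply Finset.sum_eq_zero; intro σ hσ
      apply Finset.sum_eq_zero; intro z hz
      simp only [bl, bx]
      rw [Set.indicator_of_notMem]
      rintro ⟨h1, h2⟩
      apply h
      rw [Finset.mem_product, Finset.mem_range, Finset.mem_range] at hz
      rw [Finset.mem_product] at hσ
      have a1 := Is_abs hη (hsgm _ hσ.1) h1
      have a2 := Is_abs hη (hsgm _ hσ.2) h2
      have c1 := h1.1
      have c2 := h2.1
      simp only at a1 a2 c1 c2
      rw [a1.1] at c1
      rw [a2.1] at c2
      have dl : ∀ i < K, δ ≤ η/2^(i+1) := fun i hi => div_le_div_of_nonneg_left hη.le (by positivity) (pow_le_pow_right₀ (by norm_num) hi)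
      exact ⟨(dl _ hz.1).trans c1, a1.2.2, (dl _ hz.2).trans c2, a2.2.2⟩
    by_cases hx : η ≤ |x| ∨ η ≤ |y|
    · rw [hsup x y hx, mul_zero, key0 (by rcases hx with h | h <;> rintro ⟨h1, h2, h3, h4⟩ <;> linarith)]
      have : ∀ E, bx lam (G 0 0) A E x y = 0 := by
        intro E
        have := bx_norm (lam := lam) (S := G 0 0) (A := A) (E := E) x y
        rw [hsup x y hx, norm_zero] at this
        exact norm_le_zero_iff.1 this
      rw [this, this]; simp
    · push Not at hx
      rcases lt_or_ge |x| δ with h1 | h1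
      · rw [key0 (by rintro ⟨h, -⟩; linarith)]
        simp only [bx]
        rw [Set.indicator_of_mem (show (x,y) ∈ E1 from ⟨h1, hx.2⟩), Set.indicator_of_notMem]
        · simp
        · rintro ⟨h, -⟩; exact absurd h.1 (not_le.2 h1)
      · rcases lt_or_ge |y| δ with h2 | h2
        · rw [key0 (by rintro ⟨-, -, h, -⟩; linarith)]
          simp only [bx]
          rw [Set.indicator_of_mem (show (x,y) ∈ E2 from ⟨⟨h1, hx.1⟩, h2⟩), Set.indicator_of_notMem]
          · simp
          · rintro ⟨h, -⟩; exact absurd (show |x| < δ from h) (not_lt.2 h1)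
        · have n1 : bx lam (G 0 0) A E1 x y = 0 := by
            simp only [bx]; rw [Set.indicator_of_notMem]
            rintro ⟨h, -⟩; exact absurd (show |x| < δ from h) (not_lt.2 h1)
          have n2 : bx lam (G 0 0) A E2 x y = 0 := by
            simp only [bx]; rw [Set.indicator_of_notMem]
            rintro ⟨-, h⟩; exact absurd (show |y| < δ from h) (not_lt.2 h2)
          rw [n1, n2, add_zero, add_zero]
          have ex : ∀ x : ℝ, δ ≤ |x| → |x| < η → ∃ σ ∈ sg, ∃ i < K, x ∈ Is η σ i := by
            intro x h1 h2
            obtain ⟨i, hi, h3⟩ := Is_cov K h1 h2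
            rcases le_total 0 x with hx | hx
            · refine ⟨1, by simp [hsg], i, hi, ?_⟩
              rw [abs_of_nonneg hx] at h3; simpa [Is] using h3
            · refine ⟨-1, by simp [hsg], i, hi, ?_⟩
              rw [abs_of_nonpos hx] at h3; simpa [Is] using h3
          have us : ∀ x : ℝ, ∀ σ ∈ sg, ∀ σ' ∈ sg, ∀ i j, x ∈ Is η σ i → x ∈ Is η σ' j → σ = σ' ∧ i = j := by
            intro x σ hσ σ' hσ' i j h h'
            have a1 := Is_abs hη (hsgm _ hσ) h
            have a2 := Is_abs hη (hsgm _ hσ') h'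
            have : σ = σ' := mul_right_cancel₀ (abs_pos.1 a1.2.1) (a1.1.trans a2.1.symm)
            subst this
            exact ⟨rfl, Is_uniq hη h h'⟩
          obtain ⟨σ, hσ, i, hi, hxi⟩ := ex x h1 hx.1
          obtain ⟨τ, hτ, k, hk, hyk⟩ := ex y h2 hx.2
          rw [Finset.sum_eq_single (σ, τ), Finset.sum_eq_single (i, k)]
          · simp only [bl, bx]
            rw [Set.indicator_of_mem (show (x,y) ∈ Is η σ i ×ˢ Is η τ k from ⟨hxi, hyk⟩)]
          · intro z _ hz
            simp only [bl, bx]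
            rw [Set.indicator_of_notMem]
            rintro ⟨h, h'⟩
            exact hz (Prod.ext (us x σ hσ σ hσ _ _ h hxi).2 (us y τ hτ τ hτ _ _ h' hyk).2)
          · intro h; exact absurd (Finset.mem_product.2 ⟨Finset.mem_range.2 hi, Finset.mem_range.2 hk⟩) h
          · intro ρ hρ hne
            rw [Finset.mem_product] at hρ
            apply Finset.sum_eq_zero; intro z _
            simp only [bl, bx]
            rw [Set.indicator_of_notMem]
            rintro ⟨h, h'⟩
            exact hne (Prod.ext (us x _ hρ.1 σ hσ _ _ h hxi).1 (us y _ hρ.2 τ hτ _ _ h' hyk).1)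
          · intro h; exact absurd (Finset.mem_product.2 ⟨hσ, hτ⟩) h
  rw [hfun]
  refine fin.mono (le_of_eq ?_)
  rw [nsmul_eq_mul]; push_cast; ring

lemma bdG {G} (hG : Fam G) (n : ℕ) : ∃ B, 0 ≤ B ∧ ∀ α β, α ≤ n → β ≤ n → ∀ x y : ℝ, |x| ≤ 1 → |y| ≤ 1 → |G α β x y| ≤ B := by
  have h1 : ∀ α β, ∃ B, ∀ z ∈ Set.Icc (-1:ℝ) 1 ×ˢ Set.Icc (-1:ℝ) 1, ‖G α β z.1 z.2‖ ≤ B := fun α β =>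
    (isCompact_Icc.prod isCompact_Icc).exists_bound_of_continuousOn (hG.c α β).continuousOn
  choose B hB using h1
  have hB0 : ∀ α β, 0 ≤ B α β := fun α β => (norm_nonneg _).trans (hB α β (0,0) (by constructor <;> norm_num))
  refine ⟨∑ α ∈ Finset.range (n+1), ∑ β ∈ Finset.range (n+1), B α β, Finset.sum_nonneg fun _ _ => Finset.sum_nonneg fun _ _ => hB0 _ _, ?_⟩
  intro α β hα hβ x y hx hy
  calc |G α β x y| ≤ B α β := hB α β (x,y) ⟨abs_le.1 hx, abs_le.1 hy⟩
    _ ≤ ∑ β ∈ Finset.range (n+1), B α β := Finset.single_le_sum (f := fun β => B α β) (fun _ _ => hB0 _ _) (Finset.mem_range.2 (by omega))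
    _ ≤ _ := Finset.single_le_sum (f := fun α => ∑ β ∈ Finset.range (n+1), B α β) (fun _ _ => Finset.sum_nonneg fun _ _ => hB0 _ _) (Finset.mem_range.2 (by omega))

lemma lowG {G} (hG : Fam G) (α β : ℕ) (h : G α β 0 0 ≠ 0) : ∃ e > (0:ℝ), ∀ x y : ℝ, |x| ≤ e → |y| ≤ e → |G α β 0 0|/2 ≤ |G α β x y| := by
  have hc : Continuous (fun z : ℝ × ℝ => |G α β z.1 z.2|) := (hG.c α β).abs
  have := (hc.tendsto (0,0)).eventually (lt_mem_nhds (show |G α β 0 0|/2 < |G α β 0 0| by have := abs_pos.2 h; linarith))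
  obtain ⟨e, he, h⟩ := Metric.eventually_nhds_iff.1 this
  refine ⟨e/2, by positivity, ?_⟩
  intro x y hx hy
  refine (h (y := (x,y)) ?_).le
  rw [Prod.dist_eq, Real.dist_0_eq_abs, Real.dist_0_eq_abs]
  exact max_lt (by simp only; linarith) (by simp only; linarith)

lemma lam_le {L e e' : ℝ} (hL : 1 ≤ L) (h : e ≤ e') : L^(-e') ≤ L^(-e) := Real.rpow_le_rpow_of_exponent_le hL (by linarith)

lemma case0 {G} (hG : Fam G) {d : ℝ} (hd : 0 ≤ d) (h : G 1 1 0 0 ≠ 0) :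
    ∃ ε > (0:ℝ), ∀ A0 : ℝ, ∃ C : ℝ, ∀ A A1 A2, Amp A A1 A0 → Amp A1 A2 A0 → (∀ x y, ε ≤ |x| ∨ ε ≤ |y| → A x y = 0) → ∀ lam : ℝ, 1 ≤ |lam| →
      Bd (fun x y => Complex.exp (Complex.I * lam * G 0 0 x y) * A x y) (C * |lam|^(-(1/(2*(1+d))))) := by
  obtain ⟨e, he, hl⟩ := lowG hG 1 1 h
  obtain ⟨B, hB0, hB⟩ := bdG hG 3
  have r : ∀ x ∈ Set.Icc (-(min e (1/2))) (min e (1/2)), |x| ≤ e ∧ |x| ≤ 1 := by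
    intro x hx
    have := abs_le.2 hx
    exact ⟨this.trans (min_le_left _ _), by linarith [min_le_right e (1/2)]⟩
  refine ⟨min e (1/2), by positivity, ?_⟩
  intro A0
  obtain ⟨C, hC, hn⟩ := nondeg A0 (|G 1 1 0 0|/2) B (min e (1/2)) (by have := abs_pos.2 h; positivity) hB0 (by positivity) (min_le_right _ _)
  refine ⟨C, ?_⟩
  intro A A1 A2 hA hA1 hs lam hlam
  refine (hn G hG (fun x hx y hy => hl x y (r x hx).1 (r y hy).1) (fun x hx y hy => hB _ _ (by norm_num) (by norm_num) x y (r x hx).2 (r y hy).2)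
    (fun x hx y hy => hB _ _ (by norm_num) (by norm_num) x y (r x hx).2 (r y hy).2) A A1 A2 hA hA1 hs lam (abs_pos.1 (by linarith))).mono ?_
  refine mul_le_mul_of_nonneg_left (lam_le hlam ?_) hC
  rw [div_le_div_iff₀ (by positivity) (by norm_num)]; linarith

lemma caseS {G} (hG : Fam G) {d : ℝ} (hd : 0 ≤ d) {a b : ℕ} (ha : 1 ≤ a) (hb : 1 ≤ b) (h1 : G (a+1) 1 0 0 ≠ 0) (h2 : G 1 (b+1) 0 0 ≠ 0) 
    (hab : (a:ℝ)*b ≤ d*(a+b)) :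
    ∃ ε > (0:ℝ), ∀ A0 : ℝ, ∃ C : ℝ, ∀ A A1, Amp A A1 A0 → (∀ x y, ε ≤ |x| ∨ ε ≤ |y| → A x y = 0) → ∀ lam : ℝ, 1 ≤ |lam| →
      Bd (fun x y => Complex.exp (Complex.I * lam * G 0 0 x y) * A x y) (C * |lam|^(-(1/(2*(1+d))))) := by
  obtain ⟨e1, he1, hl1⟩ := lowG hG _ _ h1
  obtain ⟨e2, he2, hl2⟩ := lowG hG _ _ h2
  obtain ⟨B, hB0, hB⟩ := bdG hG (a+2*b+2)
  set ε := min (min e1 e2) (1/2) with hε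
  have hε0 : 0 < ε := by positivity
  have hε2 : 2*ε ≤ 1 := by have := min_le_right (min e1 e2) (1/2); rw [← hε] at this; linarith
  have hε1 : ε ≤ e1 := (min_le_left _ _).trans (min_le_left _ _)
  have hε3 : ε ≤ e2 := (min_le_left _ _).trans (min_le_right _ _)
  refine ⟨ε, hε0, ?_⟩
  intro A0
  have p1 := abs_pos.2 h1
  have p2 := abs_pos.2 h2
  set c := min ((2*ε)^(a+2)*(|G (a+1) 1 0 0|/2)) ((2*ε)^(b+2)*(|G 1 (b+1) 0 0|/2)) with hc
  obtain ⟨C, hC, hn⟩ := lemA a b ha hb B c A0 (by positivity) hB0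
  refine ⟨Real.sqrt (|2*ε| * |2*ε|) * C, ?_⟩
  intro A A1 hA hs lam hlam
  have r : ∀ s ∈ Set.Icc (0:ℝ) 1, |(-ε) + 2*ε*s| ≤ ε := fun s hs => abs_le.2 ⟨by nlinarith [hs.1], by nlinarith [hs.2]⟩
  have hyp : HypA (Gr G (-ε) (2*ε) (-ε) (2*ε) 1) a b B c := by
    refine ⟨Gr_fam hG _ _ _ _ _, ?_, ?_, ?_⟩
    · intro α β _ h2 _ h4 x hx y hy
      simp only [Gr, div_one]
      rw [← pow_add, abs_mul, abs_of_nonneg (by positivity)]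
      have := hB α β (by omega) (by omega) _ _ ((r x hx).trans (by linarith)) ((r y hy).trans (by linarith))
      calc _ ≤ 1 * B := mul_le_mul (pow_le_one₀ (by positivity) hε2) this (by positivity) (by positivity)
        _ = B := one_mul _
    · intro x hx y hy
      simp only [Gr, div_one]
      rw [← pow_add, abs_mul, abs_of_nonneg (by positivity)]
      exact (min_le_left _ _).trans (mul_le_mul_of_nonneg_left (hl1 _ _ ((r x hx).trans hε1) ((r y hy).trans hε1)) (by positivity))
    · intro x hx y hy
      simp only [Gr, div_one]
      rw [← pow_add, abs_mul, abs_of_nonneg (by positivity), show 1 + (b+1) = b+2 by ring]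
      exact (min_le_right _ _).trans (mul_le_mul_of_nonneg_left (hl2 _ _ ((r x hx).trans hε3) ((r y hy).trans hε3)) (by positivity))
  have hl0 : lam * 1 ≠ 0 := by rw [mul_one]; exact abs_pos.1 (by linarith)
  have main := rescale hG hA (by positivity) (by positivity) one_ne_zero (hn _ hyp _ _ (Amp_r hA (-ε) (2*ε) (-ε) (2*ε) (by rwa [abs_of_pos (by positivity)])) _ hl0)
  have e : (fun x y => Complex.exp (Complex.I * lam * G 0 0 x y) * A x y) = bx lam (G 0 0) A (sqr (-ε) (2*ε) (-ε) (2*ε)) := by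
    ext x y
    unfold bx
    by_cases hm : (x,y) ∈ sqr (-ε) (2*ε) (-ε) (2*ε)
    · rw [Set.indicator_of_mem hm]
    · rw [Set.indicator_of_notMem hm, hs x y, mul_zero]
      by_contra hcon
      push Not at hcon
      apply hm
      have q : ∀ t : ℝ, |t| < ε → (t - -ε)/(2*ε) ∈ Set.Ico (0:ℝ) 1 := by
        intro t ht
        have := abs_lt.1 ht
        exact ⟨div_nonneg (by linarith) (by linarith), by rw [div_lt_one (by linarith)]; linarith⟩
      exact ⟨q x hcon.1, q y hcon.2⟩
  rw [e]
  refine main.mono ?_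
  rw [mul_one, mul_assoc]
  refine mul_le_mul_of_nonneg_left (mul_le_mul_of_nonneg_left ((min_le_right _ _).trans (lam_le hlam ?_)) hC) (by positivity)
  have ha' : (1:ℝ) ≤ a := by exact_mod_cast ha
  have hb' : (1:ℝ) ≤ b := by exact_mod_cast hb
  rw [div_le_div_iff₀ (by positivity) (by positivity)]
  nlinarith

lemma amp_of {a : ℝ × ℝ → ℂ} (ha : ContDiff ℝ (⊤ : ℕ∞) a) (hc : HasCompactSupport a) : ∃ A1 A2 A0, Amp (fun x y => a (x,y)) A1 A0 ∧ Amp A1 A2 A0 := by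
  have step : ∀ b : ℝ × ℝ → ℂ, ContDiff ℝ (⊤ : ℕ∞) b → HasCompactSupport b → ContDiff ℝ (⊤ : ℕ∞) (fun z => fderiv ℝ b z (1,0)) ∧
      HasCompactSupport (fun z => fderiv ℝ b z (1,0)) ∧ (∃ M, ∀ z, ‖b z‖ ≤ M) ∧ ∀ y x, HasDerivAt (fun x => b (x,y)) (fderiv ℝ b (x,y) (1,0)) x := by
    intro b hb hc
    refine ⟨(hb.fderiv_right (m := (⊤ : ℕ∞)) (by simp)).clm_apply contDiff_const, hc.fderiv_apply ℝ (1,0), hc.exists_bound_of_continuous hb.continuous, ?_⟩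
    intro y x
    exact ((hb.differentiable (by simp)) (x,y)).hasFDerivAt.comp_hasDerivAt x ((hasDerivAt_id x).prodMk (hasDerivAt_const x y))
  obtain ⟨s1, c1, ⟨M0, h0⟩, d0⟩ := step a ha hc
  obtain ⟨s2, c2, ⟨M1, h1⟩, d1⟩ := step _ s1 c1
  obtain ⟨s3, c3, ⟨M2, h2⟩, d2⟩ := step _ s2 c2
  have p0 := (norm_nonneg _).trans (h0 0)
  have p1 := (norm_nonneg _).trans (h1 0)
  have p2 := (norm_nonneg _).trans (h2 0)
  exact ⟨_, _, M0 + M1 + M2, 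
    ⟨d0, ha.continuous, s1.continuous, fun x y => (h0 (x,y)).trans (by linarith), fun x y => (h1 (x,y)).trans (by linarith)⟩,
    ⟨d1, s1.continuous, s2.continuous, fun x y => (h1 (x,y)).trans (by linarith), fun x y => (h2 (x,y)).trans (by linarith)⟩⟩

lemma allcases {G c s F} (hG : Fam G) (hS : Ser (fun α β => G (α+1) (β+1)) c s) (hF : Nw c F) :
    ∃ ε > (0:ℝ), ∀ A0 : ℝ, ∃ C : ℝ, ∀ A A1 A2, Amp A A1 A0 → Amp A1 A2 A0 → (∀ x y, ε ≤ |x| ∨ ε ≤ |y| → A x y = 0) → ∀ lam : ℝ, 1 ≤ |lam| →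
      Bd (fun x y => Complex.exp (Complex.I * lam * G 0 0 x y) * A x y) (C * |lam|^(-(1/(2*(1+nd c))))) := by
  have hz : ∀ α β, c α β ≠ 0 → G (α+1) (β+1) 0 0 ≠ 0 := by
    intro α β h
    have := hS.zero α β
    rw [this]; positivity
  by_cases h0 : c 0 0 = 0
  swap
  · exact case0 hG (nd_nonneg hF) (hz 0 0 h0)
  by_cases hex : ∃ a b : ℕ, 1 ≤ a ∧ 1 ≤ b ∧ c a 0 ≠ 0 ∧ c 0 b ≠ 0 ∧ (a:ℝ)*b ≤ nd c*(a+b)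
  · obtain ⟨a, b, ha, hb, h1, h2, hab⟩ := hex
    obtain ⟨ε, hε, h⟩ := caseS hG (nd_nonneg hF) ha hb (hz a 0 h1) (hz 0 b h2) hab
    refine ⟨ε, hε, fun A0 => ?_⟩
    obtain ⟨C, hC⟩ := h A0
    exact ⟨C, fun A A1 A2 hA _ => hC A A1 hA⟩
  · have hd : 0 < nd c := by
      have := nd_lb hF (ξ := 1) (ζ := 1) (μ := 1) zero_le_one zero_le_one ?_
      · linarith
      · intro m hm
        have := hF.nz m hm
        have h1 : 1 ≤ m.1 + m.2 := by
          by_contra hcon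
          have e1 : m.1 = 0 := by omega
          have e2 : m.2 = 0 := by omega
          rw [e1, e2] at this
          exact this h0
        rw [one_mul, one_mul]; exact_mod_cast h1
    obtain ⟨ε, hε, h⟩ := caseG hG hS hF (fun a b ha hb h1 h2 => by
      by_contra hcon
      push Not at hcon
      exact hex ⟨a, b, ha, hb, h1, h2, hcon⟩) hd
    refine ⟨ε, hε, fun A0 => ?_⟩
    obtain ⟨C, hC⟩ := h A0
    exact ⟨C, fun A A1 A2 hA _ => hC A A1 hA⟩

lemma phong_aux (S : ℝ × ℝ → ℝ) (hS : ∀ z : ℝ × ℝ, AnalyticAt ℝ S z)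
    (hnz : ∀ ε > (0 : ℝ), ∃ z : ℝ × ℝ, ‖z‖ < ε ∧ pdx (pdy S) z ≠ 0) :
    ∃ s F, Ser (fun α β => GS S (α+1) (β+1)) (taylorCoef (pdx (pdy S))) s ∧ Nw (taylorCoef (pdx (pdy S))) F := by
  set P := pdx (pdy S) with hP
  have hPa : ∀ z, AnalyticAt ℝ P z := pdx_an (pdy_an hS)
  obtain ⟨c, A, ρ, s, hs0, hs1, hA, hρ, hρs, hc, h0⟩ := ps (hPa 0)
  have ser := ser_of (GS_fam hPa) hs0 hs1 hA hρ hρs hc h0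
  have hct : c = taylorCoef P := by
    funext p q
    have := ser.zero p q
    unfold taylorCoef
    change c p q = GS P p q 0 0 / _
    rw [this]; field_simp
  have e : (fun α β => GS S (α+1) (β+1)) = GS P := by
    funext α β; exact GS_P hS α β
  have hne : ∃ p q, c p q ≠ 0 := by
    by_contra hcon
    push Not at hcon
    obtain ⟨z, hz, hz'⟩ := hnz s hs0
    apply hz'
    rw [Prod.norm_def] at hz
    have := h0 z.1 z.2 ((le_max_left _ _).trans hz.le) ((le_max_right _ _).trans hz.le)
    simpa [hcon] using this
  obtain ⟨F, hF⟩ := exF c hne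
  rw [e, ← hct]
  exact ⟨s, F, ser, hF⟩

/-- The sharp `L²` estimate of Phong and Stein for oscillatory
integral operators with real analytic phase in two dimensions, with the decay
exponent `1/(2δ_S)` given by the Newton distance of `∂ₓ∂_y S`. -/
theorem phong_stein_sharp_L2
    (S : ℝ × ℝ → ℝ) (hS : ∀ z : ℝ × ℝ, AnalyticAt ℝ S z)
    (hnz : ∀ ε > (0 : ℝ), ∃ z : ℝ × ℝ, ‖z‖ < ε ∧ pdx (pdy S) z ≠ 0)
    (δS : ℝ)
    (hδS : δS = 1 + sInf {t : ℝ |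
      ((t, t) : ℝ × ℝ) ∈ convexHull ℝ (newtonQuadrants (pdx (pdy S)))}) :
    ∃ ε > (0 : ℝ), ∀ a : ℝ × ℝ → ℂ, ContDiff ℝ (⊤ : ℕ∞) a →
      tsupport a ⊆ {z : ℝ × ℝ | |z.1| < ε ∧ |z.2| < ε} →
      ∃ C : ℝ, ∀ lam : ℝ, 1 ≤ |lam| →
        ∀ f : Lp ℂ 2 (volume : Measure ℝ),
          eLpNorm (fun x : ℝ => ∫ y : ℝ,
              Complex.exp (Complex.I * lam * S (x, y)) * f y * a (x, y)) 2
              (volume : Measure ℝ) ≤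
            ENNReal.ofReal (C * |lam| ^ (-(1 / (2 * δS))) * ‖f‖) := by
  obtain ⟨s, F, ser, hF⟩ := phong_aux S hS hnz
  obtain ⟨ε, hε, h⟩ := allcases (GS_fam hS) ser hF
  refine ⟨ε, hε, ?_⟩
  intro a ha hsupp
  have hc : HasCompactSupport a := by
    refine (isCompact_closedBall (0 : ℝ × ℝ) ε).of_isClosed_subset (isClosed_tsupport a) (hsupp.trans ?_)
    rintro z ⟨h1, h2⟩
    rw [mem_closedBall_zero_iff, Prod.norm_def]
    exact max_le h1.le h2.le
  obtain ⟨A1, A2, A0, hA, hA1⟩ := amp_of ha hc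
  obtain ⟨C, hC⟩ := h A0
  refine ⟨|C|, ?_⟩
  intro lam hlam f
  have hz : ∀ x y, ε ≤ |x| ∨ ε ≤ |y| → a (x, y) = 0 := by
    intro x y hxy
    by_contra hne
    have := hsupp (subset_tsupport a hne)
    rcases hxy with h | h
    · exact absurd this.1 (not_lt.2 h)
    · exact absurd this.2 (not_lt.2 h)
  have hb := (hC _ A1 A2 hA hA1 hz lam hlam).mono (mul_le_mul_of_nonneg_right (le_abs_self C) (by positivity)) f (Lp.memLp f)
  have e : (fun x : ℝ => ∫ y : ℝ, Complex.exp (Complex.I * lam * S (x, y)) * f y * a (x, y)) =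
      Tp (fun x y => Complex.exp (Complex.I * lam * GS S 0 0 x y) * a (x, y)) f := by
    funext x
    unfold Tp
    congr 1
    funext y
    simp only [GS, Function.iterate_zero, id]
    ring
  rw [e, ENNReal.ofReal_mul (by positivity), Lp.norm_def, ENNReal.ofReal_toReal (Lp.eLpNorm_ne_top f), hδS]
  exact hb
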